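/- Let d ≥ 1, δ ∈ (0,1], p ∈ (1,∞) and β > 0. Then there exist constants â = â(d,δ,p,β) > 0 and N = N(d,δ,p,β) such that for every measurable a : ℝ^{1+d} → 𝕊_δ with a^♯ ≤ â, every λ ≥ 0 and every u ∈ C₀^∞(ℝ^{1+d}), λ‖u‖_{Ė_{p,β}} + √λ ‖Du‖_{Ė_{p,β}} + ‖∂_t u‖_{Ė_{p,β}} + ‖D²u‖_{Ė_{p,β}} ≤ N ‖∂_t u + Σ_{i,j} a^{ij}(t,x) D_{ij}u − λu‖_{Ė_{p,β}}. -/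

import Mathlib

open MeasureTheory Metric Set
open scoped ENNReal NNReal

noncomputable section

abbrev Spc (d : ℕ) : Type := EuclideanSpace ℝ (Fin d)

abbrev Pt (d : ℕ) : Type := ℝ × Spc d

instance matrixMeasurableSpace (d : ℕ) : MeasurableSpace (Matrix (Fin d) (Fin d) ℝ) :=
  (inferInstance : MeasurableSpace (Fin d → Fin d → ℝ))

/-- Membership in `𝕊_δ`: symmetric `d×d` matrices with
`δ|ξ|² ≤ (aξ,ξ) ≤ δ⁻¹|ξ|²`. -/
def inS (d : ℕ) (δ : ℝ) (a : Matrix (Fin d) (Fin d) ℝ) : Prop :=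
  a.IsSymm ∧ ∀ ξ : Fin d → ℝ,
    δ * (∑ i, ξ i ^ 2) ≤ (∑ i, ∑ j, a i j * ξ i * ξ j) ∧
    (∑ i, ∑ j, a i j * ξ i * ξ j) ≤ δ⁻¹ * (∑ i, ξ i ^ 2)

/-- `{a,u} = a^{ij} a^{kr} u_{ik} u_{jr}`. -/
def bra (d : ℕ) (a u : Matrix (Fin d) (Fin d) ℝ) : ℝ :=
  ∑ i, ∑ j, ∑ k, ∑ r, a i j * a k r * u i k * u j r

/-- Frobenius norm of a `d×d` array. -/
def mnorm {d : ℕ} (m : Fin d → Fin d → ℝ) : ℝ :=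
  Real.sqrt (∑ i, ∑ j, m i j ^ 2)

/-- Euclidean norm of a vector given as `Fin d → ℝ`. -/
def vnorm {d : ℕ} (v : Fin d → ℝ) : ℝ :=
  Real.sqrt (∑ i, v i ^ 2)

/-- Parabolic cylinder `C_R(t,x) = (t, t+R²) × B_R(x)`. -/
def cyl (d : ℕ) (R t : ℝ) (x : Spc d) : Set (Pt d) :=
  Ioo t (t + R ^ 2) ×ˢ ball x R

/-- Time derivative `∂_t u`. -/
def Dt {d : ℕ} (u : Pt d → ℝ) (z : Pt d) : ℝ :=
  deriv (fun s => u (s, z.2)) z.1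

/-- Spatial derivative `D_i u`. -/
def Dx {d : ℕ} (i : Fin d) (u : Pt d → ℝ) (z : Pt d) : ℝ :=
  fderiv ℝ (fun y => u (z.1, y)) z.2 (EuclideanSpace.single i 1)

/-- Second spatial derivative `D_{ij} u = D_i D_j u`. -/
def Dxx {d : ℕ} (i j : Fin d) (u : Pt d → ℝ) : Pt d → ℝ :=
  Dx i (Dx j u)

/-- `u ∈ C₀^∞(ℝ^{1+d})`. -/
def CinfC {d : ℕ} (u : Pt d → ℝ) : Prop :=
  ContDiff ℝ (⊤ : ℕ∞) u ∧ HasCompactSupport u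

/-- The kernel `p_{α,k}(s,r)`. -/
def pak (d : ℕ) (α k s r : ℝ) : ℝ :=
  if 0 < s then s ^ (-((d : ℝ) + 2 - α) / 2) * Real.exp (-(r ^ 2) / (k * s)) else 0

/-- Parabolic distance to the origin `ρ(t,x) = |x| + √|t|`. -/
def prho {d : ℕ} (z : Pt d) : ℝ := ‖z.2‖ + Real.sqrt |z.1|

/-- Average of (the positive part of) `g` over `C`, valued in `ℝ≥0∞`. -/
def aveLin {d : ℕ} (C : Set (Pt d)) (g : Pt d → ℝ) : ℝ≥0∞ :=
  (volume C)⁻¹ * ∫⁻ z in C, ENNReal.ofReal (g z)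

/-- Parabolic maximal function `𝕄_β g` (for `g ≥ 0`). -/
def maxF {d : ℕ} (β : ℝ) (g : Pt d → ℝ) (z : Pt d) : ℝ≥0∞ :=
  ⨆ (ρ : ℝ) (_ : 0 < ρ) (t : ℝ) (x : Spc d) (_ : z ∈ cyl d ρ t x),
    ENNReal.ofReal (ρ ^ β) * aveLin (cyl d ρ t x) g

/-- Oscillation of a matrix-valued function over `C`. -/
def oscC {d : ℕ} (C : Set (Pt d)) (g : Pt d → Fin d → Fin d → ℝ) : ℝ :=
  ⨍ z₁ in C, ⨍ z₂ in C, mnorm (fun i j => g z₁ i j - g z₂ i j)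

/-- Mixed norm `‖f‖_{𝕃_{q,p}}` (inner integration in `t`, outer in `x`). -/
def mixedNorm {d : ℕ} (q p : ℝ) (f : Pt d → ℝ) : ℝ :=
  (∫ x : Spc d, (∫ t : ℝ, |f (t, x)| ^ q) ^ (p / q)) ^ (1 / p)

/-- Mixed norm on a set `Γ`. -/
def mixedNormOn {d : ℕ} (q p : ℝ) (Γ : Set (Pt d)) (f : Pt d → ℝ) : ℝ :=
  mixedNorm q p (Γ.indicator f)

/-- Normalized (averaged) mixed norm over the cylinder `C_R(t,x)`, in `ℝ≥0∞`. -/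
def cylNormL {d : ℕ} (q p R t : ℝ) (x : Spc d) (f : Pt d → ℝ) : ℝ≥0∞ :=
  ((volume (ball x R))⁻¹ * ∫⁻ y in ball x R,
      ((volume (Ioo t (t + R ^ 2)))⁻¹ * ∫⁻ s in Ioo t (t + R ^ 2),
        ENNReal.ofReal |f (s, y)| ^ q) ^ (p / q)) ^ (1 / p)

/-- Mixed norm on a set, valued in `ℝ≥0∞`. -/
def mixedNormLe {d : ℕ} (q p : ℝ) (Γ : Set (Pt d)) (f : Pt d → ℝ) : ℝ≥0∞ :=
  (∫⁻ x : Spc d, (∫⁻ t : ℝ, ENNReal.ofReal |Γ.indicator f (t, x)| ^ q) ^ (p / q)) ^ (1 / p)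

/-- `ã_C(t)`: average of `a(t,·)` over the ball of the cylinder. -/
def aTilde {d : ℕ} (a : Pt d → Matrix (Fin d) (Fin d) ℝ) (R : ℝ) (x₀ : Spc d) (t : ℝ)
    (i j : Fin d) : ℝ :=
  ⨍ y in ball x₀ R, a (t, y) i j

/-- The mean oscillation of `a` w.r.t. `x` over one cylinder. -/
def aSharpCyl {d : ℕ} (a : Pt d → Matrix (Fin d) (Fin d) ℝ) (R t₀ : ℝ) (x₀ : Spc d) : ℝ≥0∞ :=
  (volume (cyl d R t₀ x₀))⁻¹ * ∫⁻ z in cyl d R t₀ x₀,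
    ENNReal.ofReal (mnorm (fun i j => a z i j - aTilde a R x₀ z.1 i j))

/-- `a^♯`. -/
def aSharp {d : ℕ} (a : Pt d → Matrix (Fin d) (Fin d) ℝ) : ℝ≥0∞ :=
  ⨆ (R : ℝ) (_ : 0 < R) (t₀ : ℝ) (x₀ : Spc d), aSharpCyl a R t₀ x₀

/-- `a^♯_ρ` (only cylinders of radius `≤ ρa`). -/
def aSharpRho {d : ℕ} (a : Pt d → Matrix (Fin d) (Fin d) ℝ) (ρa : ℝ) : ℝ≥0∞ :=
  ⨆ (R : ℝ) (_ : 0 < R) (_ : R ≤ ρa) (t₀ : ℝ) (x₀ : Spc d), aSharpCyl a R t₀ x₀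

/-- Homogeneous Morrey norm `‖g‖_{Ė_{p,β}}`. -/
def morreyP {d : ℕ} (p β : ℝ) (g : Pt d → ℝ) : ℝ≥0∞ :=
  ⨆ (ρ : ℝ) (_ : 0 < ρ) (t : ℝ) (x : Spc d),
    ENNReal.ofReal (ρ ^ β) *
      ((volume (cyl d ρ t x))⁻¹ * ∫⁻ z in cyl d ρ t x, ENNReal.ofReal |g z| ^ p) ^ (1 / p)

/-- Homogeneous mixed-norm Morrey norm `‖g‖_{Ė_{q,p,β}}`. -/
def morreyQP {d : ℕ} (q p β : ℝ) (g : Pt d → ℝ) : ℝ≥0∞ :=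
  ⨆ (ρ : ℝ) (_ : 0 < ρ) (t : ℝ) (x : Spc d),
    ENNReal.ofReal (ρ ^ β) * cylNormL q p ρ t x g

/-- Inhomogeneous mixed-norm Morrey norm `‖g‖_{E_{q,p,β}}` (radii `ρ ∈ (0,1]`). -/
def morreyI {d : ℕ} (q p β : ℝ) (g : Pt d → ℝ) : ℝ≥0∞ :=
  ⨆ (ρ : ℝ) (_ : 0 < ρ) (_ : ρ ≤ 1) (t : ℝ) (x : Spc d),
    ENNReal.ofReal (ρ ^ β) * cylNormL q p ρ t x g

/-- `b̄_{q',p',ρb}` for a vector field `b`. -/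
def bBar {d : ℕ} (q' p' : ℝ) (b : Pt d → Fin d → ℝ) (ρb : ℝ) : ℝ≥0∞ :=
  ⨆ (R : ℝ) (_ : 0 < R) (_ : R ≤ ρb) (t : ℝ) (x : Spc d),
    ENNReal.ofReal R * cylNormL q' p' R t x (fun z => vnorm (b z))

/-- Test function supported in the open set `Q`. -/
def IsTest {d : ℕ} (Q : Set (Pt d)) (φ : Pt d → ℝ) : Prop :=
  ContDiff ℝ (⊤ : ℕ∞) φ ∧ HasCompactSupport φ ∧ tsupport φ ⊆ Q

/-- `ut` is the weak time derivative of `u` on `Q`. -/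
def WeakDtOn {d : ℕ} (Q : Set (Pt d)) (u ut : Pt d → ℝ) : Prop :=
  ∀ φ, IsTest Q φ → ∫ z in Q, u z * Dt φ z = - ∫ z in Q, ut z * φ z

/-- `ui` is the weak `i`-th spatial derivative of `u` on `Q`. -/
def WeakDxOn {d : ℕ} (Q : Set (Pt d)) (i : Fin d) (u ui : Pt d → ℝ) : Prop :=
  ∀ φ, IsTest Q φ → ∫ z in Q, u z * Dx i φ z = - ∫ z in Q, ui z * φ z

section
open ENNReal (mul_rpow_of_nonneg ofReal ofReal_add ofReal_div_of_pos ofReal_eq_zero ofReal_inv_of_pos ofReal_le_ofReal ofReal_le_ofReal_iff ofReal_lt_ofReal_iff ofReal_lt_top ofReal_mul ofReal_natCast ofReal_ne_top ofReal_ofNat ofReal_one ofReal_rpow_of_nonneg ofReal_rpow_of_pos ofReal_toReal ofReal_tsum_of_nonneg ofReal_zero toReal_nonneg)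
open Real (exp cos sqrt)
open scoped Real
variable {d : ℕ}

abbrev Mx (d : ℕ) := Matrix (Fin d) (Fin d) ℝ

lemma eof {α : Type*} {p : α → Prop} {f : Filter α} (h : ∀ x, p x) : ∀ᶠ x in f, p x := .of_forall h

def pc (z : Pt d) (r : ℝ) : Set (Pt d) :=
  Ioo (z.1 - r ^ 2) (z.1 + r ^ 2) ×ˢ ball z.2 r

def vv (d : ℕ) : ℝ := 2 * (volume (ball (0 : Spc d) 1)).toReal

lemma vv_pos (d : ℕ) : 0 < vv d := by
  unfold vv
  have : 0 < (volume (ball (0 : Spc d) 1)).toReal :=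
    ENNReal.toReal_pos (measure_ball_pos _ _ one_pos).ne' measure_ball_lt_top.ne
  positivity

lemma vol_pc (z : Pt d) {r : ℝ} (hr : 0 < r) :
    volume (pc z r) = ofReal (vv d * r ^ (d + 2)) := by
  unfold pc vv
  rw [Measure.volume_eq_prod, Measure.prod_prod, Real.volume_Ioo,
    Measure.addHaar_ball_of_pos _ _ hr, finrank_euclideanSpace_fin]
  have h : volume (ball (0 : Spc d) 1) = ofReal (volume (ball (0 : Spc d) 1)).toReal :=
    (ofReal_toReal measure_ball_lt_top.ne).symm
  rw [h, ← ofReal_mul (by positivity), ← ofReal_mul (by nlinarith [sq_nonneg r]),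
    ENNReal.toReal_ofReal toReal_nonneg]
  congr 1; ring

lemma vol_pc_ne_top (z : Pt d) (r : ℝ) : volume (pc z r) ≠ ⊤ := by
  unfold pc
  rw [Measure.volume_eq_prod, Measure.prod_prod]
  exact ENNReal.mul_ne_top (by simp) measure_ball_lt_top.ne

lemma vol_pc_pos (z : Pt d) {r : ℝ} (hr : 0 < r) : volume (pc z r) ≠ 0 := by
  rw [vol_pc z hr]
  have := vv_pos d
  simp only [ne_eq, ofReal_eq_zero, not_le]; positivity

lemma isOpen_pc (z : Pt d) (r : ℝ) : IsOpen (pc z r) := isOpen_Ioo.prod isOpen_ball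

lemma meas_pc (z : Pt d) (r : ℝ) : MeasurableSet (pc z r) := (isOpen_pc z r).measurableSet

lemma mem_pc {z w : Pt d} {r : ℝ} :
    w ∈ pc z r ↔ |w.1 - z.1| < r ^ 2 ∧ ‖w.2 - z.2‖ < r := by
  unfold pc
  rw [Set.mem_prod, mem_Ioo, mem_ball, dist_eq_norm, abs_lt]
  constructor <;> rintro ⟨⟨h1, h2⟩, h3⟩ <;> exact ⟨⟨by linarith, by linarith⟩, h3⟩

lemma self_mem_pc (z : Pt d) {r : ℝ} (hr : 0 < r) : z ∈ pc z r := by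
  rw [mem_pc]; simp [hr, pow_pos hr]

/-- enlargement -/
lemma pc_sub {z w : Pt d} {r s t : ℝ} (hr : 0 < r) (hs : 0 < s) (hw : w ∈ pc z r) (h : r + s ≤ t) :
    pc w s ⊆ pc z t := by
  intro y hy
  rw [mem_pc] at *
  constructor
  · have : |y.1 - z.1| ≤ |y.1 - w.1| + |w.1 - z.1| := abs_sub_le _ _ _
    nlinarith
  · have : ‖y.2 - z.2‖ ≤ ‖y.2 - w.2‖ + ‖w.2 - z.2‖ := norm_sub_le_norm_sub_add_norm_sub _ _ _
    linarith

lemma pc_mono {z : Pt d} {r s : ℝ} (hr : 0 < r) (h : r ≤ s) : pc z r ⊆ pc z s := by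
  intro y hy
  rw [mem_pc] at *
  exact ⟨hy.1.trans_le (by nlinarith), hy.2.trans_le h⟩

/-- Integral of q-th power -/
def LI (q : ℝ) (H : Pt d → ℝ) (D : Set (Pt d)) : ℝ≥0∞ :=
  ∫⁻ w in D, ofReal (H w) ^ q

def MB (p e : ℝ) (H : Pt d → ℝ) (X : ℝ) : Prop :=
  ∀ z : Pt d, ∀ r : ℝ, 0 < r → LI p H (pc z r) ≤ ofReal (X * r ^ e)

lemma holder_avg {q p : ℝ} (hq : 0 < q) (hqp : q ≤ p) {H : Pt d → ℝ} (hH : Measurable H)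
    (D : Set (Pt d)) {s : ℝ}
    (h : LI p H D ≤ ofReal s ^ p * volume D) :
    LI q H D ≤ ofReal s ^ q * volume D := by
  have hp : 0 < p := hq.trans_le hqp
  unfold LI at *
  rcases eq_or_lt_of_le hqp with rfl | hlt
  · exact h
  have hpq : (p / q).HolderConjugate (Real.conjExponent (p / q)) :=
    Real.HolderConjugate.conjExponent (by rw [lt_div_iff₀ hq]; linarith)
  have := ENNReal.lintegral_mul_le_Lp_mul_Lq (volume.restrict D) hpq
    (f := fun w => ofReal (H w) ^ q) (g := fun _ => 1)
    (hH.ennreal_ofReal.pow_const q).aemeasurable aemeasurable_const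
  simp only [Pi.mul_apply, mul_one, ENNReal.one_rpow, lintegral_const, one_mul,
    Measure.restrict_apply_univ, ← ENNReal.rpow_mul] at this
  rw [mul_div_cancel₀ _ hq.ne'] at this
  refine this.trans ?_
  calc _ ≤ (ofReal s ^ p * volume D) ^ (1 / (p / q)) * volume D ^ (1 / (p / q).conjExponent) := by
        gcongr
    _ = _ := by
        rw [mul_rpow_of_nonneg _ _ (by positivity), ← ENNReal.rpow_mul, mul_assoc]
        congr 1
        · congr 1; field_simp
        · have h1 := hpq.inv_add_inv_eq_one
          rw [← ENNReal.rpow_add_of_nonneg]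
          · rw [one_div, one_div, h1, ENNReal.rpow_one]
          · positivity
          · have := hpq.symm.pos; positivity

lemma cake {α : Type*} [MeasurableSpace α] (μ : Measure α) {g : α → ℝ} (hg : Measurable g)
    (h0 : ∀ x, 0 ≤ g x) {a : ℝ} (ha : 0 < a) :
    ofReal a * ∫⁻ s in Ioi (0:ℝ), μ {x | s < g x} * ofReal (s ^ (a - 1)) =
      ∫⁻ x, ofReal (g x) ^ a ∂μ := by
  rw [← lintegral_rpow_eq_lintegral_meas_lt_mul μ (eof h0) hg.aemeasurable ha]
  congr 1; ext x; rw [ofReal_rpow_of_nonneg (h0 x) ha.le]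

def Gd (q : ℝ) (H : Pt d → ℝ) (s : ℝ) (z : Pt d) (r : ℝ) : Prop :=
  LI q H (pc z r) ≤ ofReal s ^ q * volume (pc z r)

def GG (q K η γ : ℝ) (H f : Pt d → ℝ) : Prop :=
  ∀ z r s, 0 < r → 0 < s → (∀ k : ℕ, 1 ≤ k → Gd q H s z (2 ^ k * r) ∧ Gd q f (γ * s) z (2 ^ k * r)) →
    volume {w ∈ pc z (4 * r) | K * s < H w} ≤ ofReal η * volume (pc z r)

/-- from bad cylinder to upper level set -/
lemma bad_est {q : ℝ} (hq : 1 ≤ q) {H : Pt d → ℝ} (hH : Measurable H) {s : ℝ} (hs : 0 < s)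
    {z : Pt d} {r : ℝ} (h : ¬ Gd q H s z r) :
    volume (pc z r) ≤ 2 * (ofReal s ^ q)⁻¹ * LI q H (pc z r ∩ {w | s / 2 < H w}) := by
  unfold Gd at h; push Not at h
  set S := ofReal s ^ q with hS
  have hS0 : S ≠ 0 := by simp [hS, hs]
  have hSt : S ≠ ⊤ := by simp [hS, hs, (by linarith : (0:ℝ) ≤ q)]
  have hm : MeasurableSet {w | s / 2 < H w} := measurableSet_lt measurable_const hH
  have hsplit : LI q H (pc z r) ≤ LI q H (pc z r ∩ {w | s / 2 < H w}) + 2⁻¹ * S * volume (pc z r) := by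
    unfold LI
    rw [← lintegral_inter_add_sdiff _ (pc z r) hm]
    gcongr
    calc ∫⁻ w in pc z r \ {w | s / 2 < H w}, ofReal (H w) ^ q
        ≤ ∫⁻ w in pc z r \ {w | s / 2 < H w}, 2⁻¹ * S := by
          refine setLIntegral_mono' ((meas_pc z r).diff hm) fun w hw => ?_
          have h1 : H w ≤ s / 2 := by simpa using hw.2
          calc ofReal (H w) ^ q ≤ ofReal (s / 2) ^ q := by gcongr
            _ = (2⁻¹) ^ q * S := by
                rw [hS, ← mul_rpow_of_nonneg _ _ (by linarith), div_eq_inv_mul,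
                  ofReal_mul (by norm_num)]
                congr 2; rw [ofReal_inv_of_pos (by norm_num)]; simp
            _ ≤ 2⁻¹ * S := by
                gcongr
                calc (2⁻¹ : ℝ≥0∞) ^ q ≤ 2⁻¹ ^ (1:ℝ) :=
                      ENNReal.rpow_le_rpow_of_exponent_ge (by simp) hq
                  _ = _ := by simp
      _ = 2⁻¹ * S * volume (pc z r \ {w | s / 2 < H w}) := by simp
      _ ≤ _ := by gcongr; exact sdiff_subset
  have h2 := h.le.trans hsplit
  have hv := vol_pc_ne_top z r
  have h3 : S * volume (pc z r) = 2⁻¹ * S * volume (pc z r) + 2⁻¹ * S * volume (pc z r) := by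
    rw [← add_mul, ← add_mul, ENNReal.inv_two_add_inv_two, one_mul]
  rw [h3] at h2
  have h4 : 2⁻¹ * S * volume (pc z r) ≤ LI q H (pc z r ∩ {w | s / 2 < H w}) := by
    refine ENNReal.le_of_add_le_add_right ?_ h2
    exact ENNReal.mul_ne_top (ENNReal.mul_ne_top (by simp) hSt) hv
  calc volume (pc z r) = 2 * S⁻¹ * (2⁻¹ * S * volume (pc z r)) := by
        rw [show 2 * S⁻¹ * (2⁻¹ * S * volume (pc z r)) = (2 * 2⁻¹) * (S⁻¹ * S) * volume (pc z r) by ring,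
          ENNReal.mul_inv_cancel (by simp) (by simp), ENNReal.inv_mul_cancel hS0 hSt]; simp
    _ ≤ _ := by gcongr

lemma exists_bad {q : ℝ} (hq : 1 ≤ q) {H : Pt d → ℝ} (hH : Continuous H) {s : ℝ} (hs : 0 < s)
    {z : Pt d} (hz : s < H z) {R : ℝ} (hR : 0 < R) : ∃ n : ℕ, ¬ Gd q H s z (2⁻¹ ^ n * R) := by
  obtain ⟨m, hm1, hm2⟩ := exists_between hz
  have ho : IsOpen {w | m < H w} := isOpen_lt continuous_const hH
  obtain ⟨ε, hε, hb⟩ := Metric.isOpen_iff.1 ho z hm2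
  obtain ⟨n, hn⟩ : ∃ n : ℕ, 2⁻¹ ^ n * R < min ε 1 := by
    have : Filter.Tendsto (fun n : ℕ => (2⁻¹ : ℝ) ^ n * R) Filter.atTop (nhds (0 * R)) :=
      (tendsto_pow_atTop_nhds_zero_of_lt_one (by norm_num) (by norm_num)).mul_const R
    rw [zero_mul] at this
    exact (this.eventually_lt_const (by positivity)).exists
  refine ⟨n, ?_⟩
  set r := 2⁻¹ ^ n * R with hr
  have hr0 : 0 < r := by positivity
  have hsub : pc z r ⊆ {w | m < H w} := by
    refine Subset.trans ?_ hb
    intro w hw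
    rw [mem_pc] at hw
    have h1 : r < ε := hn.trans_le (min_le_left _ _)
    have h2 : r < 1 := hn.trans_le (min_le_right _ _)
    rw [mem_ball, dist_eq_norm, Prod.norm_def, max_lt_iff]
    refine ⟨?_, hw.2.trans h1⟩
    simp only [Prod.fst_sub, Real.norm_eq_abs]
    nlinarith [hw.1]
  unfold Gd; push Not
  calc ofReal s ^ q * volume (pc z r) < ofReal m ^ q * volume (pc z r) := by
        refine ENNReal.mul_lt_mul_left (vol_pc_pos z hr0) (vol_pc_ne_top z r) ?_
        exact ENNReal.rpow_lt_rpow ((ofReal_lt_ofReal_iff (hs.trans hm1)).2 hm1) (by linarith)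
    _ = ∫⁻ w in pc z r, ofReal m ^ q := by simp
    _ ≤ LI q H (pc z r) := by
        refine setLIntegral_mono' (meas_pc z r) fun w hw => ?_
        have : m < H w := hsub hw
        gcongr

lemma AM_level {q K η γ : ℝ} (hq : 1 ≤ q) (hK : 1 ≤ K) (hγ : 0 < γ)
    {H f : Pt d → ℝ} (hH : Continuous H) (hf : Measurable f)
    (hG : GG q K η γ H f) (z0 : Pt d) {ρ R s : ℝ} (hρ : 0 < ρ) (hR : ρ ≤ R) (hs : 0 < s)
    (hgood : ∀ z r, R ≤ r → Gd q H s z r ∧ Gd q f (γ * s) z r) :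
    volume {w ∈ pc z0 ρ | K * s < H w} ≤ ofReal η *
      (2 * (ofReal s ^ q)⁻¹ * LI q H (pc z0 (2 * R) ∩ {w | s / 2 < H w}) +
       2 * (ofReal (γ * s) ^ q)⁻¹ * LI q f (pc z0 (2 * R) ∩ {w | γ * s / 2 < f w})) := by
  classical
  have hR0 : 0 < R := hρ.trans_le hR
  set E := {w ∈ pc z0 ρ | K * s < H w} with hE
  have hex : ∀ z ∈ E, ∃ n : ℕ, ¬ (Gd q H s z (2⁻¹ ^ n * R) ∧ Gd q f (γ * s) z (2⁻¹ ^ n * R)) := by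
    intro z hz
    obtain ⟨n, hn⟩ := exists_bad hq hH hs (z := z) (by nlinarith [hz.2]) hR0
    exact ⟨n, fun h => hn h.1⟩
  have hex' : ∀ z, ∃ r, z ∈ E → (0 < r ∧ 2 * r ≤ R ∧ ¬ (Gd q H s z r ∧ Gd q f (γ * s) z r) ∧
      ∀ k : ℕ, 1 ≤ k → Gd q H s z (2 ^ k * r) ∧ Gd q f (γ * s) z (2 ^ k * r)) := by
    intro z
    by_cases hz : z ∈ E
    swap
    · exact ⟨0, fun h => absurd h hz⟩
    set n := Nat.find (hex z hz) with hn
    have h1 := Nat.find_spec (hex z hz)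
    have h2 : ∀ m < n, _ := fun m hm => Nat.find_min (hex z hz) hm
    have hn1 : n ≠ 0 := by
      intro h0
      rw [← hn, h0] at h1
      exact h1 (hgood z _ (by simp))
    refine ⟨2⁻¹ ^ n * R, fun _ => ⟨by positivity, ?_, h1, ?_⟩⟩
    · obtain ⟨m, hm⟩ := Nat.exists_eq_succ_of_ne_zero hn1
      rw [hm, pow_succ]
      have : (2⁻¹ : ℝ) ^ m ≤ 1 := pow_le_one₀ (by norm_num) (by norm_num)
      nlinarith
    · intro k hk
      by_cases hkn : k ≤ n
      · have := h2 (n - k) (by omega)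
        rw [not_not] at this
        have e : (2:ℝ) ^ k * (2⁻¹ ^ n * R) = 2⁻¹ ^ (n - k) * R := by
          rw [← mul_assoc]; congr 1
          obtain ⟨j, hj⟩ := Nat.exists_eq_add_of_le hkn
          rw [hj, Nat.add_sub_cancel_left, pow_add, ← mul_assoc, ← mul_pow]; norm_num
        rwa [e]
      · refine hgood z _ ?_
        obtain ⟨j, rfl⟩ := Nat.exists_eq_add_of_le (le_of_not_ge hkn)
        have : (1:ℝ) ≤ 2 ^ j := one_le_pow₀ (by norm_num)
        have e : (2:ℝ) ^ n * 2⁻¹ ^ n = 1 := by rw [← mul_pow]; norm_num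
        calc R ≤ 2 ^ j * R := by nlinarith
          _ = (2 ^ n * 2⁻¹ ^ n) * (2 ^ j * R) := by rw [e, one_mul]
          _ = _ := by rw [pow_add]; ring
  choose r hr using hex'
  obtain ⟨u, huE, hdisj, hcov⟩ := Vitali.exists_disjoint_subfamily_covering_enlargement
    (fun z => pc z (r z)) E r 2 one_lt_two (fun a ha => (hr a ha).1.le) R
    (fun a ha => by linarith [(hr a ha).2.1, (hr a ha).1])
    (fun a ha => ⟨a, self_mem_pc a (hr a ha).1⟩)
  have hcount : u.Countable := hdisj.countable_of_isOpen (fun z _ => isOpen_pc _ _)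
    (fun a ha => ⟨a, self_mem_pc a (hr a (huE ha)).1⟩)
  have hsubE : E ⊆ ⋃ b ∈ u, {w ∈ pc b (4 * r b) | K * s < H w} := by
    intro a ha
    obtain ⟨b, hb, ⟨c, hca, hcb⟩, hab⟩ := hcov a ha
    simp only [mem_iUnion]
    refine ⟨b, hb, ?_, ha.2⟩
    have hb0 := (hr b (huE hb)).1
    have ha0 := (hr a ha).1
    rw [mem_pc] at *
    constructor
    · have : |a.1 - b.1| ≤ |a.1 - c.1| + |c.1 - b.1| := abs_sub_le _ _ _
      rw [abs_sub_comm a.1 c.1] at this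
      nlinarith
    · have : ‖a.2 - b.2‖ ≤ ‖a.2 - c.2‖ + ‖c.2 - b.2‖ := norm_sub_le_norm_sub_add_norm_sub _ _ _
      rw [norm_sub_rev a.2 c.2] at this
      linarith
  have hsubD : ∀ b ∈ u, pc b (r b) ⊆ pc z0 (2 * R) := fun b hb =>
    pc_sub hρ (hr b (huE hb)).1 (huE hb).1 (by linarith [(hr b (huE hb)).2.1, (hr b (huE hb)).1])
  have hsum : ∀ (g : Pt d → ℝ) (m : ℝ), Measurable g → ∑' b : u, LI q g (pc (b : Pt d) (r b) ∩ {w | m < g w}) ≤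
      LI q g (pc z0 (2 * R) ∩ {w | m < g w}) := by
    intro g m hg
    have hm : MeasurableSet {w | m < g w} := measurableSet_lt measurable_const hg
    unfold LI
    have := hcount.to_subtype
    rw [← lintegral_iUnion (fun b => (meas_pc _ _).inter hm)]
    · refine lintegral_mono_set ?_
      intro w hw
      obtain ⟨b, hb⟩ := mem_iUnion.1 hw
      exact ⟨hsubD b b.2 hb.1, hb.2⟩
    · intro b c hbc
      have := hdisj b.2 c.2 (fun h => hbc (Subtype.ext h))
      exact this.mono inter_subset_left inter_subset_left
  calc volume E ≤ volume (⋃ b ∈ u, {w ∈ pc b (4 * r b) | K * s < H w}) := measure_mono hsubE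
    _ ≤ ∑' b : u, volume {w ∈ pc (b:Pt d) (4 * r b) | K * s < H w} := measure_biUnion_le _ hcount _
    _ ≤ ∑' b : u, ofReal η * (2 * (ofReal s ^ q)⁻¹ * LI q H (pc (b:Pt d) (r b) ∩ {w | s / 2 < H w}) +
       2 * (ofReal (γ * s) ^ q)⁻¹ * LI q f (pc (b:Pt d) (r b) ∩ {w | γ * s / 2 < f w})) := by
        refine ENNReal.tsum_le_tsum fun b => ?_
        obtain ⟨h1, h2, h3, h4⟩ := hr b (huE b.2)
        refine (hG _ _ s h1 hs h4).trans ?_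
        gcongr
        rw [not_and_or] at h3
        rcases h3 with h3 | h3
        · exact (bad_est hq hH.measurable hs h3).trans le_self_add
        · exact (bad_est hq hf (by positivity) h3).trans le_add_self
    _ ≤ _ := by
        rw [ENNReal.tsum_mul_left, ENNReal.tsum_add, ENNReal.tsum_mul_left, ENNReal.tsum_mul_left]
        gcongr
        · exact hsum H _ hH.measurable
        · exact hsum f _ hf

/-- integrated level set piece -/
lemma cake_piece {q p γ : ℝ} (hq : 0 < q) (hqp : q < p) (hγ : 0 < γ) {f : Pt d → ℝ}
    (hf : Measurable f) (h0 : ∀ z, 0 ≤ f z) (D : Set (Pt d)) (hD : MeasurableSet D) :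
    ∫⁻ s in Ioi (0:ℝ), (ofReal (γ * s) ^ q)⁻¹ * LI q f (D ∩ {w | γ * s / 2 < f w}) *
      ofReal (s ^ (p - 1)) =
    ofReal (2 ^ (p - q) / (p - q) / γ ^ p) * LI p f D := by
  have hpq : 0 < p - q := by linarith
  set μ := (volume.restrict D).withDensity (fun w => ofReal (f w) ^ q) with hμ
  have hc := cake μ (g := fun w => 2 * f w / γ) (by fun_prop) (fun w => by have := h0 w; positivity) hpq
  have hmf : Measurable (fun w => ofReal (f w) ^ q) := hf.ennreal_ofReal.pow_const q
  have hset : ∀ s, MeasurableSet {w | s < 2 * f w / γ} := fun s =>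
    measurableSet_lt measurable_const (by fun_prop)
  have h1 : ∀ s ∈ Ioi (0:ℝ), (ofReal (γ * s) ^ q)⁻¹ * LI q f (D ∩ {w | γ * s / 2 < f w}) *
      ofReal (s ^ (p - 1)) = ofReal (γ ^ (-q)) * (μ {x | s < 2 * f x / γ} *
        ofReal (s ^ (p - q - 1))) := by
    intro s hs
    have hs : 0 < s := hs
    have e1 : {w | γ * s / 2 < f w} = {w | s < 2 * f w / γ} := by
      ext w; simp only [mem_setOf_eq]; rw [lt_div_iff₀ hγ, div_lt_iff₀ two_pos]
      constructor <;> intro h <;> linarith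
    have e2 : μ {x | s < 2 * f x / γ} = LI q f (D ∩ {w | s < 2 * f w / γ}) := by
      rw [hμ, withDensity_apply _ (hset s), Measure.restrict_restrict (hset s), inter_comm]; rfl
    rw [e1, e2]
    have e3 : (ofReal (γ * s) ^ q)⁻¹ * ofReal (s ^ (p - 1)) =
        ofReal (γ ^ (-q)) * ofReal (s ^ (p - q - 1)) := by
      rw [← ENNReal.rpow_neg, ofReal_rpow_of_pos (by positivity),
        ← ofReal_mul (by positivity), ← ofReal_mul (by positivity),
        Real.mul_rpow hγ.le hs.le, mul_assoc, ← Real.rpow_add hs]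
      ring_nf
    calc _ = ((ofReal (γ * s) ^ q)⁻¹ * ofReal (s ^ (p - 1))) *
          LI q f (D ∩ {w | s < 2 * f w / γ}) := by ring
      _ = _ := by rw [e3]; ring
  rw [setLIntegral_congr_fun measurableSet_Ioi h1, lintegral_const_mul' _ _ ofReal_ne_top]
  have h2 : ∫⁻ x, ofReal (2 * f x / γ) ^ (p - q) ∂μ =
      ofReal ((2 / γ) ^ (p - q)) * LI p f D := by
    rw [hμ, lintegral_withDensity_eq_lintegral_mul _ hmf (by fun_prop)]
    unfold LI
    rw [← lintegral_const_mul' _ _ ofReal_ne_top]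
    refine lintegral_congr fun w => ?_
    have hw := h0 w
    simp only [Pi.mul_apply]
    rw [ofReal_rpow_of_nonneg hw hq.le, ofReal_rpow_of_nonneg (by positivity) hpq.le,
      ofReal_rpow_of_nonneg hw (by linarith), ← ofReal_mul (by positivity),
      ← ofReal_mul (by positivity)]
    congr 1
    rw [show 2 * f w / γ = (2 / γ) * f w by ring, Real.mul_rpow (by positivity) hw]
    rw [show p = q + (p - q) by ring, Real.rpow_add_of_nonneg hw hq.le hpq.le]
    ring_nf
  rw [h2] at hc
  have h3 : ∫⁻ s in Ioi (0:ℝ), μ {x | s < 2 * f x / γ} * ofReal (s ^ (p - q - 1)) =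
      ofReal ((p - q)⁻¹) * (ofReal ((2 / γ) ^ (p - q)) * LI p f D) := by
    rw [← hc, ← mul_assoc, ← ofReal_mul (by positivity), inv_mul_cancel₀ hpq.ne']; simp
  rw [h3, ← mul_assoc, ← mul_assoc, ← ofReal_mul (by positivity), ← ofReal_mul (by positivity)]
  congr 2
  rw [Real.div_rpow (by norm_num) hγ.le, Real.rpow_neg hγ.le, Real.rpow_sub hγ]
  field_simp

lemma AM_int {q p K η γ : ℝ} (hq : 1 ≤ q) (hqp : q < p) (hK : 1 ≤ K) (hγ : 0 < γ) (hη : 0 ≤ η)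
    {H f : Pt d → ℝ} (hH : Continuous H) (hH0 : ∀ z, 0 ≤ H z) (hf : Measurable f) (hf0 : ∀ z, 0 ≤ f z)
    (hG : GG q K η γ H f) (z0 : Pt d) {ρ R s0 : ℝ} (hρ : 0 < ρ) (hR : ρ ≤ R) (hs0 : 0 ≤ s0)
    (hgood : ∀ s, 0 < s → s0 ≤ s → ∀ z r, R ≤ r → Gd q H s z r ∧ Gd q f (γ * s) z r) :
    LI p H (pc z0 ρ) ≤ ofReal (K ^ p) * (ofReal (s0 ^ p) * volume (pc z0 ρ) +
      ofReal (2 * p * η * (2 ^ (p - q) / (p - q))) *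
        (LI p H (pc z0 (2 * R)) + ofReal (γ ^ (-p)) * LI p f (pc z0 (2 * R)))) := by
  have hp : 0 < p := by linarith
  have hK0 : 0 < K := by linarith
  set μ := volume.restrict (pc z0 ρ) with hμ
  set D := pc z0 (2 * R)
  have hc := cake μ (g := fun w => H w / K) (by have := hH.measurable; fun_prop) (fun w => by have := hH0 w; positivity) hp
  have e1 : LI p H (pc z0 ρ) = ofReal (K ^ p) * ∫⁻ x, ofReal (H x / K) ^ p ∂μ := by
    unfold LI
    rw [← lintegral_const_mul' _ _ ofReal_ne_top]
    refine lintegral_congr fun w => ?_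
    have hw := hH0 w
    rw [ofReal_rpow_of_nonneg hw hp.le, ofReal_rpow_of_nonneg (by positivity) hp.le,
      ← ofReal_mul (by positivity), ← Real.mul_rpow (by positivity) (by positivity),
      mul_div_cancel₀ _ hK0.ne']
  rw [e1, ← hc]
  gcongr
  have hbound : ∀ s ∈ Ioi (0:ℝ), μ {x | s < H x / K} * ofReal (s ^ (p - 1)) ≤
      (Ioc 0 s0).indicator (fun s => volume (pc z0 ρ) * ofReal (s ^ (p - 1))) s +
      ofReal (η * 2) * ((ofReal (1 * s) ^ q)⁻¹ * LI q H (D ∩ {w | 1 * s / 2 < H w}) *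
        ofReal (s ^ (p - 1)) + (ofReal (γ * s) ^ q)⁻¹ * LI q f (D ∩ {w | γ * s / 2 < f w}) *
        ofReal (s ^ (p - 1))) := by
    intro s hs
    have hs : 0 < s := hs
    by_cases hss : s ≤ s0
    · rw [indicator_of_mem (show s ∈ Ioc 0 s0 from ⟨hs, hss⟩)]
      refine le_trans ?_ le_self_add
      refine mul_le_mul_left ?_ _
      calc μ {x | s < H x / K} ≤ μ univ := measure_mono (subset_univ _)
        _ = _ := by rw [hμ, Measure.restrict_apply_univ]
    · rw [indicator_of_notMem (fun h : s ∈ Ioc 0 s0 => hss h.2), zero_add, one_mul]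
      have := AM_level hq hK hγ hH hf hG z0 hρ hR hs (hgood s hs (le_of_not_ge hss))
      have e2 : μ {x | s < H x / K} = volume {w ∈ pc z0 ρ | K * s < H w} := by
        rw [hμ, Measure.restrict_apply (measurableSet_lt measurable_const (by have := hH.measurable; fun_prop)),
          inter_comm]
        congr 1; ext w
        simp only [mem_inter_iff, mem_setOf_eq, lt_div_iff₀ hK0, mul_comm]
      rw [e2]
      calc _ ≤ _ := mul_le_mul_left this _
        _ = _ := by
          rw [ofReal_mul hη]; simp only [ofReal_ofNat]; ring
  have hmeasind : Measurable ((Ioc 0 s0).indicator (fun s : ℝ => volume (pc z0 ρ) * ofReal (s ^ (p - 1)))) := by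
    refine Measurable.indicator ?_ measurableSet_Ioc
    fun_prop
  have hI1 : ∫⁻ s in Ioi (0:ℝ), (Ioc 0 s0).indicator (fun s : ℝ => volume (pc z0 ρ) * ofReal (s ^ (p - 1))) s
      = volume (pc z0 ρ) * ofReal (s0 ^ p / p) := by
    rw [lintegral_indicator measurableSet_Ioc, Measure.restrict_restrict measurableSet_Ioc,
      inter_eq_left.2 (fun x hx => hx.1), lintegral_const_mul' _ _ (vol_pc_ne_top _ _)]
    congr 1
    have hint : IntervalIntegrable (fun x : ℝ => x ^ (p - 1)) volume 0 s0 :=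
      intervalIntegral.intervalIntegrable_rpow' (by linarith)
    rw [← ofReal_integral_eq_lintegral_ofReal]
    · rw [← intervalIntegral.integral_of_le hs0, integral_rpow (Or.inl (by linarith))]
      simp [Real.zero_rpow hp.ne']
    · exact (intervalIntegrable_iff_integrableOn_Ioc_of_le hs0).1 hint
    · refine (ae_restrict_iff' measurableSet_Ioc).2 (eof fun x hx => ?_)
      exact Real.rpow_nonneg hx.1.le _
  have hLHm : ∫⁻ s in Ioi (0:ℝ), ((ofReal (1 * s) ^ q)⁻¹ * LI q H (D ∩ {w | 1 * s / 2 < H w}) *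
        ofReal (s ^ (p - 1)) + (ofReal (γ * s) ^ q)⁻¹ * LI q f (D ∩ {w | γ * s / 2 < f w}) *
        ofReal (s ^ (p - 1))) = ofReal (2 ^ (p - q) / (p - q) / 1 ^ p) * LI p H D +
        ofReal (2 ^ (p - q) / (p - q) / γ ^ p) * LI p f D := by
    rw [lintegral_add_left, cake_piece (by linarith) hqp one_pos hH.measurable hH0 D (meas_pc _ _),
      cake_piece (by linarith) hqp hγ hf hf0 D (meas_pc _ _)]
    have hanti : Antitone (fun s : ℝ => LI q H (D ∩ {w | 1 * s / 2 < H w})) := by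
      intro a b hab
      refine lintegral_mono_set ?_
      rintro w ⟨h1, h2⟩
      refine ⟨h1, ?_⟩
      simp only [mem_setOf_eq] at *
      linarith
    have := hanti.measurable
    fun_prop
  calc _ ≤ ofReal p * (∫⁻ s in Ioi (0:ℝ), ((Ioc 0 s0).indicator (fun s => volume (pc z0 ρ) * ofReal (s ^ (p - 1))) s +
      ofReal (η * 2) * ((ofReal (1 * s) ^ q)⁻¹ * LI q H (D ∩ {w | 1 * s / 2 < H w}) *
        ofReal (s ^ (p - 1)) + (ofReal (γ * s) ^ q)⁻¹ * LI q f (D ∩ {w | γ * s / 2 < f w}) *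
        ofReal (s ^ (p - 1))))) := by
        gcongr ofReal p * ?_
        exact setLIntegral_mono' measurableSet_Ioi hbound
    _ = ofReal p * (volume (pc z0 ρ) * ofReal (s0 ^ p / p) + ofReal (η * 2) * 
        (ofReal (2 ^ (p - q) / (p - q) / 1 ^ p) * LI p H D +
        ofReal (2 ^ (p - q) / (p - q) / γ ^ p) * LI p f D)) := by
        rw [lintegral_add_left hmeasind, hI1, lintegral_const_mul' _ _ ofReal_ne_top, hLHm]
    _ = _ := by
        have hpq : 0 < p - q := by linarith
        have a1 : ofReal (s0 ^ p) = ofReal p * ofReal (s0 ^ p / p) := by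
          rw [← ofReal_mul hp.le, mul_div_cancel₀ _ hp.ne']
        have a2 : ofReal (2 * p * η * (2 ^ (p - q) / (p - q))) =
          ofReal p * ofReal (η * 2) * ofReal (2 ^ (p - q) / (p - q) / 1 ^ p) := by
          rw [← ofReal_mul hp.le, ← ofReal_mul (by positivity)]
          congr 1; rw [Real.one_rpow]; ring
        have a3 : ofReal (2 ^ (p - q) / (p - q) / γ ^ p) =
          ofReal (2 ^ (p - q) / (p - q) / 1 ^ p) * ofReal (γ ^ (-p)) := by
          rw [← ofReal_mul (by positivity), Real.one_rpow, Real.rpow_neg hγ.le]; congr 1; ring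
        rw [a1, a2, a3]; ring

lemma MB_good {q p e X s R r : ℝ} (hq : 0 < q) (hqp : q ≤ p) (he : e ≤ d + 2) {H : Pt d → ℝ}
    (hH : Measurable H) (hX : MB p e H X) (hX0 : 0 ≤ X) (hR : 0 < R) (hRr : R ≤ r) (hs : 0 < s)
    (h : X * R ^ (e - (d + 2)) / vv d ≤ s ^ p) (z : Pt d) : Gd q H s z r := by
  have hr : 0 < r := hR.trans_le hRr
  have hv := vv_pos d
  refine holder_avg hq hqp hH _ ((hX z r hr).trans ?_)
  rw [vol_pc z hr, ofReal_rpow_of_pos hs, ← ofReal_mul (by positivity)]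
  refine ofReal_le_ofReal ?_
  have h1 : r ^ (e - (d + 2)) ≤ R ^ (e - (d + 2)) :=
    Real.rpow_le_rpow_of_nonpos hR hRr (by linarith)
  have h2 : r ^ e = r ^ (e - (d + 2)) * r ^ (d + 2) := by
    rw [← Real.rpow_natCast, ← Real.rpow_add hr]; push_cast; congr 1; ring
  rw [h2, ← mul_assoc, ← mul_assoc]
  gcongr ?_ * _
  rw [div_le_iff₀ hv] at h
  exact (mul_le_mul_of_nonneg_left h1 hX0).trans h

lemma AM_step (d : ℕ) {q p e K : ℝ} (hq : 1 ≤ q) (hqp : q < p) (he : e < d + 2) (hK : 1 ≤ K) :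
    ∃ η : ℝ, 0 < η ∧ ∀ γ : ℝ, 0 < γ → ∃ C : ℝ, 0 < C ∧ ∀ H f : Pt d → ℝ, Continuous H → (∀ z, 0 ≤ H z) →
      Measurable f → (∀ z, 0 ≤ f z) → GG q K η γ H f → ∀ X Y : ℝ, 0 ≤ X → 0 ≤ Y → MB p e H X → MB p e f Y →
      MB p e H (X / 2 + C * Y) := by
  have hp : 0 < p := by linarith
  have hpq : 0 < p - q := by linarith
  have hv := vv_pos d
  have hK0 : 0 < K := by linarith
  obtain ⟨l, hl⟩ : ∃ l : ℕ, K ^ p * ((2:ℝ) ^ (e - (d + 2))) ^ l ≤ 1 / 4 := by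
    have h1 : Filter.Tendsto (fun l : ℕ => K ^ p * ((2:ℝ) ^ (e - (d + 2))) ^ l) Filter.atTop (nhds (K ^ p * 0)) :=
      (tendsto_pow_atTop_nhds_zero_of_lt_one (by positivity)
        (Real.rpow_lt_one_of_one_lt_of_neg (by norm_num) (by linarith))).const_mul _
    rw [mul_zero] at h1
    exact (h1.eventually_le_const (by norm_num)).exists
  set M := K ^ p * (2 * p * (2 ^ (p - q) / (p - q))) * ((2:ℝ) ^ (l+1)) ^ e with hM
  have hM0 : 0 < M := by positivity
  refine ⟨1 / (4 * M), by positivity, fun γ hγ => ⟨1 / (2 * γ ^ p), by positivity, ?_⟩⟩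
  intro H f hH hH0 hf hf0 hG X Y hX hY hHX hfY z0 ρ hρ
  set R := 2 ^ l * ρ with hR
  have hRρ : ρ ≤ R := by
    have : (1:ℝ) ≤ 2 ^ l := one_le_pow₀ (by norm_num)
    nlinarith
  have hR0 : 0 < R := by positivity
  set Z := X + Y / γ ^ p with hZ
  have hZ0 : 0 ≤ Z := by positivity
  set s0 := (Z * R ^ (e - (d + 2)) / vv d) ^ (1 / p) with hs0
  have hs0p : s0 ^ p = Z * R ^ (e - (d + 2)) / vv d := by
    rw [hs0, ← Real.rpow_mul (by positivity), one_div_mul_cancel hp.ne', Real.rpow_one]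
  have hs00 : 0 ≤ s0 := by positivity
  have hgood : ∀ s, 0 < s → s0 ≤ s → ∀ z r, R ≤ r → Gd q H s z r ∧ Gd q f (γ * s) z r := by
    intro s hs hss z r hr
    have h1 : Z * R ^ (e - (d + 2)) / vv d ≤ s ^ p := hs0p ▸ Real.rpow_le_rpow hs00 hss hp.le
    constructor
    · refine MB_good (by linarith) hqp.le he.le hH.measurable hHX hX hR0 hr hs (le_trans ?_ h1) z
      gcongr
      rw [hZ]; exact le_add_of_nonneg_right (by positivity)
    · refine MB_good (by linarith) hqp.le he.le hf hfY hY hR0 hr (by positivity) ?_ z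
      rw [Real.mul_rpow hγ.le hs.le]
      calc Y * R ^ (e - (d + 2)) / vv d = γ ^ p * ((Y / γ ^ p) * R ^ (e - (d + 2)) / vv d) := by
            field_simp
        _ ≤ γ ^ p * (Z * R ^ (e - (d + 2)) / vv d) := by
            gcongr; rw [hZ]; exact le_add_of_nonneg_left hX
        _ ≤ _ := by gcongr
  have hη0 : (0:ℝ) ≤ 1 / (4 * M) := by positivity
  have hmain := AM_int hq hqp hK hγ hη0 hH hH0 hf hf0 hG z0 hρ hRρ hs00 hgood
  have hH2 := hHX z0 (2 * R) (by positivity)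
  have hf2 := hfY z0 (2 * R) (by positivity)
  refine hmain.trans ?_
  calc _ ≤ ofReal (K ^ p) * (ofReal (s0 ^ p) * volume (pc z0 ρ) +
      ofReal (2 * p * (1 / (4 * M)) * (2 ^ (p - q) / (p - q))) *
        (ofReal (X * (2 * R) ^ e) + ofReal (γ ^ (-p)) * ofReal (Y * (2 * R) ^ e))) := by gcongr
    _ = ofReal (K ^ p * (s0 ^ p * (vv d * ρ ^ (d + 2)) + 
      (2 * p * (1 / (4 * M)) * (2 ^ (p - q) / (p - q))) * (X * (2 * R) ^ e + γ ^ (-p) * (Y * (2 * R) ^ e)))) := by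
        rw [vol_pc z0 hρ, ← ofReal_mul (p := s0 ^ p) (by positivity), ← ofReal_mul (p := γ ^ (-p)) (by positivity),
          ← ofReal_add (by positivity) (by positivity), ← ofReal_mul (by positivity),
          ← ofReal_add (by positivity) (by positivity), ← ofReal_mul (by positivity)]
    _ ≤ _ := by
        refine ofReal_le_ofReal ?_
        have i1 : R ^ (e - (d + 2)) * ρ ^ (d + 2) = ((2:ℝ) ^ (e - (d + 2))) ^ l * ρ ^ e := by
          rw [hR, Real.mul_rpow (by positivity) hρ.le, mul_assoc, ← Real.rpow_natCast ρ, ← Real.rpow_add hρ,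
            ← Real.rpow_natCast, ← Real.rpow_natCast, ← Real.rpow_mul (by norm_num), ← Real.rpow_mul (by norm_num)]
          push_cast
          congr 2 <;> ring
        have i2 : (2 * R) ^ e = ((2:ℝ) ^ (l+1)) ^ e * ρ ^ e := by
          rw [hR, ← Real.mul_rpow (by positivity) hρ.le]; congr 1; ring
        have i3 : s0 ^ p * (vv d * ρ ^ (d + 2)) = Z * (((2:ℝ) ^ (e - (d + 2))) ^ l * ρ ^ e) := by
          rw [hs0p, ← i1]; field_simp
        have i4 : X * (2 * R) ^ e + γ ^ (-p) * (Y * (2 * R) ^ e) = Z * (((2:ℝ) ^ (l+1)) ^ e * ρ ^ e) := by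
          rw [hZ, i2, Real.rpow_neg hγ.le]; ring
        rw [i3, i4]
        have i5 : K ^ p * (2 * p * (1 / (4 * M)) * (2 ^ (p - q) / (p - q)) * (Z * (((2:ℝ) ^ (l+1)) ^ e * ρ ^ e))) =
           (1 / 4) * (Z * ρ ^ e) := by
          calc _ = (M / (4 * M)) * (Z * ρ ^ e) := by
                simp only [hM]; ring
            _ = _ := by congr 1; field_simp
        rw [mul_add, i5]
        have i6 : K ^ p * (Z * (((2:ℝ) ^ (e - (d + 2))) ^ l * ρ ^ e)) ≤ (1 / 4) * (Z * ρ ^ e) := by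
          calc _ = (K ^ p * ((2:ℝ) ^ (e - (d + 2))) ^ l) * (Z * ρ ^ e) := by ring
            _ ≤ _ := by gcongr
        have i7 : (X / 2 + 1 / (2 * γ ^ p) * Y) * ρ ^ e = (1/2) * (Z * ρ ^ e) := by rw [hZ]; field_simp
        rw [i7]; linarith

/-- Acerbi--Mingione type lemma. -/
lemma AM (d : ℕ) {q p e K : ℝ} (hq : 1 ≤ q) (hqp : q < p) (he : e < d + 2) (hK : 1 ≤ K) :
    ∃ η : ℝ, 0 < η ∧ ∀ γ : ℝ, 0 < γ → ∃ C : ℝ, 0 < C ∧ ∀ H f : Pt d → ℝ, Continuous H → (∀ z, 0 ≤ H z) →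
      Measurable f → (∀ z, 0 ≤ f z) → GG q K η γ H f → ∀ X Y : ℝ, 0 ≤ X → 0 ≤ Y → MB p e H X → MB p e f Y →
      MB p e H (C * Y) := by
  obtain ⟨η, hη, h⟩ := AM_step d hq hqp he hK
  refine ⟨η, hη, fun γ hγ => ?_⟩
  obtain ⟨C, hC, h⟩ := h γ hγ
  refine ⟨2 * C, by positivity, ?_⟩
  intro H f hH hH0 hf hf0 hG X Y hX hY hHX hfY
  have hn : ∀ n : ℕ, MB p e H (X * (1/2) ^ n + 2 * C * Y) := by
    intro n
    induction n with
    | zero =>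
      intro z r hr
      refine (hHX z r hr).trans (ofReal_le_ofReal ?_)
      have : 0 ≤ 2 * C * Y := by positivity
      gcongr; simp [this]
    | succ n ih =>
      have := h H f hH hH0 hf hf0 hG _ Y (by positivity) hY ih hfY
      convert this using 1
      rw [pow_succ]; ring
  intro z r hr
  have ht : Filter.Tendsto (fun n : ℕ => ofReal ((X * (1/2) ^ n + 2 * C * Y) * r ^ e)) Filter.atTop
      (nhds (ofReal ((X * 0 + 2 * C * Y) * r ^ e))) := by
    refine (ENNReal.continuous_ofReal.tendsto _).comp ?_
    exact (((tendsto_pow_atTop_nhds_zero_of_lt_one (by norm_num) (by norm_num)).const_mul X).add_const _).mul_const _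
  rw [mul_zero, zero_add] at ht
  exact ge_of_tendsto' ht (fun n => hn n z r hr)

structure Nice (F : Pt d → ℝ) : Prop where
  meas : Measurable F
  bdd : ∃ B, ∀ z, |F z| ≤ B
  supp : ∃ R, 0 < R ∧ ∀ z, z ∉ pc (0 : Pt d) R → F z = 0

structure KN (K : Pt d → Pt d → ℝ) : Prop where
  cont : Continuous (Function.uncurry K)
  bdd : ∃ B, ∀ z w, |K z w| ≤ B

def TT (K : Pt d → Pt d → ℝ) (F : Pt d → ℝ) (z : Pt d) : ℝ := ∫ w, K z w * F w

def Reg (N0 : ℝ) (K : Pt d → Pt d → ℝ) : Prop :=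
  ∀ (z0 : Pt d) (r : ℝ), 0 < r → ∀ k : ℕ, 4 ≤ k → ∀ z ∈ pc z0 (4 * r), ∀ z' ∈ pc z0 (4 * r),
    ∀ w, w ∉ pc z0 (2 ^ k * r) → |K z w - K z' w| ≤ N0 * 2⁻¹ ^ k / (2 ^ k * r) ^ (d + 2)

def LpB (p N : ℝ) (K : Pt d → Pt d → ℝ) : Prop :=
  ∀ F, Nice F → LI p (fun z => |TT K F z|) univ ≤ ofReal N * LI p (fun z => |F z|) univ

lemma Nice.integrable {F : Pt d → ℝ} (hF : Nice F) : Integrable F := by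
  obtain ⟨B, hB⟩ := hF.bdd
  obtain ⟨R, hR, hs⟩ := hF.supp
  have h1 : IntegrableOn F (pc 0 R) :=
    Measure.integrableOn_of_bounded (vol_pc_ne_top _ _) hF.meas.aestronglyMeasurable
      (M := B) (eof hB)
  refine (integrableOn_iff_integrable_of_support_subset ?_).1 h1
  intro z hz
  by_contra h
  exact hz (hs z h)

lemma Nice.indicator {F : Pt d → ℝ} (hF : Nice F) {S : Set (Pt d)} (hS : MeasurableSet S) :
    Nice (S.indicator F) := by
  obtain ⟨B, hB⟩ := hF.bdd
  obtain ⟨R, hR, hs⟩ := hF.supp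
  refine ⟨hF.meas.indicator hS, ⟨B, fun z => ?_⟩, R, hR, fun z hz => ?_⟩
  · by_cases h : z ∈ S
    · rw [indicator_of_mem h]; exact hB z
    · rw [indicator_of_notMem h]; simpa using (abs_nonneg _).trans (hB z)
  · by_cases h : z ∈ S
    · rw [indicator_of_mem h]; exact hs z hz
    · rw [indicator_of_notMem h]

lemma KN.meas {K : Pt d → Pt d → ℝ} (hK : KN K) (z : Pt d) : Continuous (K z) :=
  hK.cont.comp (by fun_prop : Continuous fun w => (z, w))

lemma KN.integrable {K : Pt d → Pt d → ℝ} (hK : KN K) {F : Pt d → ℝ} (hF : Nice F) (z : Pt d) :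
    Integrable (fun w => K z w * F w) := by
  obtain ⟨B, hB⟩ := hK.bdd
  exact hF.integrable.bdd_mul (hK.meas z).aestronglyMeasurable (c := B) (eof (hB z))

lemma TT_cont {K : Pt d → Pt d → ℝ} (hK : KN K) {F : Pt d → ℝ} (hF : Nice F) : Continuous (TT K F) := by
  obtain ⟨B, hB⟩ := hK.bdd
  refine continuous_of_dominated (bound := fun w => B * |F w|) ?_ ?_ ?_ ?_
  · intro z; exact (hK.integrable hF z).aestronglyMeasurable
  · intro z; refine eof fun w => ?_
    rw [norm_mul]; exact mul_le_mul_of_nonneg_right (hB z w) (abs_nonneg _)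
  · exact hF.integrable.abs.const_mul B
  · refine eof fun w => ?_
    have := hK.cont.comp (by fun_prop : Continuous fun z : Pt d => (z, w))
    exact this.mul continuous_const

lemma TT_bdd {K : Pt d → Pt d → ℝ} (hK : KN K) {F : Pt d → ℝ} (hF : Nice F) : ∃ B, ∀ z, |TT K F z| ≤ B := by
  obtain ⟨B, hB⟩ := hK.bdd
  refine ⟨∫ w, B * |F w|, fun z => ?_⟩
  rw [← Real.norm_eq_abs]
  refine norm_integral_le_of_norm_le (hF.integrable.abs.const_mul B) (eof fun w => ?_)
  rw [norm_mul]; exact mul_le_mul_of_nonneg_right (hB z w) (abs_nonneg _)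

lemma osc_far {K : Pt d → Pt d → ℝ} (hK : KN K) {N0 p0 : ℝ} (hp0 : 1 ≤ p0) (hN0 : 0 ≤ N0)
    (hreg : Reg N0 K) {F : Pt d → ℝ} (hF : Nice F) {z0 : Pt d} {r s θ : ℝ} (hr : 0 < r) (hs : 0 < s) (hθ : 0 < θ)
    (h1 : ∀ k : ℕ, 4 ≤ k → Gd p0 (fun z => |F z|) (θ * (3/2) ^ k * s) z0 (2 ^ k * r))
    {z z' : Pt d} (hz : z ∈ pc z0 (4 * r)) (hz' : z' ∈ pc z0 (4 * r)) :
    |TT K ((pc z0 (16 * r))ᶜ.indicator F) z - TT K ((pc z0 (16 * r))ᶜ.indicator F) z'| ≤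
      6 * N0 * vv d * 2 ^ (d + 2) * θ * s := by
  have hv := vv_pos d
  have hF2 := hF.indicator (meas_pc z0 (16 * r)).compl
  set F2 := (pc z0 (16 * r))ᶜ.indicator F with hF2d
  have e1 : TT K F2 z - TT K F2 z' = ∫ w, (K z w - K z' w) * F2 w := by
    unfold TT
    rw [← integral_sub (hK.integrable hF2 z) (hK.integrable hF2 z')]
    congr 1; ext w; ring
  rw [← ofReal_le_ofReal_iff (by positivity), e1, ← Real.norm_eq_abs, ofReal_norm_eq_enorm]
  refine (enorm_integral_le_lintegral_enorm _).trans ?_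
  set An : ℕ → Set (Pt d) := fun j => pc z0 (2 ^ (j + 5) * r) \ pc z0 (2 ^ (j + 4) * r) with hAn
  have hcov : (pc z0 (16 * r))ᶜ ⊆ ⋃ j, An j := by
    intro w hw
    have hex : ∃ n : ℕ, w ∈ pc z0 (2 ^ (n + 4) * r) := by
      obtain ⟨n, hn⟩ := pow_unbounded_of_one_lt ((|w.1 - z0.1| + ‖w.2 - z0.2‖ + 1) / r + 1) (one_lt_two : (1:ℝ) < 2)
      refine ⟨n, ?_⟩
      have h2 : |w.1 - z0.1| + ‖w.2 - z0.2‖ + 1 < 2 ^ (n + 4) * r := by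
        rw [← div_lt_iff₀ hr]
        have : (2:ℝ) ^ n ≤ 2 ^ (n + 4) := pow_le_pow_right₀ (by norm_num) (by omega)
        linarith
      have := abs_nonneg (w.1 - z0.1)
      have := norm_nonneg (w.2 - z0.2)
      rw [mem_pc]
      constructor <;> nlinarith
    classical
    have hm := Nat.find_spec hex
    have hn0 : Nat.find hex ≠ 0 := by
      intro h0; rw [h0] at hm; exact hw (by norm_num at hm; exact hm)
    obtain ⟨m, hmm⟩ := Nat.exists_eq_succ_of_ne_zero hn0
    refine mem_iUnion.2 ⟨m, ?_, Nat.find_min hex (by omega)⟩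
    rw [hmm] at hm
    convert hm using 3
  have hpt : ∀ j : ℕ, ∫⁻ w in An j, ‖(K z w - K z' w) * F2 w‖ₑ ≤
      ofReal (N0 * vv d * 2 ^ (d + 2) * θ * s * ((3/2) * (3/4) ^ (j + 4))) := by
    intro j
    have hAm : MeasurableSet (An j) := (meas_pc _ _).diff (meas_pc _ _)
    set c := N0 * 2⁻¹ ^ (j + 4) / (2 ^ (j + 4) * r) ^ (d + 2) with hc
    have hc0 : 0 ≤ c := by positivity
    have hg := holder_avg (q := 1) (p := p0) one_pos hp0 (H := fun z => |F z|) hF.meas.abs _ (h1 (j + 5) (by omega))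
    calc ∫⁻ w in An j, ‖(K z w - K z' w) * F2 w‖ₑ ≤ ∫⁻ w in An j, ofReal c * ofReal (|F w|) ^ (1:ℝ) := by
          refine setLIntegral_mono' hAm fun w hw => ?_
          rw [enorm_mul, ENNReal.rpow_one]
          gcongr
          · rw [← ofReal_norm_eq_enorm]
            exact ofReal_le_ofReal (hreg z0 r hr (j+4) (by omega) z hz z' hz' w hw.2)
          · rw [← ofReal_norm_eq_enorm]
            refine ofReal_le_ofReal ?_
            rw [hF2d]; exact norm_indicator_le_norm_self _ _
      _ ≤ ofReal c * LI 1 (fun z => |F z|) (pc z0 (2 ^ (j + 5) * r)) := by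
          rw [lintegral_const_mul' _ _ ofReal_ne_top]
          gcongr
          exact lintegral_mono_set sdiff_subset
      _ ≤ ofReal c * (ofReal (θ * (3 / 2) ^ (j + 5) * s) ^ (1:ℝ) * volume (pc z0 (2 ^ (j + 5) * r))) := by
          gcongr
      _ = _ := by
          rw [ENNReal.rpow_one, vol_pc _ (by positivity), ← ofReal_mul (by positivity), ← ofReal_mul hc0]
          congr 1
          have q1 : (2:ℝ) ^ (j + 5) * r = 2 * (2 ^ (j + 4) * r) := by ring
          have q2 : (3/2:ℝ) ^ (j + 5) = (3/2) * (3/2) ^ (j + 4) := by ring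
          have q3 : (3/4:ℝ) ^ (j + 4) = (3/2) ^ (j + 4) * 2⁻¹ ^ (j + 4) := by rw [← mul_pow]; norm_num
          rw [q1, q2, q3, hc, mul_pow 2]
          have : ((2:ℝ) ^ (j + 4) * r) ^ (d + 2) ≠ 0 := by positivity
          field_simp
  have hgeo : HasSum (fun j : ℕ => N0 * vv d * 2 ^ (d + 2) * θ * s * ((3/2) * (3/4:ℝ) ^ (j + 4)))
      (N0 * vv d * 2 ^ (d + 2) * θ * s * ((3/2) * ((3/4) ^ 4 * 4))) := by
    have := (hasSum_geometric_of_lt_one (r := (3/4:ℝ)) (by norm_num) (by norm_num)).mul_left ((3/4:ℝ)^4)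
    have := (this.mul_left (3/2 : ℝ)).mul_left (N0 * vv d * 2 ^ (d + 2) * θ * s)
    have e4 : (1 - 3 / 4 : ℝ)⁻¹ = 4 := by norm_num
    rw [e4] at this
    refine this.congr_fun ?_
    intro j; rw [pow_add]; ring
  calc ∫⁻ w, ‖(K z w - K z' w) * F2 w‖ₑ = ∫⁻ w in (pc z0 (16 * r))ᶜ, ‖(K z w - K z' w) * F2 w‖ₑ := by
        rw [← lintegral_indicator (meas_pc _ _).compl]
        refine lintegral_congr fun w => ?_
        by_cases hw : w ∈ (pc z0 (16 * r))ᶜ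
        · rw [indicator_of_mem hw]
        · rw [indicator_of_notMem hw, hF2d, indicator_of_notMem hw]; simp
    _ ≤ ∫⁻ w in ⋃ j, An j, ‖(K z w - K z' w) * F2 w‖ₑ := lintegral_mono_set hcov
    _ ≤ ∑' j, ∫⁻ w in An j, ‖(K z w - K z' w) * F2 w‖ₑ := lintegral_iUnion_le _ _
    _ ≤ ∑' j : ℕ, ofReal (N0 * vv d * 2 ^ (d + 2) * θ * s * ((3/2) * (3/4) ^ (j + 4))) := ENNReal.tsum_le_tsum hpt
    _ = ofReal (N0 * vv d * 2 ^ (d + 2) * θ * s * ((3/2) * ((3/4) ^ 4 * 4))) := by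
        rw [← ofReal_tsum_of_nonneg (fun j => by positivity) hgeo.summable, hgeo.tsum_eq]
    _ ≤ _ := by
        refine ofReal_le_ofReal ?_
        have : 0 ≤ N0 * vv d * 2 ^ (d + 2) * θ * s := by positivity
        calc N0 * vv d * 2 ^ (d + 2) * θ * s * ((3/2) * ((3/4) ^ 4 * 4)) ≤ N0 * vv d * 2 ^ (d + 2) * θ * s * 6 := by
              gcongr; norm_num
          _ = _ := by ring

lemma osc (d : ℕ) {p0 N0 Np : ℝ} (hp0 : 1 ≤ p0) (hN0 : 0 ≤ N0) (hNp : 0 ≤ Np) :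
    ∃ N : ℝ, 0 < N ∧ ∀ K : Pt d → Pt d → ℝ, KN K → Reg N0 K → LpB p0 Np K → ∀ F, Nice F → ∀ (z0 : Pt d) (r s θ : ℝ),
      0 < r → 0 < s → 0 < θ → N * θ ≤ 1 →
      (∀ k : ℕ, 4 ≤ k → Gd p0 (fun z => |F z|) (θ * (3/2) ^ k * s) z0 (2 ^ k * r)) →
      Gd 1 (fun z => |TT K F z|) s z0 (4 * r) →
      volume {w ∈ pc z0 (4 * r) | 3 * s < |TT K F w|} ≤ ofReal (N * θ ^ p0) * volume (pc z0 r) := by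
  have hv := vv_pos d
  have hp00 : 0 < p0 := by linarith
  set N1 := 24 * N0 * vv d * 2 ^ (d + 2) with hN1
  set N2 := (Np * 4 ^ (d + 2)) ^ (1 / p0) * (81 / 4) with hN2
  set N3 := Np * 16 ^ (d + 2) * (81 / 16) ^ p0 with hN3
  have hN1' : 0 ≤ N1 := by positivity
  have hN2' : 0 ≤ N2 := by positivity
  have hN3' : 0 ≤ N3 := by positivity
  refine ⟨1 + N1 + N2 + N3, by positivity, ?_⟩
  intro K hK hreg hLp F hF z0 r s θ hr hs hθ hNθ h1 h2
  have g1 : N1 * θ ≤ 1 := by nlinarith [mul_nonneg hN2' hθ.le, mul_nonneg hN3' hθ.le]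
  have g2 : N2 * θ ≤ 1 := by nlinarith [mul_nonneg hN1' hθ.le, mul_nonneg hN3' hθ.le]
  have hF2 := hF.indicator (meas_pc z0 (16 * r)).compl
  have hF1 := hF.indicator (meas_pc z0 (16 * r))
  have hfar := fun z hz z' hz' => osc_far hK hp0 hN0 hreg hF hr hs hθ h1 (z := z) (z' := z') hz hz'
  set F2 := (pc z0 (16 * r))ᶜ.indicator F with hF2d
  set F1 := (pc z0 (16 * r)).indicator F with hF1d
  have hsum : ∀ z, TT K F z = TT K F1 z + TT K F2 z := by
    intro z
    unfold TT
    rw [← integral_add (hK.integrable hF1 z) (hK.integrable hF2 z)]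
    congr 1; ext w; rw [← mul_add, hF1d, hF2d]
    rw [← indicator_self_add_compl (pc z0 (16 * r)) F]; simp
  have hT1 : LI p0 (fun z => |TT K F1 z|) univ ≤ ofReal (Np * (θ * (81 / 16) * s) ^ p0 * (vv d * (16 * r) ^ (d + 2))) := by
    have h16 := h1 4 le_rfl
    unfold Gd at h16
    norm_num at h16
    refine (hLp F1 hF1).trans ?_
    have e : LI p0 (fun z => |F1 z|) univ = LI p0 (fun z => |F z|) (pc z0 (16 * r)) := by
      unfold LI
      rw [Measure.restrict_univ, ← lintegral_indicator (meas_pc _ _)]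
      refine lintegral_congr fun w => ?_
      by_cases hw : w ∈ pc z0 (16 * r)
      · simp only [hF1d, indicator_of_mem hw]
      · simp [hF1d, indicator_of_notMem hw, hp00]
    rw [e]
    calc _ ≤ _ := mul_le_mul_right h16 _
      _ = _ := by
        rw [vol_pc _ (by positivity), ofReal_rpow_of_pos (by positivity), ← ofReal_mul (by positivity),
          ← ofReal_mul (by positivity)]; congr 1; ring
  have hT1m := (TT_cont hK hF1).abs
  have havg : Gd 1 (fun z => |TT K F1 z|) (s / 4) z0 (4 * r) := by
    refine holder_avg one_pos hp0 hT1m.measurable _ ?_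
    refine (lintegral_mono_set (subset_univ _)).trans (hT1.trans ?_)
    rw [vol_pc _ (by positivity), ofReal_rpow_of_pos (by positivity), ← ofReal_mul (by positivity)]
    refine ofReal_le_ofReal ?_
    have e1 : Np * 4 ^ (d + 2) * ((81/4)*θ) ^ p0 ≤ 1 := by
      have : (N2 * θ) ^ p0 ≤ 1 := Real.rpow_le_one (by positivity) g2 hp00.le
      rw [hN2, mul_assoc, Real.mul_rpow (by positivity) (by positivity), ← Real.rpow_mul (by positivity),
        one_div_mul_cancel hp00.ne', Real.rpow_one] at this
      exact this
    have e2 : (θ * (81 / 16) * s) ^ p0 = ((81/4)*θ) ^ p0 * (s/4) ^ p0 := by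
      rw [← Real.mul_rpow (by positivity) (by positivity)]; congr 1; ring
    have e3 : (16 * r) ^ (d + 2) = 4 ^ (d + 2) * (4 * r) ^ (d + 2) := by rw [← mul_pow]; congr 1; ring
    rw [e2, e3]
    calc _ = (Np * 4 ^ (d + 2) * ((81/4)*θ) ^ p0) * ((s/4) ^ p0 * (vv d * (4 * r) ^ (d + 2))) := by ring
      _ ≤ 1 * ((s/4) ^ p0 * (vv d * (4 * r) ^ (d + 2))) := by gcongr
      _ = _ := by rw [one_mul]
  have hT2 : ∀ z ∈ pc z0 (4 * r), |TT K F2 z| ≤ 3 / 2 * s := by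
    intro z hz
    rw [← ofReal_le_ofReal_iff (by positivity)]
    have hV0 := vol_pc_pos z0 (r := 4 * r) (by positivity)
    have hVt := vol_pc_ne_top z0 (4 * r)
    rw [← ENNReal.mul_le_mul_iff_left hV0 hVt]
    unfold Gd LI at havg h2
    simp only [ENNReal.rpow_one] at havg h2
    calc ofReal |TT K F2 z| * volume (pc z0 (4 * r)) = ∫⁻ z' in pc z0 (4 * r), ofReal |TT K F2 z| := by simp
      _ ≤ ∫⁻ z' in pc z0 (4 * r), (ofReal |TT K F z'| + (ofReal |TT K F1 z'| + ofReal (s/4))) := by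
          refine setLIntegral_mono' (meas_pc _ _) fun z' hz' => ?_
          rw [← ofReal_add (by positivity) (by positivity), ← ofReal_add (by positivity) (by positivity)]
          refine ofReal_le_ofReal ?_
          have a1 := hfar z hz z' hz'
          have a2 : 6 * N0 * vv d * 2 ^ (d + 2) * θ * s ≤ s / 4 := by
            have : 6 * N0 * vv d * 2 ^ (d + 2) * θ * s = (N1 * θ) * (s / 4) := by rw [hN1]; ring
            rw [this]; nlinarith
          have a3 : TT K F2 z = (TT K F2 z - TT K F2 z') + TT K F z' - TT K F1 z' := by rw [hsum z']; ring
          calc |TT K F2 z| ≤ |TT K F2 z - TT K F2 z'| + |TT K F z'| + |TT K F1 z'| := by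
                conv_lhs => rw [a3]
                exact (abs_sub _ _).trans (by gcongr; exact abs_add_le _ _)
            _ ≤ _ := by linarith
      _ ≤ ofReal s * volume (pc z0 (4 * r)) + (ofReal (s/4) * volume (pc z0 (4 * r)) + 
            ofReal (s/4) * volume (pc z0 (4 * r))) := by
          rw [lintegral_add_left ((TT_cont hK hF).abs.measurable.ennreal_ofReal), lintegral_add_left hT1m.measurable.ennreal_ofReal]
          gcongr
          simp
      _ = _ := by
          rw [← add_mul, ← add_mul, ← ofReal_add (by positivity) (by positivity), ← ofReal_add (by positivity) (by positivity)]
          congr 2; ring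
  have hsub : {w ∈ pc z0 (4 * r) | 3 * s < |TT K F w|} ⊆ {w | ofReal s ^ p0 ≤ ofReal (|TT K F1 w|) ^ p0} := by
    rintro w ⟨hw, hw2⟩
    have := hT2 w hw
    rw [hsum] at hw2
    have := abs_add_le (TT K F1 w) (TT K F2 w)
    simp only [mem_setOf_eq]
    gcongr
    linarith
  have hcheb := mul_meas_ge_le_lintegral (μ := volume) ((hT1m.measurable.ennreal_ofReal).pow_const p0) (ofReal s ^ p0)
  have hS0 : ofReal s ^ p0 ≠ 0 := by simp [hs]
  have hSt : ofReal s ^ p0 ≠ ⊤ := by simp [hp00.le]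
  rw [← ENNReal.mul_le_mul_iff_right hS0 hSt]
  calc _ ≤ ofReal s ^ p0 * volume {w | ofReal s ^ p0 ≤ ofReal (|TT K F1 w|) ^ p0} := by gcongr
    _ ≤ _ := hcheb
    _ = LI p0 (fun z => |TT K F1 z|) univ := by simp [LI]
    _ ≤ _ := hT1
    _ = ofReal s ^ p0 * (ofReal (N3 * θ ^ p0) * volume (pc z0 r)) := by
        rw [vol_pc _ hr, ofReal_rpow_of_pos hs, ← ofReal_mul (by positivity), ← ofReal_mul (by positivity)]
        congr 1
        rw [Real.mul_rpow (by positivity) hs.le, Real.mul_rpow hθ.le (by positivity), mul_pow, hN3]; ring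
    _ ≤ _ := by
        gcongr; linarith

lemma iUnion_pc : (⋃ n : ℕ, pc (0 : Pt d) ((n:ℝ) + 1)) = univ := by
  refine eq_univ_of_forall fun w => ?_
  obtain ⟨n, hn⟩ := exists_nat_gt (|w.1| + ‖w.2‖)
  refine mem_iUnion.2 ⟨n, ?_⟩
  have := abs_nonneg w.1
  have := norm_nonneg w.2
  rw [mem_pc]
  constructor
  · simp only [Prod.fst_zero, sub_zero]; nlinarith
  · simp only [Prod.snd_zero, sub_zero]; linarith

lemma mono_pc : Monotone (fun n : ℕ => pc (0 : Pt d) ((n:ℝ) + 1)) := by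
  intro m n h
  refine pc_mono (by positivity) ?_
  have : (m:ℝ) ≤ n := by exact_mod_cast h
  linarith

lemma LI_univ_le {p : ℝ} {H : Pt d → ℝ} {C : ℝ≥0∞} (h : ∀ n : ℕ, LI p H (pc 0 ((n:ℝ) + 1)) ≤ C) :
    LI p H univ ≤ C := by
  unfold LI at *
  rw [← iUnion_pc, setLIntegral_iUnion_of_directed _ mono_pc.directed_le]
  exact iSup_le h

lemma LI_mono {p : ℝ} (hp : 0 ≤ p) {H G : Pt d → ℝ} (D : Set (Pt d)) (h : ∀ w, H w ≤ G w) :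
    LI p H D ≤ LI p G D := by
  unfold LI
  refine lintegral_mono fun w => ?_
  have := h w
  dsimp only
  gcongr

lemma Gd.mono {q s s' r : ℝ} (hq : 0 ≤ q) {H : Pt d → ℝ} {z : Pt d} (h : Gd q H s z r) (hs : s ≤ s') : Gd q H s' z r := by
  unfold Gd at *
  refine h.trans ?_
  gcongr

lemma Nice.LI_lt_top {p : ℝ} (hp : 0 < p) {F : Pt d → ℝ} (hF : Nice F) : LI p (fun z => |F z|) univ < ⊤ := by
  obtain ⟨B, hB⟩ := hF.bdd
  obtain ⟨R, hR, hs⟩ := hF.supp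
  have : LI p (fun z => |F z|) univ = LI p (fun z => |F z|) (pc 0 R) := by
    unfold LI
    rw [Measure.restrict_univ, ← lintegral_indicator (meas_pc _ _)]
    refine lintegral_congr fun w => ?_
    by_cases hw : w ∈ pc 0 R
    · rw [indicator_of_mem hw]
    · simp [indicator_of_notMem hw, hs w hw, hp]
  rw [this]
  calc LI p (fun z => |F z|) (pc 0 R) ≤ ∫⁻ w in pc 0 R, ofReal B ^ p := by
        refine lintegral_mono fun w => ?_
        have := hB w
        dsimp only
        gcongr
    _ < ⊤ := by
        rw [lintegral_const, Measure.restrict_apply_univ]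
        exact ENNReal.mul_lt_top (ENNReal.rpow_lt_top_of_nonneg hp.le ofReal_ne_top) (vol_pc_ne_top _ _).lt_top

lemma MB_of_LI {p X : ℝ} {H : Pt d → ℝ} (h : LI p H univ ≤ ofReal X) : MB p 0 H X := by
  intro z r hr
  rw [Real.rpow_zero, mul_one]
  exact (lintegral_mono_set (subset_univ _)).trans h

lemma CZ_up (d : ℕ) {p N0 N2 : ℝ} (hp : 2 < p) (hN0 : 0 ≤ N0) (hN2 : 0 ≤ N2) :
    ∃ N : ℝ, 0 < N ∧ ∀ K : Pt d → Pt d → ℝ, KN K → Reg N0 K → LpB 2 N2 K → LpB p N K := by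
  obtain ⟨η, hη, hAM⟩ := AM d (q := 2) (p := p) (e := 0) (K := 3) (by norm_num) hp (by positivity) (by norm_num)
  obtain ⟨No, hNo, hosc⟩ := osc d (p0 := 2) (by norm_num) hN0 hN2
  set θ := min (1 / No) (min 1 (η / No)) with hθ
  have hθ0 : 0 < θ := by positivity
  have hθ1 : No * θ ≤ 1 := by
    have : θ ≤ 1 / No := min_le_left _ _
    calc No * θ ≤ No * (1 / No) := by gcongr
      _ = 1 := by field_simp
  have hθ2 : No * θ ^ (2:ℝ) ≤ η := by
    have h1 : θ ≤ 1 := (min_le_right _ _).trans (min_le_left _ _)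
    have h2 : θ ≤ η / No := (min_le_right _ _).trans (min_le_right _ _)
    rw [Real.rpow_two]
    rw [le_div_iff₀ hNo] at h2
    nlinarith [mul_pos hNo hθ0]
  obtain ⟨C, hC, hAM⟩ := hAM θ hθ0
  refine ⟨C, hC, fun K hK hreg hL2 F hF => ?_⟩
  have hTc := TT_cont hK hF
  have hG : GG 2 3 η θ (fun z => |TT K F z|) (fun z => |F z|) := by
    intro z r s hr hs hk
    refine (hosc K hK hreg hL2 F hF z r s θ hr hs hθ0 hθ1 (fun k hk4 => ?_) ?_).trans ?_
    · refine (hk k (by omega)).2.mono (by norm_num) ?_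
      have : (1:ℝ) ≤ (3/2) ^ k := one_le_pow₀ (by norm_num)
      have : 0 < θ * s := by positivity
      nlinarith
    · have := (hk 2 (by norm_num)).1
      norm_num at this
      exact holder_avg one_pos (by norm_num) hTc.abs.measurable _ this
    · gcongr
  have hFt := hF.LI_lt_top (p := p) (by linarith)
  obtain ⟨B, hB⟩ := TT_bdd hK hF
  have hB0 : 0 ≤ B := (abs_nonneg _).trans (hB 0)
  have hTt : LI p (fun z => |TT K F z|) univ < ⊤ := by
    calc LI p (fun z => |TT K F z|) univ ≤ ∫⁻ w in univ, ofReal B ^ (p - 2) * ofReal |TT K F w| ^ (2:ℝ) := by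
          refine lintegral_mono fun w => ?_
          have := hB w
          calc ofReal |TT K F w| ^ p = ofReal |TT K F w| ^ (p - 2) * ofReal |TT K F w| ^ (2:ℝ) := by
                rw [← ENNReal.rpow_add_of_nonneg _ _ (by linarith) (by norm_num)]; congr 1; ring
            _ ≤ _ := by
                gcongr
      _ = ofReal B ^ (p - 2) * LI 2 (fun z => |TT K F z|) univ := by
          rw [lintegral_const_mul' _ _ (ENNReal.rpow_lt_top_of_nonneg (by linarith) ofReal_ne_top).ne]; rfl
      _ < ⊤ := by
          refine ENNReal.mul_lt_top (ENNReal.rpow_lt_top_of_nonneg (by linarith) ofReal_ne_top) ((hL2 F hF).trans_lt ?_)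
          exact ENNReal.mul_lt_top ofReal_lt_top (hF.LI_lt_top (by norm_num))
  have := hAM (fun z => |TT K F z|) (fun z => |F z|) hTc.abs (fun z => abs_nonneg _) hF.meas.abs (fun z => abs_nonneg _) hG
    (LI p (fun z => |TT K F z|) univ).toReal (LI p (fun z => |F z|) univ).toReal toReal_nonneg toReal_nonneg
    (MB_of_LI (by rw [ofReal_toReal hTt.ne])) (MB_of_LI (by rw [ofReal_toReal hFt.ne]))
  refine LI_univ_le fun n => ?_
  have h := this 0 ((n:ℝ) + 1) (by positivity)
  rwa [Real.rpow_zero, mul_one, ofReal_mul hC.le, ofReal_toReal hFt.ne] at h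

lemma KN.transpose {K : Pt d → Pt d → ℝ} (hK : KN K) : KN (fun z w => K w z) := by
  obtain ⟨B, hB⟩ := hK.bdd
  exact ⟨hK.cont.comp continuous_swap, B, fun z w => hB w z⟩

lemma TT_dual {K : Pt d → Pt d → ℝ} (hK : KN K) {F g : Pt d → ℝ} (hF : Nice F) (hg : Nice g) :
    ∫ z, TT (fun z w => K w z) F z * g z = ∫ w, F w * TT K g w := by
  obtain ⟨B, hB⟩ := hK.bdd
  unfold TT
  simp_rw [← integral_mul_const, ← integral_const_mul]
  rw [integral_integral_swap]
  · congr 1; ext w; congr 1; ext z; ring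
  · have h1 : Integrable (fun x : Pt d × Pt d => g x.1 * F x.2) (volume.prod volume) := hg.integrable.mul_prod hF.integrable
    have h2 : Integrable (fun x : Pt d × Pt d => K x.2 x.1 * (g x.1 * F x.2)) (volume.prod volume) :=
      h1.bdd_mul (hK.cont.comp continuous_swap).aestronglyMeasurable (c := B) (eof fun x => hB _ _)
    refine h2.congr (eof fun x => ?_)
    simp only [Function.uncurry]; ring

lemma CZ_dual {p q N : ℝ} (hpq : q.HolderConjugate p) (hN : 0 ≤ N) {K : Pt d → Pt d → ℝ} (hK : KN K)
    (h : LpB p N K) : LpB q (N ^ (q / p)) (fun z w => K w z) := by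
  intro F hF
  refine LI_univ_le fun n => ?_
  set S := pc (0 : Pt d) ((n:ℝ) + 1) with hS
  have hSm : MeasurableSet S := meas_pc _ _
  set h' := TT (fun z w => K w z) F with hh'
  have hc : Continuous h' := TT_cont hK.transpose hF
  obtain ⟨B, hB⟩ := TT_bdd hK.transpose hF
  rw [← hh'] at hB
  have hq := hpq.lt
  have hp := hpq.symm.lt
  have hq0 := hpq.pos
  have hp0 := hpq.symm.pos
  set g := S.indicator (fun z => SignType.sign (h' z) * |h' z| ^ (q - 1)) with hg
  have hgm : Measurable (fun z => (SignType.sign (h' z) : ℝ) * |h' z| ^ (q - 1)) := by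
    refine Measurable.mul ?_ ?_
    · have : (fun z => ((SignType.sign (h' z) : SignType) : ℝ)) = fun z => if 0 < h' z then 1 else if h' z < 0 then -1 else 0 := by
        ext z; rw [sign_apply]; split_ifs <;> simp
      rw [this]
      refine Measurable.ite (measurableSet_lt measurable_const hc.measurable) measurable_const ?_
      exact Measurable.ite (measurableSet_lt hc.measurable measurable_const) measurable_const measurable_const
    · exact hc.abs.measurable.pow_const _
  have habs : ∀ z, |(SignType.sign (h' z) : ℝ) * |h' z| ^ (q - 1)| = |h' z| ^ (q - 1) := by
    intro z
    by_cases h0 : h' z = 0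
    · simp [h0, Real.zero_rpow (by linarith : q - 1 ≠ 0)]
    · rw [abs_mul, abs_of_nonneg (by positivity : 0 ≤ |h' z| ^ (q - 1))]
      rcases lt_or_gt_of_ne h0 with h1 | h1
      · simp [h1]
      · simp [h1]
  have hgn : Nice g := by
    refine ⟨hgm.indicator (meas_pc _ _), ⟨B ^ (q - 1), fun z => ?_⟩, (n:ℝ) + 1, by positivity, fun z hz => ?_⟩
    · by_cases hz : z ∈ S
      · rw [hg, indicator_of_mem hz, habs]
        exact Real.rpow_le_rpow (abs_nonneg _) (hB z) (by linarith)
      · rw [hg, indicator_of_notMem hz, abs_zero]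
        exact Real.rpow_nonneg ((abs_nonneg _).trans (hB z)) _
    · rw [hg, indicator_of_notMem hz]
  set A := LI q (fun z => |h' z|) S with hA
  have hgA : LI p (fun z => |g z|) univ = A := by
    rw [hA]; unfold LI
    rw [Measure.restrict_univ, ← lintegral_indicator hSm]
    refine lintegral_congr fun w => ?_
    by_cases hw : w ∈ S
    · simp only [hg, indicator_of_mem hw, habs]
      rw [← ofReal_rpow_of_nonneg (abs_nonneg _) (by linarith), ← ENNReal.rpow_mul]
      congr 1
      have := hpq.mul_eq_add
      linarith
    · simp [hg, indicator_of_notMem hw, hp0]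
  have hAt : A ≠ ⊤ := by rw [← hgA]; exact (hgn.LI_lt_top hp0).ne
  have hAeq : A = ofReal (∫ z, h' z * g z) := by
    rw [ofReal_integral_eq_lintegral_ofReal]
    · rw [hA]; unfold LI
      rw [← lintegral_indicator hSm]
      refine lintegral_congr fun w => ?_
      by_cases hw : w ∈ S
      · simp only [hg, indicator_of_mem hw]
        rw [ofReal_rpow_of_nonneg (abs_nonneg _) hq0.le, ← mul_assoc]
        congr 1
        rw [mul_comm (h' w), sign_mul_self]
        conv_lhs => rw [show q = 1 + (q - 1) by ring, Real.rpow_add_of_nonneg (abs_nonneg _) zero_le_one (by linarith), Real.rpow_one]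
      · simp [hg, indicator_of_notMem hw]
    · exact hgn.integrable.bdd_mul hc.aestronglyMeasurable (c := B) (eof hB)
    · refine eof fun z => ?_
      simp only [Pi.zero_apply]
      by_cases hz : z ∈ S
      · simp only [hg, indicator_of_mem hz]
        rw [← mul_assoc, mul_comm (h' z), sign_mul_self]; positivity
      · simp [hg, indicator_of_notMem hz]
  have hmain : A ≤ (LI q (fun z => |F z|) univ) ^ (1 / q) * (ofReal N * A) ^ (1 / p) := by
    calc A = ofReal (∫ w, F w * TT K g w) := by rw [hAeq, hh', TT_dual hK hF hgn]
      _ ≤ ∫⁻ w, ofReal (|F w|) * ofReal |TT K g w| := by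
          refine (ofReal_le_ofReal (le_abs_self _)).trans ?_
          rw [← Real.norm_eq_abs, ofReal_norm_eq_enorm]
          refine (enorm_integral_le_lintegral_enorm _).trans_eq ?_
          refine lintegral_congr fun w => ?_
          rw [enorm_mul, ← ofReal_norm_eq_enorm, ← ofReal_norm_eq_enorm]; rfl
      _ ≤ (LI q (fun z => |F z|) univ) ^ (1 / q) * (LI p (fun z => |TT K g z|) univ) ^ (1 / p) := by
          have := ENNReal.lintegral_mul_le_Lp_mul_Lq volume hpq (f := fun w => ofReal (|F w|))
            (g := fun w => ofReal |TT K g w|) hF.meas.abs.ennreal_ofReal.aemeasurable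
            (TT_cont hK hgn).abs.measurable.ennreal_ofReal.aemeasurable
          simpa [LI] using this
      _ ≤ _ := by
          gcongr
          exact (h g hgn).trans_eq (by rw [hgA])
  by_cases hA0 : A = 0
  · rw [hA0]; exact zero_le
  have hFt := (hF.LI_lt_top hq0).ne
  set Φ := LI q (fun z => |F z|) univ
  have hinv : 1 / q + 1 / p = 1 := by simpa using hpq.inv_add_inv_eq_one
  rw [mul_rpow_of_nonneg _ _ (by positivity), ← mul_assoc] at hmain
  have hA1 : A = A ^ (1 / q) * A ^ (1 / p) := by
    rw [← ENNReal.rpow_add_of_nonneg _ _ (by positivity) (by positivity), hinv, ENNReal.rpow_one]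
  have h3 : A ^ (1 / q) ≤ Φ ^ (1 / q) * ofReal N ^ (1 / p) := by
    conv_lhs at hmain => rw [hA1]
    refine (ENNReal.mul_le_mul_iff_left ?_ ?_).1 hmain
    · simp [hA0, hAt, hp0.le]
    · simp [hA0, hAt, hp0.le]
  have h4 := ENNReal.rpow_le_rpow h3 hq0.le
  rw [mul_rpow_of_nonneg _ _ hq0.le, ← ENNReal.rpow_mul, ← ENNReal.rpow_mul, ← ENNReal.rpow_mul,
    one_div_mul_cancel hq0.ne', ENNReal.rpow_one, ENNReal.rpow_one] at h4
  refine h4.trans_eq ?_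
  rw [mul_comm, ofReal_rpow_of_nonneg hN (by positivity)]
  congr 3
  rw [one_div_mul_eq_div]

lemma CZ_down (d : ℕ) {p0 N0 N2 : ℝ} (hp0 : 1 < p0) (hp2 : p0 < 2) (hN0 : 0 ≤ N0) (hN2 : 0 ≤ N2) :
    ∃ N : ℝ, 0 < N ∧ ∀ K : Pt d → Pt d → ℝ, KN K → Reg N0 (fun z w => K w z) → LpB 2 N2 K → LpB p0 N K := by
  have hpq : p0.HolderConjugate (Real.conjExponent p0) := Real.HolderConjugate.conjExponent hp0
  have hp' : 2 < Real.conjExponent p0 := by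
    rw [Real.conjExponent, lt_div_iff₀ (by linarith)]; linarith
  obtain ⟨N, hN, h⟩ := CZ_up d (N2 := N2 ^ ((2:ℝ) / 2)) hp' hN0 (by positivity)
  refine ⟨N ^ (p0 / Real.conjExponent p0), by positivity, fun K hK hreg hL2 => ?_⟩
  have h22 : (2:ℝ).HolderConjugate 2 := Real.HolderConjugate.two_two
  have := h _ hK.transpose hreg (CZ_dual h22 hN2 hK hL2)
  exact CZ_dual hpq hN.le hK.transpose this

open FourierTransform in
lemma planch (f : Spc d → ℂ) (hf : Integrable f) :
    ∫⁻ x, ‖𝓕 f x‖ₑ ^ (2:ℝ) ≤ ∫⁻ x, ‖f x‖ₑ ^ (2:ℝ) := by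
  by_cases htop : ∫⁻ x, ‖f x‖ₑ ^ (2:ℝ) = ⊤
  · rw [htop]; exact le_top
  have hm : MemLp f 2 := by
    refine ⟨hf.1, ?_⟩
    rw [eLpNorm_lt_top_iff_lintegral_rpow_enorm_lt_top (by norm_num) (by norm_num)]
    simpa using lt_top_iff_ne_top.2 htop
  set g : Lp ℂ 2 (volume : Measure (Spc d)) := hm.toLp f with hg
  have hfc : Continuous (𝓕 f) := by
    exact VectorFourier.fourierIntegral_continuous Real.continuous_fourierChar continuous_inner hf
  have hkey : (𝓕 g : Lp ℂ 2 (volume : Measure (Spc d))) =ᵐ[volume] 𝓕 f := by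
    apply ae_eq_of_integral_contDiff_smul_eq
    · exact (Lp.memLp (𝓕 g)).locallyIntegrable (by norm_num)
    · exact hfc.locallyIntegrable
    · intro φ hφ hφc
      have hφ' : ContDiff ℝ (⊤ : ℕ∞) (fun x => (φ x : ℂ)) := Complex.ofRealCLM.contDiff.comp hφ
      have hφc' : HasCompactSupport (fun x => (φ x : ℂ)) := hφc.comp_left (g := fun t : ℝ => (t : ℂ)) (by simp)
      set Φ := hφc'.toSchwartzMap hφ' with hΦ
      have e1 : (Lp.toTemperedDistribution (𝓕 g)) Φ = (Lp.toTemperedDistribution g) (𝓕 Φ) := by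
        rw [← Lp.fourier_toTemperedDistribution_eq, TemperedDistribution.fourier_apply]
      rw [Lp.toTemperedDistribution_apply, Lp.toTemperedDistribution_apply] at e1
      have e2 : ∫ x, (𝓕 Φ) x • (g : Spc d → ℂ) x = ∫ x, (𝓕 (Φ : Spc d → ℂ)) x • f x := by
        refine integral_congr_ae ?_
        filter_upwards [hm.coeFn_toLp] with x hx
        rw [hx, SchwartzMap.fourier_coe]
      have e3 : ∫ x, (𝓕 (Φ : Spc d → ℂ)) x • f x = ∫ x, Φ x • 𝓕 f x := by
        simpa using! (VectorFourier.integral_fourierIntegral_smul_eq_flip (L := innerₗ (Spc d))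
          Real.continuous_fourierChar continuous_inner Φ.integrable hf)
      rw [e2, e3] at e1
      simpa [hΦ] using! e1
  have h1 : eLpNorm (𝓕 f) 2 volume = eLpNorm f 2 volume := by
    have h := Lp.norm_fourier_eq g
    rw [← eLpNorm_congr_ae hkey, ← eLpNorm_congr_ae hm.coeFn_toLp, ← Lp.enorm_def, ← Lp.enorm_def,
      ← ofReal_norm, ← ofReal_norm, h]
  rw [eLpNorm_eq_lintegral_rpow_enorm_toReal (by norm_num) (by norm_num),
    eLpNorm_eq_lintegral_rpow_enorm_toReal (by norm_num) (by norm_num)] at h1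
  have h2 := congrArg (fun y : ℝ≥0∞ => y ^ (2:ℝ)) h1
  simp only [ENNReal.toReal_ofNat] at h2
  rw [← ENNReal.rpow_mul, ← ENNReal.rpow_mul] at h2
  norm_num at h2
  norm_num
  exact h2.le

def qf (A : Mx d) (ξ : Spc d) : ℝ := ∑ i, ∑ j, A i j * ξ i * ξ j

lemma qf_dot (A : Mx d) (ξ : Fin d → ℝ) :
    ξ ⬝ᵥ A.mulVec ξ = qf A (WithLp.toLp 2 ξ) := by
  simp only [qf, dotProduct, Matrix.mulVec, Finset.mul_sum]
  refine Finset.sum_congr rfl fun i _ => Finset.sum_congr rfl fun j _ => ?_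
  ring

lemma qf_add (A B : Mx d) (ξ : Spc d) : qf (A + B) ξ = qf A ξ + qf B ξ := by
  simp only [qf, Matrix.add_apply, add_mul, Finset.sum_add_distrib]

lemma qf_smul (c : ℝ) (A : Mx d) (ξ : Spc d) : qf (c • A) ξ = c * qf A ξ := by
  simp only [qf, Matrix.smul_apply, smul_eq_mul, Finset.mul_sum, mul_assoc]

lemma qf_sub (A B : Mx d) (ξ : Spc d) : qf (A - B) ξ = qf A ξ - qf B ξ := by
  simp only [qf, Matrix.sub_apply, sub_mul, Finset.sum_sub_distrib]

lemma qf_one (ξ : Spc d) : qf (1 : Mx d) ξ = ‖ξ‖ ^ 2 := by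
  simp only [qf, Matrix.one_apply, ite_mul, one_mul, zero_mul, Finset.sum_ite_eq, Finset.mem_univ, if_true]
  rw [EuclideanSpace.norm_sq_eq]
  refine Finset.sum_congr rfl fun i _ => ?_
  rw [Real.norm_eq_abs, sq_abs, sq]

abbrev gam (d : ℕ) : Measure (Spc d) := ProbabilityTheory.stdGaussian (Spc d)

open scoped MatrixOrder Matrix.Norms.L2Operator in
lemma gauss_L (H : Mx d) (hs : H.IsSymm) (h0 : ∀ ξ, 0 ≤ qf H ξ) (c : ℝ) (hc : 0 ≤ c)
    (hH : ∀ ξ, qf H ξ ≤ c ^ 2 * ‖ξ‖ ^ 2) :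
    ∃ L : Spc d →L[ℝ] Spc d, (∀ η, ‖L η‖ ≤ 2 * c * ‖η‖) ∧
      ∀ ξ x, ∫ η, cos (2 * π * inner ℝ ξ (x - L η)) ∂(gam d) =
        cos (2 * π * inner ℝ ξ x) * exp (-(4 * π ^ 2 * qf H ξ)) := by
  have hS : ((2:ℝ) • H).PosSemidef := by
    refine Matrix.PosSemidef.of_dotProduct_mulVec_nonneg ?_ fun x => ?_
    · rw [Matrix.IsHermitian, Matrix.conjTranspose_eq_transpose_of_trivial, Matrix.transpose_smul, hs.eq]
    · rw [star_trivial, qf_dot, qf_smul]; have := h0 (WithLp.toLp 2 x); positivity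
  have hS0 : 0 ≤ (2:ℝ) • H := Matrix.nonneg_iff_posSemidef.2 hS
  set R := CFC.sqrt ((2:ℝ) • H) with hR
  have hRR : R * R = (2:ℝ) • H := CFC.sqrt_mul_sqrt_self _ hS0
  have hRs : star R = R := (Matrix.nonneg_iff_posSemidef.1 (CFC.sqrt_nonneg ((2:ℝ) • H))).1
  set L := Matrix.toEuclideanCLM (𝕜 := ℝ) R with hL
  have hLs : ContinuousLinearMap.adjoint L = L := by
    rw [← ContinuousLinearMap.star_eq_adjoint, hL, ← map_star, hRs]
  have hLn : ∀ η, ‖L η‖ ^ 2 = 2 * qf H η := by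
    intro η
    have e1 : ‖L η‖ ^ 2 = inner ℝ η ((L * L) η) := by
      rw [← real_inner_self_eq_norm_sq, ← ContinuousLinearMap.adjoint_inner_right, hLs]; rfl
    rw [e1, hL, ← map_mul, hRR]
    have : η = WithLp.toLp 2 η.ofLp := rfl
    rw [this, Matrix.toEuclideanCLM_toLp, EuclideanSpace.inner_toLp_toLp, star_trivial, dotProduct_comm, qf_dot, qf_smul]
  refine ⟨L, fun η => ?_, fun ξ x => ?_⟩
  · have h1 : ‖L η‖ ^ 2 ≤ (2 * c * ‖η‖) ^ 2 := by
      rw [hLn]; have := hH η; nlinarith [sq_nonneg (c * ‖η‖)]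
    exact (pow_le_pow_iff_left₀ (norm_nonneg _) (by positivity) two_ne_zero).1 h1
  · have hcf := ProbabilityTheory.charFun_multivariateGaussian (μ := (0 : Spc d)) hS ((-(2 * π)) • ξ)
    rw [charFun_apply, ProbabilityTheory.multivariateGaussian, integral_map (by fun_prop) (by fun_prop)] at hcf
    have e2 : ((-(2 * π)) • ξ).ofLp ⬝ᵥ ((2:ℝ) • H).mulVec ((-(2 * π)) • ξ).ofLp / 2 = 4 * π ^ 2 * qf H ξ := by
      rw [qf_dot, qf_smul]
      simp only [qf, PiLp.smul_apply, smul_eq_mul, Finset.mul_sum, Finset.sum_div]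
      refine Finset.sum_congr rfl fun i _ => Finset.sum_congr rfl fun j _ => ?_
      ring
    have hint : ∀ ξ' : Spc d, Integrable (fun η => Complex.exp ((inner ℝ (L η) ξ' : ℝ) * Complex.I)) (gam d) := by
      intro ξ'
      refine Integrable.of_bound (C := 1) (by fun_prop) (eof fun η => ?_)
      rw [Complex.norm_exp_ofReal_mul_I]
    have e3 : ∀ η, cos (2 * π * inner ℝ ξ (x - L η)) =
       (Complex.exp ((2 * π * inner ℝ ξ x : ℝ) * Complex.I) * Complex.exp ((inner ℝ (L η) ((-(2 * π)) • ξ) : ℝ) * Complex.I)).re := by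
      intro η
      rw [← Complex.exp_add, ← add_mul, ← Complex.ofReal_add, Complex.exp_ofReal_mul_I_re]
      congr 1
      rw [inner_smul_right, inner_sub_right, real_inner_comm (L η) ξ]; ring
    simp_rw [e3]
    have := integral_re (𝕜 := ℂ) ((hint ((-(2 * π)) • ξ)).const_mul (Complex.exp ((2 * π * inner ℝ ξ x : ℝ) * Complex.I)))
    simp only [RCLike.re_eq_complex_re] at this
    rw [this, integral_const_mul]
    simp only [zero_add] at hcf
    rw [hcf, inner_zero_right, Complex.ofReal_zero, zero_mul, zero_sub]
    have e4 : -(((((-(2 * π)) • ξ).ofLp ⬝ᵥ ((2:ℝ) • H).mulVec ((-(2 * π)) • ξ).ofLp : ℝ) : ℂ) / 2) = ((-(4 * π ^ 2 * qf H ξ) : ℝ) : ℂ) := by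
      rw [← e2]; push_cast; ring
    rw [e4, ← Complex.ofReal_exp, Complex.re_mul_ofReal, Complex.exp_ofReal_mul_I_re]

lemma gam_mom (Λ : ℝ) (hΛ : 0 ≤ Λ) (m : ℕ) : Integrable (fun η : Spc d => (1 + ‖η‖) * (1 + Λ * ‖η‖) ^ m) (gam d) := by
  have h := (ProbabilityTheory.IsGaussian.memLp_id (gam d) ((m + 1 : ℕ) : ℝ≥0∞) (by simp)).integrable_norm_pow (by simp)
  have h2 := (((integrable_const (1:ℝ)).add h).const_mul (2 ^ (m + 1) * (1 + Λ) ^ m))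
  refine h2.mono' (by fun_prop) (eof fun η => ?_)
  simp only [id, Pi.add_apply]
  have hn := norm_nonneg η
  rw [Real.norm_of_nonneg (by positivity)]
  have h3 : (1 + ‖η‖) ^ (m + 1) ≤ 2 ^ (m + 1) * (1 + ‖η‖ ^ (m + 1)) := by
    rcases le_total ‖η‖ 1 with h | h
    · calc (1 + ‖η‖) ^ (m + 1) ≤ 2 ^ (m + 1) * 1 := by rw [mul_one]; gcongr; linarith
        _ ≤ _ := by gcongr; simpa using by positivity
    · calc (1 + ‖η‖) ^ (m + 1) ≤ (2 * ‖η‖) ^ (m + 1) := by gcongr; linarith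
        _ ≤ _ := by rw [mul_pow]; gcongr; linarith
  calc (1 + ‖η‖) * (1 + Λ * ‖η‖) ^ m ≤ (1 + ‖η‖) * ((1 + Λ) * (1 + ‖η‖)) ^ m := by
        gcongr; nlinarith
    _ = (1 + Λ) ^ m * (1 + ‖η‖) ^ (m + 1) := by rw [mul_pow]; ring
    _ ≤ (1 + Λ) ^ m * (2 ^ (m + 1) * (1 + ‖η‖ ^ (m + 1))) := by gcongr
    _ = _ := by ring

lemma gaussS (d : ℕ) : ∃ G : SchwartzMap (Spc d) ℂ, ∀ ξ, G ξ = ((exp (-(4 * π ^ 2 * ‖ξ‖ ^ 2)) : ℝ) : ℂ) := by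
  have ht : (fun x : Spc d => -(4 * π ^ 2 * ‖x‖ ^ 2)).HasTemperateGrowth := by
    have := (Function.hasTemperateGrowth_norm_sq (H := Spc d))
    exact ((Function.HasTemperateGrowth.const (4 * π ^ 2)).mul this).neg
  have hcd := ht.1
  have hsm : ContDiff ℝ (⊤ : ℕ∞) (fun x : Spc d => exp (-(4 * π ^ 2 * ‖x‖ ^ 2))) :=
    Real.contDiff_exp.comp hcd
  have hdec : ∀ k n : ℕ, ∃ C, ∀ x : Spc d, ‖x‖ ^ k * ‖iteratedFDeriv ℝ n (fun x : Spc d => exp (-(4 * π ^ 2 * ‖x‖ ^ 2))) x‖ ≤ C := by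
    intro k n
    obtain ⟨l, C, hC, hb⟩ := ht.norm_iteratedFDeriv_le_uniform n
    have hb2 : ∀ x : Spc d, ‖iteratedFDeriv ℝ n (fun x : Spc d => exp (-(4 * π ^ 2 * ‖x‖ ^ 2))) x‖ ≤
        n.factorial * exp (-(4 * π ^ 2 * ‖x‖ ^ 2)) * ((1 + C) * (1 + ‖x‖) ^ l) ^ n := by
      intro x
      have hn := norm_nonneg x
      refine norm_iteratedFDeriv_comp_le (g := exp) (N := (⊤ : ℕ∞)) Real.contDiff_exp hcd (by exact_mod_cast le_top) x ?_ ?_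
      · intro i _
        rw [norm_iteratedFDeriv_eq_norm_iteratedDeriv, iteratedDeriv_eq_iterate, Real.iter_deriv_exp]
        rw [Real.norm_of_nonneg (Real.exp_pos _).le]
      · intro i hi hin
        refine (hb i hin x).trans ?_
        have h1 : 1 ≤ (1 + C) * (1 + ‖x‖) ^ l := by
          have : 1 ≤ (1 + ‖x‖) ^ l := one_le_pow₀ (by linarith)
          nlinarith
        calc C * (1 + ‖x‖) ^ l ≤ (1 + C) * (1 + ‖x‖) ^ l := by gcongr; linarith
          _ = ((1 + C) * (1 + ‖x‖) ^ l) ^ 1 := (pow_one _).symm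
          _ ≤ _ := pow_le_pow_right₀ h1 hi
    refine ⟨n.factorial * (1 + C) ^ n * ((k + l * n).factorial * exp 2), fun x => ?_⟩
    have hn := norm_nonneg x
    have h3 : (1 + ‖x‖) ^ (k + l * n) ≤ (k + l * n).factorial * exp (1 + ‖x‖) := by
      have := Real.pow_div_factorial_le_exp (1 + ‖x‖) (by positivity) (k + l * n)
      rw [div_le_iff₀ (by positivity)] at this
      linarith
    calc _ ≤ (1 + ‖x‖) ^ k * (n.factorial * exp (-(4 * π ^ 2 * ‖x‖ ^ 2)) * ((1 + C) * (1 + ‖x‖) ^ l) ^ n) := by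
          gcongr
          · linarith
          · exact hb2 x
      _ = n.factorial * (1 + C) ^ n * ((1 + ‖x‖) ^ (k + l * n) * exp (-(4 * π ^ 2 * ‖x‖ ^ 2))) := by
          rw [mul_pow, ← pow_mul, pow_add]; ring
      _ ≤ n.factorial * (1 + C) ^ n * (((k + l * n).factorial * exp (1 + ‖x‖)) * exp (-(4 * π ^ 2 * ‖x‖ ^ 2))) := by gcongr
      _ = n.factorial * (1 + C) ^ n * ((k + l * n).factorial * exp (1 + ‖x‖ -(4 * π ^ 2 * ‖x‖ ^ 2))) := by
          rw [mul_assoc ((k + l * n).factorial : ℝ), ← Real.exp_add]; rfl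
      _ ≤ _ := by
          gcongr
          have : 1 ≤ π ^ 2 := by nlinarith [Real.pi_gt_three]
          nlinarith [sq_nonneg (‖x‖ - 1), sq_nonneg ‖x‖, mul_le_mul_of_nonneg_right this (sq_nonneg ‖x‖)]
  exact ⟨SchwartzMap.postcompCLM Complex.ofRealCLM ⟨_, hsm, hdec⟩, fun ξ => rfl⟩

def kk (i j : Fin d) (A : Mx d) (x : Spc d) : ℝ :=
  ∫ ξ : Spc d, (-(4 * π ^ 2 * ξ i * ξ j)) * exp (-(4 * π ^ 2 * qf A ξ)) *
    cos (2 * π * inner ℝ ξ x)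

open FourierTransform in
lemma kk_one (i j : Fin d) : ∃ S : SchwartzMap (Spc d) ℂ, (∀ ξ, S ξ = (((-(4 * π ^ 2 * ξ i * ξ j)) *
    exp (-(4 * π ^ 2 * ‖ξ‖ ^ 2)) : ℝ) : ℂ)) ∧ ∀ x, kk i j 1 x = (𝓕 S x).re := by
  obtain ⟨G, hG⟩ := gaussS d
  have ht : (fun ξ : Spc d => ((-(4 * π ^ 2 * ξ i * ξ j) : ℝ))).HasTemperateGrowth := by
    have h : ∀ i : Fin d, (fun ξ : Spc d => ξ i).HasTemperateGrowth := fun i =>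
      (EuclideanSpace.proj i : Spc d →L[ℝ] ℝ).hasTemperateGrowth
    exact (((Function.HasTemperateGrowth.const (4 * π ^ 2)).mul (h i)).mul (h j)).neg
  refine ⟨SchwartzMap.smulLeftCLM ℂ (fun ξ : Spc d => ((-(4 * π ^ 2 * ξ i * ξ j) : ℝ))) G, ?_, ?_⟩
  · intro ξ
    rw [SchwartzMap.smulLeftCLM_apply_apply ht, hG]
    simp
  · intro x
    set S := SchwartzMap.smulLeftCLM ℂ (fun ξ : Spc d => ((-(4 * π ^ 2 * ξ i * ξ j) : ℝ))) G with hS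
    rw [SchwartzMap.fourier_coe, Real.fourier_eq']
    have hI : Integrable (fun v : Spc d => Complex.exp (((-2 * π * inner ℝ v x : ℝ) : ℂ) * Complex.I) • S v) := by
      refine S.integrable.norm.mono' (by
        have := S.continuous; fun_prop) (eof fun v => ?_)
      rw [norm_smul, Complex.norm_exp_ofReal_mul_I, one_mul]
    have := integral_re (𝕜 := ℂ) hI
    simp only [RCLike.re_eq_complex_re] at this
    rw [← this, kk]
    refine integral_congr_ae (eof fun ξ => ?_)
    simp only [hS]
    rw [SchwartzMap.smulLeftCLM_apply_apply ht, hG, smul_eq_mul, Complex.real_smul, ← Complex.ofReal_mul, Complex.re_mul_ofReal,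
      Complex.exp_ofReal_mul_I_re, qf_one]
    rw [show -2 * π * inner ℝ ξ x = -(2 * π * inner ℝ ξ x) by ring, Real.cos_neg]
    ring

/-- kernel bounds at scale `σ` -/
def KB (C σ : ℝ) (k : Spc d → ℝ) : Prop :=
  (∀ x, |k x| ≤ C * σ / (σ + ‖x‖) ^ (d + 3)) ∧
  ∀ x x', |k x - k x'| ≤ C * ‖x - x'‖ * (1 + ‖x - x'‖ / σ) ^ (d + 3) / (σ + ‖x‖) ^ (d + 3)

open FourierTransform in
lemma kb_one (d : ℕ) : ∃ C, 0 < C ∧ ∀ i j : Fin d, KB C 1 (kk i j (1 : Mx d)) := by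
  have key : ∀ i j : Fin d, ∃ C, 0 < C ∧ KB C 1 (kk i j (1 : Mx d)) := by
    intro i j
    obtain ⟨S, -, hS⟩ := kk_one i j
    have h0 := SchwartzMap.one_add_le_sup_seminorm_apply (𝕜 := ℝ) (m := (d + 3, 1)) (k := d + 3) (n := 0) le_rfl (by simp) (𝓕 S)
    have h1 := SchwartzMap.one_add_le_sup_seminorm_apply (𝕜 := ℝ) (m := (d + 3, 1)) (k := d + 3) (n := 1) le_rfl (by simp) (𝓕 S)
    set C0 := 2 ^ (d + 3, 1).1 * (Finset.Iic (d + 3, 1)).sup (fun m => SchwartzMap.seminorm ℝ m.1 m.2) (𝓕 S) with hC0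
    have hC0n : 0 ≤ C0 := le_trans (by positivity) (h0 0)
    refine ⟨C0 + 1, by positivity, ?_, ?_⟩
    · intro x
      rw [hS, le_div_iff₀ (by positivity)]
      have := h0 x
      rw [norm_iteratedFDeriv_zero] at this
      have h2 := Complex.abs_re_le_norm (𝓕 S x)
      nlinarith [mul_le_mul_of_nonneg_left h2 (by positivity : 0 ≤ (1 + ‖x‖) ^ (d + 3))]
    · intro x x'
      rw [hS, hS, ← Complex.sub_re]
      refine (Complex.abs_re_le_norm _).trans ?_
      rw [norm_sub_rev]
      have hb : ∀ y ∈ segment ℝ x x', ‖fderiv ℝ (⇑(𝓕 S : SchwartzMap (Spc d) ℂ)) y‖ ≤ C0 * (1 + ‖x - x'‖) ^ (d + 3) / (1 + ‖x‖) ^ (d + 3) := by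
        intro y hy
        have h2 := h1 y
        rw [norm_iteratedFDeriv_one] at h2
        have h3 : ‖x‖ ≤ ‖y‖ + ‖x - x'‖ := by
          have h4 : dist x y ≤ dist x x' := by
            have := dist_add_dist_of_mem_segment hy
            linarith [dist_nonneg (x := y) (y := x')]
          rw [dist_eq_norm, dist_eq_norm] at h4
          have := norm_sub_norm_le x y
          linarith
        have h5 : (1 + ‖x‖) ^ (d + 3) ≤ (1 + ‖x - x'‖) ^ (d + 3) * (1 + ‖y‖) ^ (d + 3) := by
          rw [← mul_pow]; gcongr
          nlinarith [norm_nonneg y, norm_nonneg (x - x')]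
        rw [le_div_iff₀ (by positivity)]
        calc ‖fderiv ℝ (⇑(𝓕 S : SchwartzMap (Spc d) ℂ)) y‖ * (1 + ‖x‖) ^ (d + 3) ≤ ‖fderiv ℝ (⇑(𝓕 S : SchwartzMap (Spc d) ℂ)) y‖ * ((1 + ‖x - x'‖) ^ (d + 3) * (1 + ‖y‖) ^ (d + 3)) := by gcongr
          _ = (1 + ‖x - x'‖) ^ (d + 3) * ((1 + ‖y‖) ^ (d + 3) * ‖fderiv ℝ (⇑(𝓕 S : SchwartzMap (Spc d) ℂ)) y‖) := by ring
          _ ≤ (1 + ‖x - x'‖) ^ (d + 3) * C0 := by gcongr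
          _ = _ := by ring
      have := (convex_segment x x').norm_image_sub_le_of_norm_fderiv_le (𝕜 := ℝ) (f := ⇑(𝓕 S : SchwartzMap (Spc d) ℂ)) (fun y _ => (𝓕 S).differentiableAt) hb
        (left_mem_segment ℝ x x') (right_mem_segment ℝ x x')
      rw [norm_sub_rev x' x] at this
      refine this.trans ?_
      rw [div_one]
      calc _ = C0 * ‖x - x'‖ * (1 + ‖x - x'‖) ^ (d + 3) / (1 + ‖x‖) ^ (d + 3) := by ring
        _ ≤ (C0 + 1) * ‖x - x'‖ * (1 + ‖x - x'‖) ^ (d + 3) / (1 + ‖x‖) ^ (d + 3) := by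
          gcongr; linarith
  choose C hC0 hC using key
  refine ⟨1 + ∑ i, ∑ j, C i j, ?_, fun i j => ?_⟩
  · have : 0 ≤ ∑ i, ∑ j, C i j := Finset.sum_nonneg fun i _ => Finset.sum_nonneg fun j _ => (hC0 i j).le
    linarith
  · have hle : C i j ≤ 1 + ∑ i, ∑ j, C i j := by
      have h1 := Finset.single_le_sum (f := fun i => ∑ j, C i j) (fun i _ => Finset.sum_nonneg fun j _ => (hC0 i j).le) (Finset.mem_univ i)
      have h2 := Finset.single_le_sum (f := fun j => C i j) (fun j _ => (hC0 i j).le) (Finset.mem_univ j)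
      linarith
    refine ⟨fun x => ((hC i j).1 x).trans ?_, fun x x' => ((hC i j).2 x x').trans ?_⟩ <;> gcongr

lemma kk_scale (i j : Fin d) {σ : ℝ} (hσ : 0 < σ) (x : Spc d) :
    kk i j (σ ^ 2 • (1 : Mx d)) x = kk i j 1 (σ⁻¹ • x) / σ ^ (d + 2) := by
  have h := Measure.integral_comp_smul_of_nonneg (volume : Measure (Spc d)) (fun ξ : Spc d => (-(4 * π ^ 2 * ξ i * ξ j)) * exp (-(4 * π ^ 2 * qf 1 ξ)) *
    cos (2 * π * inner ℝ ξ (σ⁻¹ • x))) σ (hR := hσ.le)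
  rw [finrank_euclideanSpace_fin] at h
  have h2 : kk i j (σ ^ 2 • (1 : Mx d)) x = (σ ^ 2)⁻¹ * ((σ ^ d)⁻¹ * kk i j 1 (σ⁻¹ • x)) := by
    rw [smul_eq_mul] at h
    rw [kk, kk, ← h, ← integral_const_mul]
    refine integral_congr_ae (eof fun ξ => ?_)
    simp only [qf_smul, qf_one, norm_smul, PiLp.smul_apply, smul_eq_mul, inner_smul_left, inner_smul_right, Real.norm_of_nonneg hσ.le]
    rw [mul_pow, show (starRingEnd ℝ) σ = σ from rfl, show σ⁻¹ * (σ * inner ℝ ξ x) = inner ℝ ξ x by field_simp]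
    field_simp
  rw [h2, pow_add]; field_simp

lemma kb_scale (d : ℕ) : ∃ C, 0 < C ∧ ∀ σ, 0 < σ → ∀ i j : Fin d, KB C σ (kk i j (σ ^ 2 • (1 : Mx d))) := by
  obtain ⟨C, hC, h⟩ := kb_one d
  refine ⟨C, hC, fun σ hσ i j => ⟨fun x => ?_, fun x x' => ?_⟩⟩
  · rw [kk_scale i j hσ, abs_div, abs_of_pos (pow_pos hσ _), div_le_iff₀ (by positivity)]
    refine ((h i j).1 _).trans (le_of_eq ?_)
    rw [norm_smul, norm_inv, Real.norm_of_nonneg hσ.le]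
    have : 1 + σ⁻¹ * ‖x‖ = (σ + ‖x‖) / σ := by field_simp
    rw [this, div_pow]
    have : 0 < σ + ‖x‖ := by positivity
    field_simp
    ring
  · rw [kk_scale i j hσ, kk_scale i j hσ, ← sub_div, abs_div, abs_of_pos (pow_pos hσ _), div_le_iff₀ (by positivity)]
    refine ((h i j).2 _ _).trans (le_of_eq ?_)
    rw [← smul_sub, norm_smul, norm_smul, norm_inv, Real.norm_of_nonneg hσ.le]
    have : 1 + σ⁻¹ * ‖x‖ = (σ + ‖x‖) / σ := by field_simp
    rw [this, div_pow, div_one, inv_mul_eq_div]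
    have : 0 < σ + ‖x‖ := by positivity
    field_simp
    ring

lemma coord_le (ξ : Spc d) (i : Fin d) : |ξ i| ≤ ‖ξ‖ := by
  simpa using PiLp.norm_apply_le (p := 2) ξ i

lemma gint {c : ℝ} (hc : 0 < c) : Integrable (fun ξ : Spc d => 4 * π ^ 2 * ‖ξ‖ ^ 2 * exp (-(4 * π ^ 2 * (c * ‖ξ‖ ^ 2)))) := by
  have h1 : Integrable (fun ξ : Spc d => 4 * π ^ 2 * ‖ξ‖ ^ 2 * exp (-(4 * π ^ 2 * ‖ξ‖ ^ 2))) := by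
    have h2 : ∀ i : Fin d, Integrable (fun ξ : Spc d => 4 * π ^ 2 * ξ i ^ 2 * exp (-(4 * π ^ 2 * ‖ξ‖ ^ 2))) := by
      intro i
      obtain ⟨S, hS, -⟩ := kk_one i i
      refine S.integrable.norm.congr (eof fun ξ => ?_)
      simp only [hS]
      rw [Complex.norm_real, norm_mul, norm_neg, Real.norm_of_nonneg (Real.exp_pos _).le, mul_assoc (4 * π ^ 2), ← sq, Real.norm_of_nonneg (by positivity)]
    refine (integrable_finsetSum Finset.univ fun i _ => h2 i).congr (eof fun ξ => ?_)
    simp only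
    rw [← Finset.sum_mul, ← Finset.mul_sum, EuclideanSpace.norm_sq_eq]
    simp
  have h3 := (h1.comp_smul (R := sqrt c) (Real.sqrt_pos.2 hc).ne').const_mul c⁻¹
  refine h3.congr (eof fun ξ => ?_)
  simp only
  rw [norm_smul, mul_pow, Real.norm_of_nonneg (Real.sqrt_nonneg _), Real.sq_sqrt hc.le]
  field_simp

lemma qf_cont (A : Mx d) : Continuous (qf A) := by unfold qf; fun_prop

lemma kk_bd (i j : Fin d) {A : Mx d} {c : ℝ} (hA : ∀ ξ, c * ‖ξ‖ ^ 2 ≤ qf A ξ) (ξ x : Spc d) :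
    ‖(-(4 * π ^ 2 * ξ i * ξ j)) * exp (-(4 * π ^ 2 * qf A ξ)) *
      cos (2 * π * inner ℝ ξ x)‖ ≤ 4 * π ^ 2 * ‖ξ‖ ^ 2 * exp (-(4 * π ^ 2 * (c * ‖ξ‖ ^ 2))) := by
  rw [norm_mul, norm_mul, norm_neg, Real.norm_of_nonneg (Real.exp_pos _).le, Real.norm_eq_abs, Real.norm_eq_abs, abs_mul, abs_mul, abs_of_pos (by positivity : 0 < 4 * π ^ 2)]
  calc _ ≤ (4 * π ^ 2 * ‖ξ‖ * ‖ξ‖) * exp (-(4 * π ^ 2 * (c * ‖ξ‖ ^ 2))) * 1 := by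
        gcongr
        · exact coord_le ξ i
        · exact coord_le ξ j
        · exact hA ξ
        · exact Real.abs_cos_le_one _
    _ = _ := by ring

lemma kk_cont (i j : Fin d) {A : Mx d} {c : ℝ} (hc : 0 < c) (hA : ∀ ξ, c * ‖ξ‖ ^ 2 ≤ qf A ξ) :
    Continuous (kk i j A) := by
  have := qf_cont A
  exact continuous_of_dominated (fun x => by fun_prop) (fun x => eof fun ξ => kk_bd i j hA ξ x) (gint hc)
    (eof fun ξ => by fun_prop)

lemma kk_conv (i j : Fin d) {A H : Mx d} {c : ℝ} (hc : 0 < c) (hA : ∀ ξ, c * ‖ξ‖ ^ 2 ≤ qf A ξ)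
    (L : Spc d →L[ℝ] Spc d)
    (hL : ∀ ξ x, ∫ η, cos (2 * π * inner ℝ ξ (x - L η)) ∂(gam d) =
        cos (2 * π * inner ℝ ξ x) * exp (-(4 * π ^ 2 * qf H ξ))) (x : Spc d) :
    kk i j (A + H) x = ∫ η, kk i j A (x - L η) ∂(gam d) := by
  have hq := qf_cont A
  have hI : Integrable (fun q : Spc d × Spc d => (-(4 * π ^ 2 * q.2 i * q.2 j)) * exp (-(4 * π ^ 2 * qf A q.2)) *
      cos (2 * π * inner ℝ q.2 (x - L q.1))) ((gam d).prod volume) := by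
    have h1 : Integrable (fun q : Spc d × Spc d => 4 * π ^ 2 * ‖q.2‖ ^ 2 * exp (-(4 * π ^ 2 * (c * ‖q.2‖ ^ 2)))) ((gam d).prod volume) :=
      (gint hc).comp_snd (gam d)
    exact h1.mono' (by fun_prop) (eof fun q => kk_bd i j hA q.2 _)
  unfold kk
  rw [integral_integral_swap hI]
  refine integral_congr_ae (eof fun ξ => ?_)
  simp only
  rw [integral_const_mul, hL, qf_add, mul_add, neg_add, Real.exp_add]
  ring

lemma shift_w {σ : ℝ} (hσ : 0 < σ) (x y : Spc d) : 1 / (σ + ‖x - y‖) ^ (d + 3) ≤ (1 + ‖y‖ / σ) ^ (d + 3) / (σ + ‖x‖) ^ (d + 3) := by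
  rw [div_le_div_iff₀ (by positivity) (by positivity), one_mul, ← mul_pow]
  gcongr
  have h1 : ‖x‖ ≤ ‖x - y‖ + ‖y‖ := by simpa using norm_add_le (x - y) y
  have h2 : ‖y‖ = ‖y‖ / σ * σ := by field_simp
  have h3 : 0 ≤ ‖y‖ / σ * ‖x - y‖ := by positivity
  nlinarith

def MM (d : ℕ) (Λ : ℝ) : ℝ := ∫ η : Spc d, (1 + ‖η‖) * (1 + Λ * ‖η‖) ^ (d + 3) ∂(gam d)

lemma MM_ge {Λ : ℝ} (hΛ : 0 ≤ Λ) : 1 ≤ MM d Λ := by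
  have : ∫ η : Spc d, (1:ℝ) ∂(gam d) ≤ MM d Λ := by
    refine integral_mono (integrable_const _) (gam_mom Λ hΛ _) fun η => ?_
    have h1 : 1 ≤ (1 + Λ * ‖η‖) ^ (d + 3) := one_le_pow₀ (by have := norm_nonneg η; nlinarith)
    have := norm_nonneg η
    simp only; nlinarith
  simpa using this

lemma kb_conv {C σ Λ c : ℝ} (hC : 0 < C) (hσ : 0 < σ) (hΛ : 0 ≤ Λ) (hc0 : 0 ≤ c) (hc : 2 * c ≤ Λ * σ) {k : Spc d → ℝ} (hk : KB C σ k) (hkc : Continuous k)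
    (L : Spc d →L[ℝ] Spc d) (hL : ∀ η, ‖L η‖ ≤ 2 * c * ‖η‖) :
    KB (C * MM d Λ) σ (fun x => ∫ η, k (x - L η) ∂(gam d)) ∧
    ∀ x, |(∫ η, k (x - L η) ∂(gam d)) - k x| ≤ C * MM d Λ * (2 * c) / (σ + ‖x‖) ^ (d + 3) := by
  have hLs : ∀ η, (1 + ‖L η‖ / σ) ≤ 1 + Λ * ‖η‖ := by
    intro η
    have : ‖L η‖ / σ ≤ Λ * ‖η‖ := by
      rw [div_le_iff₀ hσ]
      calc _ ≤ _ := hL η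
        _ ≤ Λ * σ * ‖η‖ := by gcongr
        _ = _ := by ring
    linarith
  have hint : ∀ x, Integrable (fun η => k (x - L η)) (gam d) := by
    intro x
    refine Integrable.of_bound (C := C * σ / σ ^ (d + 3)) (by fun_prop) (eof fun η => ?_)
    refine (hk.1 _).trans ?_
    gcongr
    linarith [norm_nonneg (x - L η)]
  have gen : ∀ (f : Spc d → ℝ) (D : ℝ), 0 ≤ D → (∀ η, |f η| ≤ D * ((1 + ‖η‖) * (1 + Λ * ‖η‖) ^ (d + 3))) →
      |∫ η, f η ∂(gam d)| ≤ D * MM d Λ := by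
    intro f D hD hf
    rw [MM, ← integral_const_mul]
    exact norm_integral_le_of_norm_le (f := f) ((gam_mom Λ hΛ (d + 3)).const_mul D) (eof hf)
  refine ⟨⟨fun x => ?_, fun x x' => ?_⟩, fun x => ?_⟩
  · refine (gen _ (C * σ / (σ + ‖x‖) ^ (d + 3)) (by positivity) fun η => ?_).trans (le_of_eq (by ring))
    refine (hk.1 _).trans ?_
    calc C * σ / (σ + ‖x - L η‖) ^ (d + 3) = C * σ * (1 / (σ + ‖x - L η‖) ^ (d + 3)) := by ring
      _ ≤ C * σ * ((1 + ‖L η‖ / σ) ^ (d + 3) / (σ + ‖x‖) ^ (d + 3)) := mul_le_mul_of_nonneg_left (shift_w hσ x _) (by positivity)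
      _ ≤ C * σ * (((1 + ‖η‖) * (1 + Λ * ‖η‖) ^ (d + 3)) / (σ + ‖x‖) ^ (d + 3)) := by
          gcongr
          refine (pow_le_pow_left₀ (by positivity) (hLs η) _).trans ?_
          exact le_mul_of_one_le_left (by positivity) (by linarith [norm_nonneg η])
      _ = _ := by ring
  · rw [← integral_sub (hint x) (hint x')]
    refine (gen _ (C * ‖x - x'‖ * (1 + ‖x - x'‖ / σ) ^ (d + 3) / (σ + ‖x‖) ^ (d + 3)) (by positivity) fun η => ?_).trans (le_of_eq (by ring))
    refine (hk.2 _ _).trans ?_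
    rw [sub_sub_sub_cancel_right]
    calc _ = C * ‖x - x'‖ * (1 + ‖x - x'‖ / σ) ^ (d + 3) * (1 / (σ + ‖x - L η‖) ^ (d + 3)) := by ring
      _ ≤ C * ‖x - x'‖ * (1 + ‖x - x'‖ / σ) ^ (d + 3) * ((1 + ‖L η‖ / σ) ^ (d + 3) / (σ + ‖x‖) ^ (d + 3)) := mul_le_mul_of_nonneg_left (shift_w hσ x _) (by positivity)
      _ ≤ C * ‖x - x'‖ * (1 + ‖x - x'‖ / σ) ^ (d + 3) * (((1 + ‖η‖) * (1 + Λ * ‖η‖) ^ (d + 3)) / (σ + ‖x‖) ^ (d + 3)) := by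
          gcongr
          refine (pow_le_pow_left₀ (by positivity) (hLs η) _).trans ?_
          exact le_mul_of_one_le_left (by positivity) (by linarith [norm_nonneg η])
      _ = _ := by ring
  · have e : (∫ η, k (x - L η) ∂(gam d)) - k x = ∫ η, (k (x - L η) - k x) ∂(gam d) := by
      rw [integral_sub (hint x) (integrable_const _)]; simp
    rw [e]
    refine (gen _ (C * (2 * c) / (σ + ‖x‖) ^ (d + 3)) (by positivity) fun η => ?_).trans (le_of_eq (by ring))
    rw [abs_sub_comm]
    refine (hk.2 _ _).trans ?_
    rw [sub_sub_cancel]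
    calc _ ≤ C * (2 * c * ‖η‖) * (1 + Λ * ‖η‖) ^ (d + 3) / (σ + ‖x‖) ^ (d + 3) := by
          have h5 := pow_le_pow_left₀ (by positivity) (hLs η) (d + 3)
          exact div_le_div_of_nonneg_right (mul_le_mul (mul_le_mul_of_nonneg_left (hL η) hC.le) h5 (by positivity) (by positivity)) (by positivity)
      _ ≤ C * (2 * c * (1 + ‖η‖)) * (1 + Λ * ‖η‖) ^ (d + 3) / (σ + ‖x‖) ^ (d + 3) := by
          gcongr; linarith
      _ = _ := by ring

structure Adm (δ : ℝ) (B : ℝ → Mx d) : Prop where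
  cont : ∀ i j, Continuous fun t => B t i j
  symm : ∀ s t, (B s - B t).IsSymm
  low : ∀ t s, t ≤ s → ∀ ξ, δ * (s - t) * ‖ξ‖ ^ 2 ≤ qf (B s - B t) ξ
  up : ∀ t s, t ≤ s → ∀ ξ, qf (B s - B t) ξ ≤ δ⁻¹ * (s - t) * ‖ξ‖ ^ 2

structure Cut (ε : ℝ) (ψ : ℝ → ℝ) : Prop where
  pos : 0 < ε
  cont : Continuous ψ
  nonneg : ∀ τ, 0 ≤ ψ τ
  le_one : ∀ τ, ψ τ ≤ 1
  zero : ∀ τ, τ ≤ ε → ψ τ = 0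
  lip : ∀ τ τ', 0 < τ → τ ≤ τ' → |ψ τ - ψ τ'| ≤ 3 * (τ' - τ) / τ

def Ker (i j : Fin d) (ψ : ℝ → ℝ) (B : ℝ → Mx d) (z w : Pt d) : ℝ :=
  ψ (w.1 - z.1) * kk i j (B w.1 - B z.1) (z.2 - w.2)

lemma kbB (d : ℕ) {δ : ℝ} (hδ : 0 < δ) : ∃ C, 0 < C ∧ ∀ B, Adm (d := d) δ B → ∀ i j : Fin d, ∀ t s, t < s →
    KB C (sqrt (δ * (s - t))) (kk i j (B s - B t)) ∧
    ∀ t', t' ≤ t → t - t' ≤ s - t → ∀ x, |kk i j (B s - B t') x - kk i j (B s - B t) x| ≤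
      C * sqrt (t - t') / (sqrt (δ * (s - t)) + ‖x‖) ^ (d + 3) := by
  obtain ⟨C0, hC0, h0⟩ := kb_scale d
  have hΛ : 0 ≤ 2 / δ := by positivity
  have hM := MM_ge (d := d) hΛ
  refine ⟨C0 * MM d (2 / δ) + C0 * MM d (2 / δ) * MM d (2 / δ) * (2 * sqrt δ⁻¹), by positivity, fun B hB i j t s hts => ?_⟩
  set σ := sqrt (δ * (s - t)) with hσ
  have hst : 0 < s - t := sub_pos.2 hts
  have hσp : 0 < σ := Real.sqrt_pos.2 (by positivity)
  have hσ2 : σ ^ 2 = δ * (s - t) := Real.sq_sqrt (by positivity)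
  have hk1 : KB (C0 * MM d (2 / δ)) σ (kk i j (B s - B t)) := by
    obtain ⟨L, hL1, hL2⟩ := gauss_L (B s - B t - σ ^ 2 • 1) ((hB.symm s t).sub (by simp [Matrix.IsSymm])) (fun ξ => by
      rw [qf_sub, qf_smul, qf_one, hσ2]; have := hB.low t s hts.le ξ; linarith) (σ / δ) (by positivity) (fun ξ => by
      rw [qf_sub, qf_smul, qf_one, div_pow, hσ2]
      have := hB.up t s hts.le ξ
      have e : δ * (s - t) / δ ^ 2 * ‖ξ‖ ^ 2 = δ⁻¹ * (s - t) * ‖ξ‖ ^ 2 := by field_simp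
      rw [e]
      have : 0 ≤ δ * (s - t) * ‖ξ‖ ^ 2 := by positivity
      linarith)
    have hlow : ∀ ξ : Spc d, σ ^ 2 * ‖ξ‖ ^ 2 ≤ qf (σ ^ 2 • 1) ξ := fun ξ => by rw [qf_smul, qf_one]
    have := (kb_conv (Λ := 2 / δ) hC0 hσp hΛ (by positivity) (by field_simp; rfl) (h0 σ hσp i j) (kk_cont i j (by positivity) hlow) L hL1).1
    have e : (fun x => ∫ η, kk i j (σ ^ 2 • 1) (x - L η) ∂(gam d)) = kk i j (B s - B t) := by
      funext x
      rw [← kk_conv i j (by positivity) hlow L hL2]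
      congr 1; abel
    rwa [e] at this
  have hmono : C0 * MM d (2 / δ) ≤ C0 * MM d (2 / δ) + C0 * MM d (2 / δ) * MM d (2 / δ) * (2 * sqrt δ⁻¹) := by
    have : 0 ≤ C0 * MM d (2 / δ) * MM d (2 / δ) * (2 * sqrt δ⁻¹) := by positivity
    linarith
  refine ⟨⟨fun x => (hk1.1 x).trans (by gcongr), fun x x' => (hk1.2 x x').trans (by gcongr)⟩, fun t' ht' htt x => ?_⟩
  have hd : 0 ≤ t - t' := sub_nonneg.2 ht'
  have hc2 : sqrt (δ⁻¹ * (t - t')) ^ 2 = δ⁻¹ * (t - t') := Real.sq_sqrt (by positivity)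
  obtain ⟨L, hL1, hL2⟩ := gauss_L (B t - B t') (hB.symm t t') (fun ξ => le_trans (by positivity) (hB.low t' t ht' ξ)) (sqrt (δ⁻¹ * (t - t'))) (by positivity)
    (fun ξ => by rw [hc2]; exact hB.up t' t ht' ξ)
  have hlow : ∀ ξ : Spc d, σ ^ 2 * ‖ξ‖ ^ 2 ≤ qf (B s - B t) ξ := fun ξ => by rw [hσ2]; exact hB.low t s hts.le ξ
  have hcs : 2 * sqrt (δ⁻¹ * (t - t')) ≤ 2 / δ * σ := by
    have : sqrt (δ⁻¹ * (t - t')) ≤ σ / δ := by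
      refine Real.sqrt_le_iff.2 ⟨by positivity, ?_⟩
      rw [div_pow, hσ2]
      have e : δ * (s - t) / δ ^ 2 = δ⁻¹ * (s - t) := by field_simp
      rw [e]; gcongr
    calc _ ≤ 2 * (σ / δ) := by gcongr
      _ = _ := by ring
  have := (kb_conv (Λ := 2 / δ) (by positivity) hσp hΛ (by positivity) hcs hk1 (kk_cont i j (by positivity) hlow) L hL1).2 x
  rw [← kk_conv i j (by positivity) hlow L hL2, show B s - B t + (B t - B t') = B s - B t' by abel] at this
  refine this.trans ?_
  rw [Real.sqrt_mul (by positivity)]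
  refine div_le_div_of_nonneg_right ?_ (by positivity)
  have : 0 ≤ C0 * MM d (2 / δ) * sqrt (t - t') := by positivity
  linarith

lemma Ker_KN {δ ε : ℝ} (hδ : 0 < δ) (i j : Fin d) {ψ : ℝ → ℝ} (hψ : Cut ε ψ) {B : ℝ → Mx d} (hB : Adm δ B) :
    KN (Ker i j ψ B) := by
  have hε := hψ.pos
  have hbd : ∀ (q : Pt d × Pt d) (ξ : Spc d), ‖ψ (q.2.1 - q.1.1) * ((-(4 * π ^ 2 * ξ i * ξ j)) * exp (-(4 * π ^ 2 * qf (B q.2.1 - B q.1.1) ξ)) *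
      cos (2 * π * inner ℝ ξ (q.1.2 - q.2.2)))‖ ≤ 4 * π ^ 2 * ‖ξ‖ ^ 2 * exp (-(4 * π ^ 2 * ((δ * ε) * ‖ξ‖ ^ 2))) := by
    intro q ξ
    by_cases h : q.2.1 - q.1.1 ≤ ε
    · rw [hψ.zero _ h, zero_mul, norm_zero]; positivity
    · have h' := not_le.1 h
      have h1 : ∀ ξ, δ * ε * ‖ξ‖ ^ 2 ≤ qf (B q.2.1 - B q.1.1) ξ := fun ξ =>
        le_trans (by gcongr) (hB.low q.1.1 q.2.1 (by linarith) ξ)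
      rw [norm_mul, Real.norm_of_nonneg (hψ.nonneg _)]
      refine (mul_le_of_le_one_left (norm_nonneg _) (hψ.le_one _)).trans (kk_bd i j h1 ξ _)
  have e : Function.uncurry (Ker i j ψ B) = fun q : Pt d × Pt d => ∫ ξ : Spc d, ψ (q.2.1 - q.1.1) * ((-(4 * π ^ 2 * ξ i * ξ j)) * exp (-(4 * π ^ 2 * qf (B q.2.1 - B q.1.1) ξ)) *
      cos (2 * π * inner ℝ ξ (q.1.2 - q.2.2))) := by
    funext q
    rw [integral_const_mul]; rfl
  refine ⟨?_, ∫ ξ : Spc d, 4 * π ^ 2 * ‖ξ‖ ^ 2 * exp (-(4 * π ^ 2 * ((δ * ε) * ‖ξ‖ ^ 2))), fun z w => ?_⟩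
  · rw [e]
    have hψc := hψ.cont
    have hBc := hB.cont
    refine continuous_of_dominated (fun q => ?_) (fun q => eof (hbd q)) (gint (by positivity)) (eof fun ξ => ?_)
    · have := qf_cont (B q.2.1 - B q.1.1)
      fun_prop
    · have : Continuous fun q : Pt d × Pt d => qf (B q.2.1 - B q.1.1) ξ := by
        unfold qf
        simp only [Matrix.sub_apply]
        refine continuous_finset_sum _ fun i _ => continuous_finset_sum _ fun j _ => ?_
        have := hBc i j
        fun_prop
      fun_prop
  · have := congrFun e (z, w)
    simp only [Function.uncurry] at this
    rw [this]
    exact norm_integral_le_of_norm_le (gint (by positivity)) (eof (hbd (z, w)))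

set_option maxHeartbeats 1000000 in
lemma Ker_reg (d : ℕ) {δ : ℝ} (hδ : 0 < δ) (hδ1 : δ ≤ 1) : ∃ N, 0 < N ∧ ∀ B, Adm (d := d) δ B → ∀ ε ψ, Cut ε ψ → ∀ i j,
    Reg N (Ker i j ψ B) := by
  obtain ⟨C, hC, hCB⟩ := kbB d hδ
  set κ := sqrt δ / 2 with hκ
  have hsd : 0 < sqrt δ := Real.sqrt_pos.2 hδ
  have hsd1 : sqrt δ ≤ 1 := Real.sqrt_le_one.2 hδ1
  have hκ0 : 0 < κ := by positivity
  set N1 := 20 * C * (1 / κ) ^ (d + 3) with hN1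
  set N2 := C * (1 / κ) ^ (d + 3) * (24 + 8 * (1 + 1 / sqrt δ) ^ (d + 3) + 6) with hN2
  have hN1p : 0 < N1 := by positivity
  have hN2p : 0 < N2 := by positivity
  refine ⟨N1 + N2, by positivity, fun B hB ε ψ hψ i j z0 r hr k hk => ?_⟩
  set ϱ := 2 ^ k * r with hϱ
  have hϱ16 : 16 * r ≤ ϱ := by
    rw [hϱ]; gcongr
    calc (16:ℝ) = 2 ^ 4 := by norm_num
      _ ≤ 2 ^ k := pow_le_pow_right₀ (by norm_num) hk
  have hϱ0 : 0 < ϱ := by positivity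
  have htarget : ∀ N : ℝ, N * 2⁻¹ ^ k / ϱ ^ (d + 2) = N * r * (1 / ϱ) ^ (d + 3) := by
    intro N
    have : (2⁻¹:ℝ) ^ k = r / ϱ := by rw [hϱ, inv_pow]; field_simp
    rw [this, one_div_pow, pow_succ ϱ (d + 2)]; field_simp
  have hW : ∀ v : ℝ, κ * ϱ ≤ v → 1 / v ^ (d + 3) ≤ (1 / κ) ^ (d + 3) * (1 / ϱ) ^ (d + 3) := by
    intro v hv
    rw [← mul_pow, ← one_div_pow]
    have : 0 < v := lt_of_lt_of_le (by positivity) hv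
    gcongr
    rw [one_div_mul_one_div]
    gcongr
  suffices main : ∀ z ∈ pc z0 (4 * r), ∀ z' ∈ pc z0 (4 * r), z'.1 ≤ z.1 → ∀ w, w ∉ pc z0 ϱ →
      |Ker i j ψ B z w - Ker i j ψ B z' w| ≤ (N1 + N2) * 2⁻¹ ^ k / ϱ ^ (d + 2) by
    intro z hz z' hz' w hw
    rcases le_total z'.1 z.1 with h | h
    · exact main z hz z' hz' h w hw
    · rw [abs_sub_comm]; exact main z' hz' z hz h w hw
  rintro ⟨t, x⟩ hz ⟨t', x'⟩ hz' htt ⟨s, y⟩ hw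
  rw [mem_pc] at hz hz' hw
  simp only at hz hz' hw htt
  obtain ⟨hz1, hz2⟩ := hz
  obtain ⟨hz1', hz2'⟩ := hz'
  rw [abs_lt] at hz1 hz1'
  rw [htarget]
  have hxx : ‖x - x'‖ ≤ 8 * r := by
    have := norm_sub_le (x - z0.2) (x' - z0.2)
    rw [sub_sub_sub_cancel_right] at this; linarith
  have hfar : ∀ x : Spc d, ‖x - z0.2‖ < 4 * r → ϱ ≤ ‖y - z0.2‖ → κ * ϱ ≤ ‖x - y‖ := by
    intro x hx h
    have h1 : ‖y - z0.2‖ ≤ ‖x - y‖ + ‖x - z0.2‖ := by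
      have := norm_sub_le (x - z0.2) (x - y)
      rw [sub_sub_sub_cancel_left] at this; linarith
    have : κ * ϱ ≤ 1 / 2 * ϱ := by gcongr; rw [hκ]; linarith
    linarith
  unfold Ker
  simp only
  rcases le_or_gt (s - t) (64 * r ^ 2) with hA | hA
  · have hone : ∀ t x, s - t ≤ 100 * r ^ 2 → κ * ϱ ≤ ‖x - y‖ → |ψ (s - t) * kk i j (B s - B t) (x - y)| ≤ 10 * C * (1 / κ) ^ (d + 3) * r * (1 / ϱ) ^ (d + 3) := by
      intro t x hτ hxy
      rcases le_or_gt s t with h | h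
      · rw [hψ.zero _ (by linarith [hψ.pos]), zero_mul, abs_zero]; positivity
      have h1 := ((hCB B hB i j t s h).1).1 (x - y)
      rw [abs_mul, abs_of_nonneg (hψ.nonneg _)]
      refine (mul_le_of_le_one_left (abs_nonneg _) (hψ.le_one _)).trans (h1.trans ?_)
      have hσ : sqrt (δ * (s - t)) ≤ 10 * r := by
        refine Real.sqrt_le_iff.2 ⟨by positivity, ?_⟩
        have : δ * (s - t) ≤ 1 * (s - t) := by gcongr
        linarith
      have h2 := hW (sqrt (δ * (s - t)) + ‖x - y‖) (by linarith [Real.sqrt_nonneg (δ * (s - t))])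
      calc _ = C * sqrt (δ * (s - t)) * (1 / (sqrt (δ * (s - t)) + ‖x - y‖) ^ (d + 3)) := by ring
        _ ≤ C * (10 * r) * ((1 / κ) ^ (d + 3) * (1 / ϱ) ^ (d + 3)) := by gcongr
        _ = _ := by ring
    by_cases hy : ϱ ≤ ‖y - z0.2‖
    · have a1 := hone t x (by nlinarith) (hfar x hz2 hy)
      have a2 := hone t' x' (by nlinarith) (hfar x' hz2' hy)
      refine (abs_sub _ _).trans ((add_le_add a1 a2).trans ?_)
      have : 0 ≤ N2 * r * (1 / ϱ) ^ (d + 3) := by positivity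
      calc _ = N1 * r * (1 / ϱ) ^ (d + 3) := by rw [hN1]; ring
        _ ≤ _ := by linarith
    · have hs : ϱ ^ 2 ≤ |s - z0.1| := by
        by_contra h; exact hw ⟨not_le.1 h, not_le.1 hy⟩
      have hq : 256 * r ^ 2 ≤ ϱ ^ 2 := by nlinarith
      have hs' : s ≤ z0.1 - ϱ ^ 2 := by
        rcases le_abs.1 hs with h | h
        · nlinarith
        · linarith
      rw [hψ.zero (s - t) (by nlinarith [hψ.pos]), hψ.zero (s - t') (by nlinarith [hψ.pos])]
      simp only [zero_mul, sub_self, abs_zero]; positivity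
  · have hr2 : 0 < r ^ 2 := by positivity
    have hts : t < s := by linarith
    have hts' : t' < s := by linarith
    set q := sqrt (s - t) with hq
    have hq2 : q ^ 2 = s - t := Real.sq_sqrt (by linarith)
    have hq8 : 8 * r ≤ q := Real.le_sqrt_of_sq_le (by nlinarith)
    have hq0 : 0 < q := by linarith
    have hσ : sqrt (δ * (s - t)) = sqrt δ * q := Real.sqrt_mul hδ.le _
    have hσ' : sqrt (δ * (s - t)) ≤ sqrt (δ * (s - t')) := by gcongr
    have hσ'2 : sqrt (δ * (s - t')) ≤ 2 * q := by
      refine Real.sqrt_le_iff.2 ⟨by positivity, ?_⟩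
      have : δ * (s - t') ≤ 1 * (s - t') := by gcongr
      nlinarith
    have hlow : ∀ x : Spc d, ‖x - z0.2‖ < 4 * r → κ * ϱ ≤ sqrt (δ * (s - t)) + ‖x - y‖ := by
      intro x hx
      by_cases hy : ϱ ≤ ‖y - z0.2‖
      · have := hfar x hx hy; linarith [Real.sqrt_nonneg (δ * (s - t))]
      · have hs : ϱ ^ 2 ≤ |s - z0.1| := by
          by_contra h; exact hw ⟨not_le.1 h, not_le.1 hy⟩
        have hq' : 256 * r ^ 2 ≤ ϱ ^ 2 := by nlinarith
        have hs' : ϱ ^ 2 ≤ s - z0.1 := by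
          rcases le_abs.1 hs with h | h
          · exact h
          · nlinarith
        have : ϱ / 2 ≤ q := Real.le_sqrt_of_sq_le (by nlinarith)
        rw [hσ, hκ]
        have := mul_le_mul_of_nonneg_left this hsd.le
        linarith [norm_nonneg (x - y)]
    set A1 := kk i j (B s - B t) (x - y)
    set A2 := kk i j (B s - B t) (x' - y)
    set A3 := kk i j (B s - B t') (x' - y)
    set W := (1 / κ) ^ (d + 3) * (1 / ϱ) ^ (d + 3) with hWd
    have hWp : 0 < W := by positivity
    have b1 : |A1 - A2| ≤ C * (8 * r) * (1 + 1 / sqrt δ) ^ (d + 3) * W := by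
      have h1 := ((hCB B hB i j t s hts).1).2 (x - y) (x' - y)
      rw [sub_sub_sub_cancel_right] at h1
      refine h1.trans ?_
      have h2 : ‖x - x'‖ / sqrt (δ * (s - t)) ≤ 1 / sqrt δ := by
        rw [hσ, div_le_div_iff₀ (by positivity) hsd, one_mul, mul_comm]
        exact mul_le_mul_of_nonneg_left (hxx.trans hq8) hsd.le
      rw [div_eq_mul_one_div]
      gcongr
      exact hW _ (hlow x hz2)
    have b2 : |A3 - A2| ≤ C * (6 * r) * W := by
      have h1 := (hCB B hB i j t s hts).2 t' htt (by nlinarith) (x' - y)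
      refine h1.trans ?_
      have : sqrt (t - t') ≤ 6 * r := Real.sqrt_le_iff.2 ⟨by positivity, by nlinarith⟩
      rw [div_eq_mul_one_div]
      gcongr
      exact hW _ (hlow x' hz2')
    have b3 : |(ψ (s - t) - ψ (s - t')) * A3| ≤ C * (24 * r) * W := by
      have h1 := ((hCB B hB i j t' s hts').1).1 (x' - y)
      have h2 := hψ.lip (s - t) (s - t') (by linarith) (by linarith)
      rw [abs_mul]
      calc _ ≤ (3 * (s - t' - (s - t)) / (s - t)) * (C * sqrt (δ * (s - t')) * (1 / (sqrt (δ * (s - t')) + ‖x' - y‖) ^ (d + 3))) := by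
            rw [mul_one_div]; exact mul_le_mul h2 h1 (abs_nonneg _) (div_nonneg (by linarith) (by linarith))
        _ ≤ (3 * (32 * r ^ 2) / (s - t)) * (C * (2 * q) * W) := by
            gcongr
            · nlinarith
            · exact hW _ ((hlow x' hz2').trans (by gcongr))
        _ = C * W * (192 * r ^ 2 / q) := by rw [← hq2]; field_simp; ring
        _ ≤ C * W * (24 * r) := by
            gcongr
            rw [div_le_iff₀ hq0]; nlinarith
        _ = _ := by ring
    have e : ψ (s - t) * A1 - ψ (s - t') * A3 = ψ (s - t) * (A1 - A2) + (-(ψ (s - t) * (A3 - A2)) + (ψ (s - t) - ψ (s - t')) * A3) := by ring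
    rw [e]
    have c1 : |ψ (s - t) * (A1 - A2)| ≤ |A1 - A2| := by
      rw [abs_mul, abs_of_nonneg (hψ.nonneg _)]; exact mul_le_of_le_one_left (abs_nonneg _) (hψ.le_one _)
    have c2 : |ψ (s - t) * (A3 - A2)| ≤ |A3 - A2| := by
      rw [abs_mul, abs_of_nonneg (hψ.nonneg _)]; exact mul_le_of_le_one_left (abs_nonneg _) (hψ.le_one _)
    have d1 := abs_add_le (ψ (s - t) * (A1 - A2)) (-(ψ (s - t) * (A3 - A2)) + (ψ (s - t) - ψ (s - t')) * A3)
    have d2 := abs_add_le (-(ψ (s - t) * (A3 - A2))) ((ψ (s - t) - ψ (s - t')) * A3)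
    rw [abs_neg] at d2
    have : 0 ≤ N1 * r * (1 / ϱ) ^ (d + 3) := by positivity
    have e2 : N2 * r * (1 / ϱ) ^ (d + 3) = C * (24 * r) * W + C * (8 * r) * (1 + 1 / sqrt δ) ^ (d + 3) * W + C * (6 * r) * W := by
      rw [hN2, hWd]; ring
    linarith

lemma Adm.refl {δ : ℝ} {B : ℝ → Mx d} (hB : Adm δ B) : Adm δ (fun t => -B (-t)) := by
  have e : ∀ s t, -B (-s) - -B (-t) = B (-t) - B (-s) := fun s t => by abel
  refine ⟨fun i j => ?_, fun s t => ?_, fun t s h ξ => ?_, fun t s h ξ => ?_⟩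
  · simp only [Matrix.neg_apply]; have := hB.cont i j; fun_prop
  · rw [e]; exact hB.symm _ _
  · rw [e]; have := hB.low (-s) (-t) (by linarith) ξ
    rwa [show -t - -s = s - t by ring] at this
  · rw [e]; have := hB.up (-s) (-t) (by linarith) ξ
    rwa [show -t - -s = s - t by ring] at this

lemma Ker_regT {δ N ε : ℝ} (i j : Fin d) {ψ : ℝ → ℝ} (hψ : Cut ε ψ) {B : ℝ → Mx d}
    (h : Reg N (Ker i j ψ (fun t => -B (-t)))) : Reg N (fun z w => Ker i j ψ B w z) := by
  have ev : ∀ A : Mx d, ∀ x, kk i j A (-x) = kk i j A x := by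
    intro A x; unfold kk; simp only [inner_neg_right, mul_neg, Real.cos_neg]
  have e : ∀ z w : Pt d, Ker i j ψ B w z = Ker i j ψ (fun t => -B (-t)) (-z.1, z.2) (-w.1, w.2) := by
    intro z w
    simp only [Ker, neg_neg]
    rw [show -w.1 - -z.1 = z.1 - w.1 by ring, ← neg_sub z.2 w.2, ev, show -B w.1 - -B z.1 = B z.1 - B w.1 by abel]
  have hm : ∀ z0 : Pt d, ∀ r z, (-z.1, z.2) ∈ pc ((-z0.1, z0.2) : Pt d) r ↔ z ∈ pc z0 r := by
    intro z0 r z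
    rw [mem_pc, mem_pc]; simp only
    rw [show -z.1 - -z0.1 = -(z.1 - z0.1) by ring, abs_neg]
  intro z0 r hr k hk z hz z' hz' w hw
  simp only [e]
  exact h (-z0.1, z0.2) r hr k hk _ ((hm _ _ _).2 hz) _ ((hm _ _ _).2 hz') _ (fun hh => hw ((hm _ _ _).1 hh))

def mu (i j : Fin d) (ψ : ℝ → ℝ) (B : ℝ → Mx d) (t s : ℝ) (ξ : Spc d) : ℝ :=
  ψ (s - t) * ((-(4 * π ^ 2 * ξ i * ξ j)) * exp (-(4 * π ^ 2 * qf (B s - B t) ξ)))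

def kx (δ τ : ℝ) (ξ : Spc d) : ℝ≥0∞ := (Ioi (0:ℝ)).indicator (fun τ =>
  ofReal (4 * π ^ 2 * ‖ξ‖ ^ 2 * exp (-(4 * π ^ 2 * ((δ * τ) * ‖ξ‖ ^ 2))))) τ

lemma kx_meas (δ : ℝ) : Measurable (fun q : ℝ × Spc d => kx δ q.1 q.2) := by
  have : (fun q : ℝ × Spc d => kx δ q.1 q.2) = (Ioi (0:ℝ) ×ˢ (univ : Set (Spc d))).indicator (fun q =>
    ofReal (4 * π ^ 2 * ‖q.2‖ ^ 2 * exp (-(4 * π ^ 2 * ((δ * q.1) * ‖q.2‖ ^ 2))))) := by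
    ext q
    simp [kx, indicator]
  rw [this]
  exact Measurable.indicator (by fun_prop) (measurableSet_Ioi.prod MeasurableSet.univ)

lemma kx_meas' (δ : ℝ) {α : Type*} [MeasurableSpace α] {f : α → ℝ} {g : α → Spc d} (hf : Measurable f) (hg : Measurable g) :
    Measurable (fun a => kx δ (f a) (g a)) := by
  have := (kx_meas (d := d) δ).comp (hf.prodMk hg)
  exact this

lemma kx_int {δ : ℝ} (hδ : 0 < δ) (ξ : Spc d) : ∫⁻ τ, kx δ τ ξ ≤ ofReal δ⁻¹ := by
  unfold kx
  rw [lintegral_indicator measurableSet_Ioi]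
  rcases eq_or_ne ξ 0 with h | h
  · simp [h]
  have hn : 0 < ‖ξ‖ := norm_pos_iff.2 h
  have ha : -(4 * π ^ 2 * δ * ‖ξ‖ ^ 2) < 0 := by
    have := Real.pi_pos
    have : 0 < 4 * π ^ 2 * δ * ‖ξ‖ ^ 2 := by positivity
    linarith
  rw [← ofReal_integral_eq_lintegral_ofReal]
  · apply ofReal_le_ofReal
    rw [integral_const_mul]
    have : ∀ τ:ℝ, -(4 * π ^ 2 * ((δ * τ) * ‖ξ‖ ^ 2)) = -(4 * π ^ 2 * δ * ‖ξ‖ ^ 2) * τ := fun τ => by ring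
    simp only [this]
    rw [integral_exp_mul_Ioi ha 0]
    apply le_of_eq
    have := Real.pi_pos
    simp
    field_simp
  · have : ∀ τ:ℝ, -(4 * π ^ 2 * ((δ * τ) * ‖ξ‖ ^ 2)) = -(4 * π ^ 2 * δ * ‖ξ‖ ^ 2) * τ := fun τ => by ring
    simp only [this]
    exact (integrableOn_exp_mul_Ioi ha 0).const_mul _
  · exact eof fun τ => by positivity

lemma mu_bd0 {δ ε : ℝ} (i j : Fin d) {ψ : ℝ → ℝ} (hψ : Cut ε ψ) {B : ℝ → Mx d} (hB : Adm δ B) (t s : ℝ) (ξ : Spc d)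
    (h : ε < s - t) : |mu i j ψ B t s ξ| ≤ 4 * π ^ 2 * ‖ξ‖ ^ 2 * exp (-(4 * π ^ 2 * ((δ * (s - t)) * ‖ξ‖ ^ 2))) := by
  have hε := hψ.pos
  have h1 := kk_bd i j (hB.low t s (by linarith)) ξ 0
  simp only [inner_zero_right, mul_zero, Real.cos_zero, mul_one] at h1
  rw [mu, abs_mul, abs_of_nonneg (hψ.nonneg _)]
  exact (mul_le_of_le_one_left (abs_nonneg _) (hψ.le_one _)).trans h1

lemma mu_bd1 {δ ε : ℝ} (i j : Fin d) {ψ : ℝ → ℝ} (hψ : Cut ε ψ) {B : ℝ → Mx d} (hB : Adm δ B) (t s : ℝ) (ξ : Spc d) :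
    ofReal |mu i j ψ B t s ξ| ≤ kx δ (s - t) ξ := by
  have hε := hψ.pos
  rcases le_or_gt (s - t) ε with h | h
  · simp [mu, hψ.zero _ h]
  · rw [kx, indicator_of_mem (by show 0 < s - t; linarith)]
    exact ofReal_le_ofReal (mu_bd0 i j hψ hB t s ξ h)

lemma mu_bd2 {δ ε : ℝ} (hδ : 0 < δ) (i j : Fin d) {ψ : ℝ → ℝ} (hψ : Cut ε ψ) {B : ℝ → Mx d} (hB : Adm δ B) (t s : ℝ) (ξ : Spc d) :
    |mu i j ψ B t s ξ| ≤ 4 * π ^ 2 * ‖ξ‖ ^ 2 * exp (-(4 * π ^ 2 * ((δ * ε) * ‖ξ‖ ^ 2))) := by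
  have hε := hψ.pos
  rcases le_or_gt (s - t) ε with h | h
  · simp only [mu, hψ.zero _ h, zero_mul, abs_zero]; positivity
  · refine (mu_bd0 i j hψ hB t s ξ h).trans ?_
    gcongr

lemma mu_cont {δ ε : ℝ} (i j : Fin d) {ψ : ℝ → ℝ} (hψ : Cut ε ψ) {B : ℝ → Mx d} (hB : Adm δ B) :
    Continuous (fun q : ℝ × ℝ × Spc d => mu i j ψ B q.1 q.2.1 q.2.2) := by
  unfold mu qf
  have := hψ.cont
  have h2 := hB.cont
  simp only [Matrix.sub_apply]
  fun_prop

attribute [local irreducible] kx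

set_option maxHeartbeats 800000 in
open FourierTransform in
lemma L2B {δ ε : ℝ} (hδ : 0 < δ) (i j : Fin d) {ψ : ℝ → ℝ} (hψ : Cut ε ψ) {B : ℝ → Mx d} (hB : Adm δ B) :
    LpB 2 (δ⁻¹ * δ⁻¹) (Ker i j ψ B) := by
  intro F hF
  have hε := hψ.pos
  have hKN := Ker_KN hδ i j hψ hB
  have hFm := hF.meas
  have hFi := hF.integrable
  have hmc := mu_cont i j hψ hB
  set E : Spc d → Pt d → ℂ := fun ξ w => Complex.exp (((-2 * π * inner ℝ w.2 ξ : ℝ) : ℂ) * Complex.I) with hE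
  have hE1 : ∀ ξ w, ‖E ξ w‖ = 1 := fun ξ w => Complex.norm_exp_ofReal_mul_I _
  set Φ : ℝ → Spc d × Pt d → ℂ := fun t q => (mu i j ψ B t q.2.1 q.1 : ℂ) * (E q.1 q.2 * (F q.2 : ℂ)) with hΦ
  have hFm2 : Measurable fun q : Spc d × Pt d => (F q.2 : ℂ) := by fun_prop
  have hEm : Measurable fun q : Spc d × Pt d => E q.1 q.2 := by
    apply Continuous.measurable; rw [hE]; fun_prop
  have hΦi : ∀ t, Integrable (Φ t) (volume.prod volume) := by
    intro t
    refine Integrable.mono' ((gint (d := d) (c := δ * ε) (by positivity)).mul_prod (ν := volume) hFi.abs) ?_ ?_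
    · refine Measurable.aestronglyMeasurable ?_
      refine Measurable.mul ?_ (hEm.mul hFm2)
      apply Continuous.measurable
      have : Continuous fun q : Spc d × Pt d => mu i j ψ B t q.2.1 q.1 := hmc.comp (by fun_prop : Continuous fun q : Spc d × Pt d => (t, q.2.1, q.1))
      fun_prop
    · refine eof fun q => ?_
      simp only [hΦ, norm_mul, hE1, one_mul, Complex.norm_real, Real.norm_eq_abs]
      exact mul_le_mul_of_nonneg_right (mu_bd2 hδ i j hψ hB t q.2.1 q.1) (abs_nonneg _)
  set g : ℝ → Spc d → ℂ := fun t ξ => ∫ w, Φ t (ξ, w) with hg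
  have hgi : ∀ t, Integrable (g t) := fun t => (hΦi t).integral_prod_left
  have hFs : ∀ z : Pt d, TT (Ker i j ψ B) F z = (𝓕 (g z.1) (-z.2)).re := by
    intro z
    rw [Real.fourier_eq']
    have h1 : ∀ ξ, Complex.exp (((-2 * π * inner ℝ ξ (-z.2) : ℝ) : ℂ) * Complex.I) • g z.1 ξ =
        ∫ w, Complex.exp (((-2 * π * inner ℝ ξ (-z.2) : ℝ) : ℂ) * Complex.I) * Φ z.1 (ξ, w) := by
      intro ξ; rw [smul_eq_mul, ← integral_const_mul]
    simp only [h1]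
    have hI : Integrable (fun q : Spc d × Pt d => Complex.exp (((-2 * π * inner ℝ q.1 (-z.2) : ℝ) : ℂ) * Complex.I) * Φ z.1 q) (volume.prod volume) := by
      refine (hΦi z.1).bdd_mul (c := 1) ?_ ?_
      · apply Continuous.aestronglyMeasurable; fun_prop
      · exact eof fun q => (Complex.norm_exp_ofReal_mul_I _).le
    rw [integral_integral_swap hI]
    rw [← RCLike.re_eq_complex_re, ← integral_re (𝕜 := ℂ) (hI.integral_prod_right)]
    rw [TT]
    refine integral_congr_ae ?_
    filter_upwards [hI.prod_left_ae] with w hw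
    rw [← integral_re (𝕜 := ℂ) hw, Ker, kk, mul_assoc, mul_comm _ (F w), ← integral_const_mul, ← integral_const_mul]
    refine integral_congr_ae (eof fun ξ => ?_)
    simp only [RCLike.re_eq_complex_re, hΦ, hE]
    have h3 : Complex.exp (((-2 * π * inner ℝ ξ (-z.2) : ℝ) : ℂ) * Complex.I) * ((mu i j ψ B z.1 w.1 ξ : ℂ) * (Complex.exp (((-2 * π * inner ℝ w.2 ξ : ℝ) : ℂ) * Complex.I) * (F w : ℂ))) =
       ((mu i j ψ B z.1 w.1 ξ * F w : ℝ) : ℂ) * Complex.exp (((2 * π * inner ℝ ξ (z.2 - w.2) : ℝ) : ℂ) * Complex.I) := by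
      have : (((2 * π * inner ℝ ξ (z.2 - w.2) : ℝ) : ℂ) * Complex.I) = (((-2 * π * inner ℝ ξ (-z.2) : ℝ) : ℂ) * Complex.I) + (((-2 * π * inner ℝ w.2 ξ : ℝ) : ℂ) * Complex.I) := by
        rw [inner_sub_right, inner_neg_right, real_inner_comm ξ w.2]; push_cast; ring
      rw [this, Complex.exp_add]; push_cast; ring
    rw [h3, Complex.re_ofReal_mul, Complex.exp_ofReal_mul_I_re, mu]
    ring
  set h : ℝ → Spc d → ℝ≥0∞ := fun s ξ => ‖𝓕 (fun y => (F (s, y) : ℂ)) ξ‖ₑ with hh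
  have hFsec : ∀ s, Integrable (fun y => (F (s, y) : ℂ)) := by
    intro s
    obtain ⟨b, hb⟩ := hF.bdd
    obtain ⟨R, hR, hs⟩ := hF.supp
    have : IntegrableOn (fun y => (F (s, y) : ℂ)) (ball 0 R) := by
      refine Measure.integrableOn_of_bounded (M := b) measure_ball_lt_top.ne ?_ ?_
      · apply Measurable.aestronglyMeasurable; fun_prop
      · exact eof fun y => by simpa using hb (s, y)
    refine (integrableOn_iff_integrable_of_support_subset ?_).1 this
    intro y hy
    by_contra hc
    apply hy
    show ((F (s,y) : ℝ) : ℂ) = 0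
    rw [hs]; · simp
    rw [mem_pc]; rintro ⟨-, h2⟩
    apply hc; simpa using h2
  have hhm : Measurable (Function.uncurry h) := by
    apply Measurable.enorm
    simp only [Real.fourier_eq']
    have : StronglyMeasurable (Function.uncurry fun (q : ℝ × Spc d) (v : Spc d) => Complex.exp (((-2 * π * inner ℝ v q.2 : ℝ) : ℂ) * Complex.I) • (F (q.1, v) : ℂ)) := by
      apply Measurable.stronglyMeasurable
      refine Measurable.mul (f := fun a : (ℝ × Spc d) × Spc d => Complex.exp (((-2 * π * inner ℝ a.2 a.1.2 : ℝ) : ℂ) * Complex.I)) (g := fun a => (F (a.1.1, a.2) : ℂ)) ?_ ?_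
      · apply Continuous.measurable; fun_prop
      · have : Measurable fun a : (ℝ × Spc d) × Spc d => (a.1.1, a.2) := by fun_prop
        exact Complex.measurable_ofReal.comp (hFm.comp this)
    exact this.integral_prod_right.measurable
  clear_value h
  have hgb : ∀ t ξ, ‖g t ξ‖ₑ ^ (2:ℝ) ≤ ofReal δ⁻¹ * ∫⁻ s, kx δ (s - t) ξ * h s ξ ^ (2:ℝ) := by
    intro t ξ
    have hks : Measurable fun s => kx δ (s - t) ξ := kx_meas' δ (by fun_prop) (by fun_prop)
    have hhs : Measurable fun s => h s ξ := hhm.comp (by fun_prop : Measurable fun s : ℝ => (s, ξ))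
    have e1 : ‖g t ξ‖ₑ ≤ ∫⁻ s, kx δ (s - t) ξ * h s ξ := by
      have hi : Integrable (fun w => Φ t (ξ, w)) := by
        have h0 : Integrable (fun w => (F w : ℂ)) := hFi.ofReal
        have : Integrable (fun w : Pt d => ((mu i j ψ B t w.1 ξ : ℂ) * E ξ w) * (F w : ℂ)) := by
          refine h0.bdd_mul (c := 4 * π ^ 2 * ‖ξ‖ ^ 2 * exp (-(4 * π ^ 2 * ((δ * ε) * ‖ξ‖ ^ 2)))) ?_ ?_
          · apply Continuous.aestronglyMeasurable
            have : Continuous fun w : Pt d => mu i j ψ B t w.1 ξ := hmc.comp (by fun_prop : Continuous fun w : Pt d => (t, w.1, ξ))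
            rw [hE]; fun_prop
          · refine eof fun w => ?_
            rw [norm_mul, hE1, mul_one, Complex.norm_real]
            exact mu_bd2 hδ i j hψ hB t w.1 ξ
        refine this.congr (eof fun w => ?_)
        simp only [hΦ]; ring
      have : g t ξ = ∫ s, (mu i j ψ B t s ξ : ℂ) * 𝓕 (fun y => (F (s, y) : ℂ)) ξ := by
        simp only [hg]
        rw [Measure.volume_eq_prod, integral_prod _ hi]
        congr 1; ext s
        rw [Real.fourier_eq', ← integral_const_mul]
        simp only [hΦ, hE, smul_eq_mul]
      rw [this, hh]
      refine (enorm_integral_le_lintegral_enorm _).trans (lintegral_mono fun s => ?_)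
      rw [enorm_mul]
      refine mul_le_mul' ?_ le_rfl
      rw [← ofReal_norm, Complex.norm_real]
      exact mu_bd1 i j hψ hB t s ξ
    have e2 : ∫⁻ s, kx δ (s - t) ξ * h s ξ ≤ (∫⁻ s, kx δ (s - t) ξ) ^ (1/2:ℝ) * (∫⁻ s, kx δ (s - t) ξ * h s ξ ^ (2:ℝ)) ^ (1/2:ℝ) := by
      have := ENNReal.lintegral_mul_le_Lp_mul_Lq volume (Real.HolderConjugate.two_two) (f := fun s => kx δ (s - t) ξ ^ (1/2:ℝ)) (g := fun s => kx δ (s - t) ξ ^ (1/2:ℝ) * h s ξ) (hks.pow_const _).aemeasurable ((hks.pow_const _).mul hhs).aemeasurable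
      convert this using 3 with s
      · simp only [Pi.mul_apply]
        rw [← mul_assoc, ← ENNReal.rpow_add_of_nonneg _ _ (by norm_num) (by norm_num)]
        norm_num
      · congr 1; ext s; rw [← ENNReal.rpow_mul]; norm_num
      · congr 1; ext s
        rw [mul_rpow_of_nonneg _ _ (by norm_num), ← ENNReal.rpow_mul]; norm_num
    have e3 : ∫⁻ s, kx δ (s - t) ξ ≤ ofReal δ⁻¹ := by
      rw [lintegral_sub_right_eq_self (fun s => kx δ s ξ) t]; exact kx_int hδ ξ
    calc ‖g t ξ‖ₑ ^ (2:ℝ) ≤ ((∫⁻ s, kx δ (s - t) ξ) ^ (1/2:ℝ) * (∫⁻ s, kx δ (s - t) ξ * h s ξ ^ (2:ℝ)) ^ (1/2:ℝ)) ^ (2:ℝ) :=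
          ENNReal.rpow_le_rpow (e1.trans e2) (by norm_num)
      _ = (∫⁻ s, kx δ (s - t) ξ) * (∫⁻ s, kx δ (s - t) ξ * h s ξ ^ (2:ℝ)) := by
          rw [mul_rpow_of_nonneg _ _ (by norm_num), ← ENNReal.rpow_mul, ← ENNReal.rpow_mul]; norm_num
      _ ≤ _ := mul_le_mul' e3 le_rfl
  have hm3 : Measurable fun q : ℝ × Spc d × ℝ => kx δ (q.2.2 - q.1) q.2.1 * h q.2.2 q.2.1 ^ (2:ℝ) := by
    refine Measurable.mul (kx_meas' δ (by fun_prop) (by fun_prop)) ?_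
    exact (hhm.comp (by fun_prop : Measurable fun q : ℝ × Spc d × ℝ => (q.2.2, q.2.1))).pow_const _
  have hTm : Measurable fun z => ofReal |TT (Ker i j ψ B) F z| ^ (2:ℝ) := by
    have := (TT_cont hKN hF).measurable
    fun_prop
  have hFm' : Measurable fun z => ofReal |F z| ^ (2:ℝ) := by fun_prop
  unfold LI
  simp only [Measure.restrict_univ]
  calc ∫⁻ z, ofReal |TT (Ker i j ψ B) F z| ^ (2:ℝ)
      = ∫⁻ t, ∫⁻ x, ofReal |TT (Ker i j ψ B) F (t,x)| ^ (2:ℝ) := by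
        rw [Measure.volume_eq_prod, lintegral_prod _ hTm.aemeasurable]
    _ ≤ ∫⁻ t, ∫⁻ x, ‖𝓕 (g t) (-x)‖ₑ ^ (2:ℝ) := by
        refine lintegral_mono fun t => lintegral_mono fun x => ENNReal.rpow_le_rpow ?_ (by norm_num)
        rw [hFs, ← ofReal_norm]
        exact ofReal_le_ofReal (Complex.abs_re_le_norm _)
    _ = ∫⁻ t, ∫⁻ x, ‖𝓕 (g t) x‖ₑ ^ (2:ℝ) := by
        refine lintegral_congr fun t => ?_
        exact lintegral_neg_eq_self (fun x => ‖𝓕 (g t) x‖ₑ ^ (2:ℝ))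
    _ ≤ ∫⁻ t, ∫⁻ ξ, ‖g t ξ‖ₑ ^ (2:ℝ) := lintegral_mono fun t => planch _ (hgi t)
    _ ≤ ∫⁻ t, ∫⁻ ξ, ofReal δ⁻¹ * ∫⁻ s, kx δ (s - t) ξ * h s ξ ^ (2:ℝ) :=
        lintegral_mono fun t => lintegral_mono fun ξ => hgb t ξ
    _ = ofReal δ⁻¹ * ∫⁻ ξ, ∫⁻ s, ∫⁻ t, kx δ (s - t) ξ * h s ξ ^ (2:ℝ) := by
        have e0 : ∀ t, ∫⁻ ξ, ofReal δ⁻¹ * ∫⁻ s, kx δ (s - t) ξ * h s ξ ^ (2:ℝ) = ofReal δ⁻¹ * ∫⁻ ξ, ∫⁻ s, kx δ (s - t) ξ * h s ξ ^ (2:ℝ) := by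
          intro t; rw [lintegral_const_mul' _ _ ofReal_ne_top]
        simp only [e0]
        rw [lintegral_const_mul' _ _ ofReal_ne_top]
        congr 1
        rw [lintegral_lintegral_swap]
        · refine lintegral_congr fun ξ => ?_
          rw [lintegral_lintegral_swap]
          exact (hm3.comp (by fun_prop : Measurable fun q : ℝ × ℝ => (q.1, ξ, q.2))).aemeasurable
        · have : Measurable (Function.uncurry fun (q : ℝ × Spc d) (s : ℝ) => kx δ (s - q.1) q.2 * h s q.2 ^ (2:ℝ)) :=
            hm3.comp (by fun_prop : Measurable fun q : (ℝ × Spc d) × ℝ => (q.1.1, q.1.2, q.2))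
          exact (this.lintegral_prod_right (ν := volume)).aemeasurable
    _ ≤ ofReal δ⁻¹ * ∫⁻ ξ, ∫⁻ s, ofReal δ⁻¹ * h s ξ ^ (2:ℝ) := by
        refine mul_le_mul' le_rfl (lintegral_mono fun ξ => lintegral_mono fun s => ?_)
        have hks : Measurable fun t => kx δ (s - t) ξ := kx_meas' δ (by fun_prop) (by fun_prop)
        rw [lintegral_mul_const _ hks]
        refine mul_le_mul' ?_ le_rfl
        rw [lintegral_sub_left_eq_self (fun t => kx δ t ξ) s]; exact kx_int hδ ξ
    _ = ofReal δ⁻¹ * (ofReal δ⁻¹ * ∫⁻ s, ∫⁻ ξ, h s ξ ^ (2:ℝ)) := by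
        congr 1
        simp only [lintegral_const_mul' _ _ (ofReal_ne_top (r := δ⁻¹))]
        congr 1
        rw [lintegral_lintegral_swap]
        exact ((hhm.pow_const _).comp measurable_swap).aemeasurable
    _ ≤ ofReal δ⁻¹ * (ofReal δ⁻¹ * ∫⁻ s, ∫⁻ y, ofReal |F (s, y)| ^ (2:ℝ)) := by
        refine mul_le_mul' le_rfl (mul_le_mul' le_rfl (lintegral_mono fun s => ?_))
        rw [hh]
        refine (planch _ (hFsec s)).trans (le_of_eq ?_)
        refine lintegral_congr fun y => ?_
        rw [← ofReal_norm, Complex.norm_real, Real.norm_eq_abs]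
    _ = _ := by
        rw [Measure.volume_eq_prod, lintegral_prod _ hFm'.aemeasurable, ofReal_mul (by positivity), mul_assoc]

lemma CinfC.diff {u : Pt d → ℝ} (hu : CinfC u) : Differentiable ℝ u := hu.1.differentiable (by simp)

lemma CinfC.hasDx {u : Pt d → ℝ} (hu : CinfC u) (s : ℝ) (y : Spc d) :
    HasFDerivAt (fun y => u (s, y)) ((fderiv ℝ u (s, y)).comp (ContinuousLinearMap.inr ℝ ℝ (Spc d))) y := by
  have h1 : HasFDerivAt (fun y : Spc d => (s, y)) (ContinuousLinearMap.inr ℝ ℝ (Spc d)) y := hasFDerivAt_prodMk_right s y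
  exact (hu.diff (s, y)).hasFDerivAt.comp y h1

lemma CinfC.hasDt {u : Pt d → ℝ} (hu : CinfC u) (s : ℝ) (y : Spc d) :
    HasDerivAt (fun s => u (s, y)) (fderiv ℝ u (s, y) (1, 0)) s := by
  have h1 : HasDerivAt (fun s : ℝ => (s, y)) ((1 : ℝ), (0 : Spc d)) s := (hasDerivAt_id s).prodMk (hasDerivAt_const s y)
  exact (hu.diff (s, y)).hasFDerivAt.comp_hasDerivAt s h1

lemma CinfC.Dx_eq {u : Pt d → ℝ} (hu : CinfC u) (i : Fin d) :
    Dx i u = fun z => fderiv ℝ u z (0, EuclideanSpace.single i 1) := by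
  ext z
  rw [Dx, (hu.hasDx z.1 z.2).fderiv]
  simp

lemma CinfC.Dt_eq {u : Pt d → ℝ} (hu : CinfC u) :
    Dt u = fun z => fderiv ℝ u z (1, 0) := by
  ext z
  rw [Dt, (hu.hasDt z.1 z.2).deriv]

lemma CinfC.dir {u : Pt d → ℝ} (hu : CinfC u) (v : Pt d) : CinfC (fun z => fderiv ℝ u z v) := by
  constructor
  · exact (hu.1.fderiv_right (m := (⊤ : ℕ∞)) (by simp)).clm_apply contDiff_const
  · exact hu.2.fderiv_apply ℝ v

lemma CinfC.dx {u : Pt d → ℝ} (hu : CinfC u) (i : Fin d) : CinfC (Dx i u) := by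
  rw [hu.Dx_eq]; exact hu.dir _

lemma CinfC.dt {u : Pt d → ℝ} (hu : CinfC u) : CinfC (Dt u) := by
  rw [hu.Dt_eq]; exact hu.dir _

lemma CinfC.dxx {u : Pt d → ℝ} (hu : CinfC u) (i j : Fin d) : CinfC (Dxx i j u) := (hu.dx j).dx i

lemma CinfC.nice {u : Pt d → ℝ} (hu : CinfC u) : Nice u := by
  refine ⟨hu.1.continuous.measurable, ?_, ?_⟩
  · obtain ⟨C, hC⟩ := hu.1.continuous.bounded_above_of_compact_support hu.2
    exact ⟨C, hC⟩
  · obtain ⟨R, hR⟩ := hu.2.isCompact.isBounded.subset_ball (0 : Pt d)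
    refine ⟨max R 1, by positivity, fun z hz => ?_⟩
    by_contra hc
    apply hz
    have h1 := hR (subset_tsupport _ hc)
    rw [mem_ball_zero_iff, Prod.norm_def, max_lt_iff] at h1
    rw [mem_pc]
    simp only [Prod.fst_zero, sub_zero, Prod.snd_zero]
    have h2 : R ≤ max R 1 := le_max_left _ _
    have h3 : 1 ≤ max R 1 := le_max_right _ _
    constructor
    · rw [← Real.norm_eq_abs]; nlinarith
    · linarith

lemma CinfC.lip {u : Pt d → ℝ} (hu : CinfC u) : ∃ L, 0 ≤ L ∧ ∀ s s' : ℝ, ∀ y y' : Spc d,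
    |u (s, y) - u (s', y')| ≤ L * (|s - s'| + ‖y - y'‖) := by
  obtain ⟨C, hC⟩ := (hu.1.continuous_fderiv (by simp)).bounded_above_of_compact_support (hu.2.fderiv ℝ)
  have hC0 : 0 ≤ C := (norm_nonneg _).trans (hC 0)
  refine ⟨C, hC0, fun s s' y y' => ?_⟩
  have := Convex.norm_image_sub_le_of_norm_fderiv_le (𝕜 := ℝ) (s := univ) (f := u) (C := C) (fun x _ => hu.diff x) (fun x _ => hC x) convex_univ (mem_univ (s', y')) (mem_univ (s, y))
  refine this.trans (mul_le_mul_of_nonneg_left ?_ hC0)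
  rw [Prod.norm_def]
  simp only [Prod.fst_sub, Prod.snd_sub, Real.norm_eq_abs]
  exact max_le (le_add_of_nonneg_right (norm_nonneg _)) (le_add_of_nonneg_left (abs_nonneg _))

lemma CinfC.sec {u : Pt d → ℝ} (hu : CinfC u) (s : ℝ) : ContDiff ℝ (⊤ : ℕ∞) (fun y => u (s, y)) ∧ HasCompactSupport (fun y => u (s, y)) := by
  constructor
  · exact hu.1.comp (by fun_prop)
  · obtain ⟨R, hR, h⟩ := hu.nice.supp
    refine HasCompactSupport.intro (isCompact_closedBall (0 : Spc d) R) fun y hy => ?_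
    apply h
    rw [mem_pc]
    rintro ⟨-, h2⟩
    apply hy
    simp at h2 ⊢
    exact h2.le

lemma ibp {u : Pt d → ℝ} (hu : CinfC u) (s : ℝ) (i : Fin d) {g : Spc d → ℝ} (hg : ContDiff ℝ 1 g) :
    ∫ y, Dx i u (s, y) * g y = - ∫ y, u (s, y) * fderiv ℝ g y (EuclideanSpace.single i 1) := by
  have hc := (hu.sec s).1.continuous
  have hcs := (hu.sec s).2
  have hd := ((hu.dx i).sec s)
  have hgd := hg.continuous_fderiv (by simp)
  have h := integral_mul_fderiv_eq_neg_fderiv_mul_of_integrable (μ := (volume : Measure (Spc d))) (f := g) (g := fun y => u (s, y)) (v := EuclideanSpace.single i (1:ℝ)) ?_ ?_ ?_ ?_ ?_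
  · simp only [mul_comm (g _)] at h
    rw [show (fun y => Dx i u (s, y) * g y) = fun y => fderiv ℝ (fun y => u (s, y)) y (EuclideanSpace.single i 1) * g y from rfl]
    rw [h]; simp only [mul_comm]
  · apply Continuous.integrable_of_hasCompactSupport ((hgd.clm_apply continuous_const).mul hc)
    exact hcs.mul_left
  · apply Continuous.integrable_of_hasCompactSupport
    · exact hg.continuous.mul hd.1.continuous
    · exact hd.2.mul_left
  · apply Continuous.integrable_of_hasCompactSupport (hg.continuous.mul hc)
    exact hcs.mul_left
  · intro x _; exact hg.differentiable (by simp) x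
  · intro x _; exact (hu.sec s).1.differentiable (by simp) x

lemma cos_fd (ξ x y : Spc d) (i : Fin d) :
    fderiv ℝ (fun y => cos (2 * π * inner ℝ ξ (x - y))) y (EuclideanSpace.single i 1) = 2 * π * ξ i * Real.sin (2 * π * inner ℝ ξ (x - y)) ∧
    fderiv ℝ (fun y => Real.sin (2 * π * inner ℝ ξ (x - y))) y (EuclideanSpace.single i 1) = -(2 * π * ξ i * cos (2 * π * inner ℝ ξ (x - y))) := by
  have h0 : HasFDerivAt (fun y => 2 * π * inner ℝ ξ (x - y)) ((2 * π) • (-(innerSL ℝ ξ))) y := by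
    have : HasFDerivAt (fun y => inner ℝ ξ (x - y)) (-(innerSL ℝ ξ)) y := by
      have h := (innerSL ℝ ξ).hasFDerivAt (x := x - y)
      have := h.comp y ((hasFDerivAt_id y).const_sub x)
      rw [show -(innerSL ℝ) ξ = (innerSL ℝ) ξ ∘SL (-ContinuousLinearMap.id ℝ (Spc d)) by simp]
      exact this
    exact this.const_mul _
  constructor
  · rw [h0.cos.fderiv]
    simp [EuclideanSpace.inner_single_right]; ring
  · rw [h0.sin.fderiv]
    simp [EuclideanSpace.inner_single_right]; ring

lemma cs_cd (ξ x : Spc d) : ContDiff ℝ 1 (fun y => cos (2 * π * inner ℝ ξ (x - y))) ∧ ContDiff ℝ 1 (fun y => Real.sin (2 * π * inner ℝ ξ (x - y))) := by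
  have : ContDiff ℝ 1 (fun y => 2 * π * inner ℝ ξ (x - y)) := contDiff_const.mul (contDiff_const.inner ℝ (contDiff_const.sub contDiff_id))
  exact ⟨Real.contDiff_cos.comp this, Real.contDiff_sin.comp this⟩

lemma ibp2 {u : Pt d → ℝ} (hu : CinfC u) (s : ℝ) (i j : Fin d) (ξ x : Spc d) :
    ∫ y, Dxx i j u (s, y) * cos (2 * π * inner ℝ ξ (x - y)) =
      (-(4 * π ^ 2 * ξ i * ξ j)) * ∫ y, u (s, y) * cos (2 * π * inner ℝ ξ (x - y)) := by
  rw [Dxx, ibp (hu.dx j) s i (cs_cd ξ x).1]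
  simp only [(cos_fd ξ x _ i).1]
  have : ∀ y, Dx j u (s, y) * (2 * π * ξ i * Real.sin (2 * π * inner ℝ ξ (x - y))) = (2 * π * ξ i) * (Dx j u (s, y) * Real.sin (2 * π * inner ℝ ξ (x - y))) := fun y => by ring
  simp only [this]
  rw [integral_const_mul, ibp hu s j (cs_cd ξ x).2]
  simp only [(cos_fd ξ x _ j).2]
  have : ∀ y, u (s, y) * -(2 * π * ξ j * cos (2 * π * inner ℝ ξ (x - y))) = (-(2 * π * ξ j)) * (u (s, y) * cos (2 * π * inner ℝ ξ (x - y))) := fun y => by ring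
  simp only [this]
  rw [integral_const_mul]; ring

def WW (v : Spc d → ℝ) (ξ x : Spc d) : ℝ := ∫ y, v y * cos (2 * π * inner ℝ ξ (x - y))

lemma WW_cont {v : Spc d → ℝ} (hv : Continuous v) (hc : HasCompactSupport v) :
    Continuous (fun q : Spc d × Spc d => WW v q.1 q.2) := by
  unfold WW
  refine continuous_of_dominated (bound := fun y => |v y|) ?_ ?_ ?_ ?_
  · intro q; apply Continuous.aestronglyMeasurable; fun_prop
  · intro q; refine eof fun y => ?_
    rw [norm_mul]
    exact mul_le_of_le_one_right (norm_nonneg _) (Real.abs_cos_le_one _)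
  · exact (hv.integrable_of_hasCompactSupport hc).abs
  · exact eof fun y => by fun_prop

open FourierTransform in
lemma finv {v : Spc d → ℝ} (hv : ContDiff ℝ (⊤ : ℕ∞) v) (hc : HasCompactSupport v) :
    (∃ w : Spc d → ℝ, Integrable w ∧ ∀ ξ x, |WW v ξ x| ≤ w ξ) ∧ ∀ x, ∫ ξ, WW v ξ x = v x := by
  have hvc : ContDiff ℝ (⊤ : ℕ∞) (fun y => (v y : ℂ)) := Complex.ofRealCLM.contDiff.comp hv
  have hcc : HasCompactSupport (fun y => (v y : ℂ)) := hc.comp_left (g := fun r : ℝ => (r : ℂ)) (by simp)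
  set S : SchwartzMap (Spc d) ℂ := hcc.toSchwartzMap hvc with hS
  have hSv : ∀ y, S y = (v y : ℂ) := fun y => rfl
  have hi : Integrable (⇑(𝓕 S : SchwartzMap (Spc d) ℂ)) := (𝓕 S : SchwartzMap (Spc d) ℂ).integrable
  have hF : ∀ ξ x, WW v ξ x = (Complex.exp (((2 * π * inner ℝ ξ x : ℝ) : ℂ) * Complex.I) * (𝓕 S : SchwartzMap (Spc d) ℂ) ξ).re := by
    intro ξ x
    rw [SchwartzMap.fourier_coe, Real.fourier_eq', ← integral_const_mul, ← RCLike.re_eq_complex_re, ← integral_re (𝕜 := ℂ), WW]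
    · congr 1; ext y
      simp only [RCLike.re_eq_complex_re, hSv, smul_eq_mul]
      rw [← mul_assoc, ← Complex.exp_add, Complex.re_mul_ofReal, mul_comm]
      congr 1
      rw [show (((2 * π * inner ℝ ξ x : ℝ) : ℂ) * Complex.I) + (((-2 * π * inner ℝ y ξ : ℝ) : ℂ) * Complex.I) = ((2 * π * inner ℝ ξ (x - y) : ℝ) : ℂ) * Complex.I by
        rw [inner_sub_right, real_inner_comm ξ y]; push_cast; ring]
      rw [Complex.exp_ofReal_mul_I_re]
    · refine Integrable.const_mul ?_ _
      refine S.integrable.bdd_mul (c := 1) ?_ ?_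
      · apply Continuous.aestronglyMeasurable; fun_prop
      · exact eof fun q => (Complex.norm_exp_ofReal_mul_I _).le
  refine ⟨⟨fun ξ => ‖(𝓕 S : SchwartzMap (Spc d) ℂ) ξ‖, hi.norm, fun ξ x => ?_⟩, fun x => ?_⟩
  · rw [hF]
    refine (Complex.abs_re_le_norm _).trans ?_
    rw [norm_mul, Complex.norm_exp_ofReal_mul_I, one_mul]
  · simp only [hF]
    have h2 := S.integrable.fourierInv_fourier_eq (by simpa [SchwartzMap.fourier_coe] using hi) (S.continuous.continuousAt (x := x))
    rw [Real.fourierInv_eq'] at h2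
    have h3 := congrArg Complex.re h2
    rw [hSv, Complex.ofReal_re, ← RCLike.re_eq_complex_re, ← integral_re (𝕜 := ℂ)] at h3
    · rw [← h3]
      congr 1
    · rw [← SchwartzMap.fourier_coe]
      refine hi.bdd_mul (c := 1) ?_ ?_
      · apply Continuous.aestronglyMeasurable; fun_prop
      · exact eof fun q => (Complex.norm_exp_ofReal_mul_I _).le

lemma gavg {v : Spc d → ℝ} (hv : ContDiff ℝ (⊤ : ℕ∞) v) (hc : HasCompactSupport v)
    {L : Spc d →L[ℝ] Spc d} {E : Spc d → ℝ}
    (hL : ∀ ξ x, ∫ η, cos (2 * π * inner ℝ ξ (x - L η)) ∂(gam d) = cos (2 * π * inner ℝ ξ x) * E ξ) (x : Spc d) :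
    ∫ ξ, E ξ * WW v ξ x = ∫ η, v (x - L η) ∂(gam d) := by
  obtain ⟨⟨w, hw, hWw⟩, hinv⟩ := finv hv hc
  have hvi : Integrable v := hv.continuous.integrable_of_hasCompactSupport hc
  have hvc := hv.continuous
  have h1 : ∀ ξ, E ξ * WW v ξ x = ∫ η, WW v ξ (x - L η) ∂(gam d) := by
    intro ξ
    have : E ξ * WW v ξ x = ∫ y, ∫ η, v y * cos (2 * π * inner ℝ ξ (x - L η - y)) ∂(gam d) := by
      rw [WW, ← integral_const_mul]
      congr 1; ext y
      rw [integral_const_mul]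
      have := hL ξ (x - y)
      simp only [sub_right_comm x _ y]
      rw [this]; ring
    rw [this, integral_integral_swap]
    · rfl
    · refine Integrable.mono' (hvi.abs.mul_prod (integrable_const (1:ℝ)) (ν := gam d)) ?_ ?_
      · apply Continuous.aestronglyMeasurable; fun_prop
      · refine eof fun q => ?_
        simp only [Function.uncurry]
        rw [norm_mul]
        exact mul_le_mul_of_nonneg_left (Real.abs_cos_le_one _) (norm_nonneg _)
  simp only [h1]
  rw [integral_integral_swap]
  · simp only [hinv]
  · refine Integrable.mono' (hw.mul_prod (integrable_const (1:ℝ)) (ν := gam d)) ?_ ?_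
    · apply Continuous.aestronglyMeasurable
      have := (WW_cont hvc hc).comp (by fun_prop : Continuous fun q : Spc d × Spc d => (q.1, x - L q.2))
      exact this
    · refine eof fun q => ?_
      simp only [Function.uncurry, mul_one]
      exact hWw q.1 _

def phi (ε τ : ℝ) : ℝ := max 0 (min 1 ((τ - ε) / ε))
def psi (ε lam τ : ℝ) : ℝ := phi ε τ * exp (-(lam * τ))

lemma phi_cont {ε : ℝ} : Continuous (phi ε) := by unfold phi; fun_prop
lemma phi_zero {ε τ : ℝ} (hε : 0 < ε) (h : τ ≤ ε) : phi ε τ = 0 := by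
  have : (τ - ε) / ε ≤ 0 := div_nonpos_of_nonpos_of_nonneg (by linarith) hε.le
  rw [phi, max_eq_left]; exact (min_le_right _ _).trans this
lemma phi_one {ε τ : ℝ} (hε : 0 < ε) (h : 2 * ε ≤ τ) : phi ε τ = 1 := by
  have : 1 ≤ (τ - ε) / ε := by rw [le_div_iff₀ hε]; linarith
  rw [phi, min_eq_left this]; simp
lemma phi_mid {ε τ : ℝ} (hε : 0 < ε) (h : ε ≤ τ) (h2 : τ ≤ 2 * ε) : phi ε τ = (τ - ε) / ε := by
  have : (τ - ε) / ε ≤ 1 := by rw [div_le_iff₀ hε]; linarith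
  rw [phi, min_eq_right this, max_eq_right]; exact div_nonneg (by linarith) hε.le
lemma phi_nonneg (ε τ : ℝ) : 0 ≤ phi ε τ := le_max_left _ _
lemma phi_le (ε τ : ℝ) : phi ε τ ≤ 1 := max_le zero_le_one (min_le_left _ _)
lemma phi_lip {ε τ τ' : ℝ} (hε : 0 < ε) (h : 0 < τ) (h' : τ ≤ τ') : |phi ε τ - phi ε τ'| ≤ 2 * (τ' - τ) / τ := by
  rcases le_or_gt (2 * ε) τ with h1 | h1
  · rw [phi_one hε h1, phi_one hε (h1.trans h')]; simp; exact div_nonneg (by linarith) h.le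
  · have e1 : |phi ε τ - phi ε τ'| ≤ |(τ - ε) / ε - (τ' - ε) / ε| := by
      unfold phi
      refine (abs_max_sub_max_le_max _ _ _ _).trans ?_
      rw [sub_self, abs_zero]
      refine max_le (abs_nonneg _) ((abs_min_sub_min_le_max _ _ _ _).trans ?_)
      rw [sub_self, abs_zero]
      exact max_le (abs_nonneg _) le_rfl
    refine e1.trans ?_
    rw [← sub_div, show τ - ε - (τ' - ε) = -(τ' - τ) by ring, abs_div, abs_neg, abs_of_nonneg (by linarith : 0 ≤ τ' - τ), abs_of_pos hε, div_le_div_iff₀ hε h]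
    nlinarith

lemma psi_cut {ε lam : ℝ} (hε : 0 < ε) (hl : 0 ≤ lam) : Cut ε (psi ε lam) := by
  refine ⟨hε, ?_, ?_, ?_, ?_, ?_⟩
  · have := phi_cont (ε := ε); unfold psi; fun_prop
  · intro τ; exact mul_nonneg (phi_nonneg _ _) (Real.exp_pos _).le
  · intro τ
    rcases le_or_gt τ ε with h | h
    · rw [psi, phi_zero hε h]; simp
    · refine mul_le_one₀ (phi_le _ _) (Real.exp_pos _).le (Real.exp_le_one_iff.2 ?_)
      have : 0 ≤ lam * τ := mul_nonneg hl (by linarith)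
      linarith
  · intro τ h; rw [psi, phi_zero hε h, zero_mul]
  · intro τ τ' h h'
    have e1 := phi_lip hε h h'
    have e2 : |exp (-(lam * τ)) - exp (-(lam * τ'))| ≤ (τ' - τ) / τ := by
      have h3 : exp (-(lam * τ')) = exp (-(lam * τ)) * exp (-(lam * (τ' - τ))) := by rw [← Real.exp_add]; ring_nf
      have h4 := Real.add_one_le_exp (-(lam * (τ' - τ)))
      have h5 : lam * τ * exp (-(lam * τ)) ≤ 1 := by
        have := Real.add_one_le_exp (lam * τ)
        rw [Real.exp_neg, ← div_eq_mul_inv, div_le_one (Real.exp_pos _)]; linarith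
      have h6 : exp (-(lam * (τ' - τ))) ≤ 1 := Real.exp_le_one_iff.2 (by have := mul_nonneg hl (sub_nonneg.2 h'); linarith)
      rw [h3, abs_of_nonneg (by nlinarith [Real.exp_pos (-(lam * τ))]), le_div_iff₀ h]
      calc (exp (-(lam * τ)) - exp (-(lam * τ)) * exp (-(lam * (τ' - τ)))) * τ
          = (exp (-(lam * τ)) * τ) * (1 - exp (-(lam * (τ' - τ)))) := by ring
        _ ≤ (exp (-(lam * τ)) * τ) * (lam * (τ' - τ)) := mul_le_mul_of_nonneg_left (by linarith) (by positivity)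
        _ = (lam * τ * exp (-(lam * τ))) * (τ' - τ) := by ring
        _ ≤ 1 * (τ' - τ) := mul_le_mul_of_nonneg_right h5 (by linarith)
        _ = _ := one_mul _
    have h6 : |exp (-(lam * τ))| ≤ 1 := by
      rw [abs_of_pos (Real.exp_pos _), Real.exp_le_one_iff]; have := mul_nonneg hl h.le; linarith
    calc |psi ε lam τ - psi ε lam τ'| = |(phi ε τ - phi ε τ') * exp (-(lam * τ)) + phi ε τ' * (exp (-(lam * τ)) - exp (-(lam * τ')))| := by
          unfold psi; ring_nf
      _ ≤ |phi ε τ - phi ε τ'| * |exp (-(lam * τ))| + |phi ε τ'| * |exp (-(lam * τ)) - exp (-(lam * τ'))| := by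
          rw [← abs_mul, ← abs_mul]; exact abs_add_le _ _
      _ ≤ (2 * (τ' - τ) / τ) * 1 + 1 * ((τ' - τ) / τ) := by
          refine add_le_add (mul_le_mul e1 h6 (abs_nonneg _) ((abs_nonneg _).trans e1)) (mul_le_mul ?_ e2 (abs_nonneg _) zero_le_one)
          rw [abs_of_nonneg (phi_nonneg _ _)]; exact phi_le _ _
      _ = _ := by ring

lemma cutFTC {G G' : ℝ → ℝ} {t ε T : ℝ} (hε : 0 < ε) (hT : t + 2 * ε ≤ T) {K : ℝ≥0} (hL : LipschitzOnWith K G (Icc t T))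
    (hG : ∀ᵐ s, s ∈ Ioc t T → HasDerivAt G (G' s) s) (hGT : G T = 0) :
    ∫ s in t..T, phi ε (s - t) * G' s = -(1 / ε) * ∫ s in (t + ε)..(t + 2 * ε), G s := by
  have hAC : AbsolutelyContinuousOnInterval G t T := LipschitzOnWith.absolutelyContinuousOnInterval (K := K) (by rwa [uIcc_of_le (by linarith)])
  have h0 : ∫ s in t..T, phi ε (s - t) * G' s = ∫ s in t..T, phi ε (s - t) * deriv G s := by
    refine intervalIntegral.integral_congr_ae ?_
    filter_upwards [hG] with s hs hm
    rw [uIoc_of_le (by linarith)] at hm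
    rw [(hs hm).deriv]
  have hph : Continuous fun s => phi ε (s - t) := phi_cont.comp (by fun_prop)
  have hsub : ∀ a b, t ≤ a → a ≤ b → b ≤ T → AbsolutelyContinuousOnInterval G a b := fun a b h1 h2 h3 =>
    hAC.mono (by rw [uIcc_of_le h2, uIcc_of_le (by linarith)]; exact Icc_subset_Icc h1 h3)
  have hII : ∀ a b, t ≤ a → a ≤ b → b ≤ T → IntervalIntegrable (fun s => phi ε (s - t) * deriv G s) volume a b := fun a b h1 h2 h3 =>
    (hsub a b h1 h2 h3).intervalIntegrable_deriv.continuousOn_mul hph.continuousOn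
  rw [h0, ← intervalIntegral.integral_add_adjacent_intervals (hII t (t + ε) le_rfl (by linarith) (by linarith)) (hII (t + ε) T (by linarith) (by linarith) le_rfl),
    ← intervalIntegral.integral_add_adjacent_intervals (hII (t + ε) (t + 2 * ε) (by linarith) (by linarith) (by linarith)) (hII (t + 2 * ε) T (by linarith) (by linarith) le_rfl)]
  have e1 : ∫ s in t..(t + ε), phi ε (s - t) * deriv G s = 0 := by
    rw [intervalIntegral.integral_congr (g := fun _ => 0)]
    · simp
    · intro s hs
      rw [uIcc_of_le (by linarith)] at hs
      simp only
      rw [phi_zero hε (by linarith [hs.2]), zero_mul]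
  have e3 : ∫ s in (t + 2 * ε)..T, phi ε (s - t) * deriv G s = - G (t + 2 * ε) := by
    rw [intervalIntegral.integral_congr (g := deriv G), (hsub _ _ (by linarith) hT le_rfl).integral_deriv_eq_sub, hGT, zero_sub]
    intro s hs
    rw [uIcc_of_le (by linarith)] at hs
    simp only
    rw [phi_one hε (by linarith [hs.1]), one_mul]
  have e2 : ∫ s in (t + ε)..(t + 2 * ε), phi ε (s - t) * deriv G s = G (t + 2 * ε) - (1 / ε) * ∫ s in (t + ε)..(t + 2 * ε), G s := by
    set f : ℝ → ℝ := fun s => (s - t - ε) / ε with hf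
    have hfd : ∀ s, HasDerivAt f (1 / ε) s := fun s => (((hasDerivAt_id s).sub_const t).sub_const ε).div_const ε
    have hfAC : AbsolutelyContinuousOnInterval f (t + ε) (t + 2 * ε) := by
      apply ContDiffOn.absolutelyContinuousOnInterval
      apply ContDiff.contDiffOn
      rw [hf]; fun_prop
    have := hfAC.integral_deriv_mul_eq_sub (hsub (t + ε) (t + 2 * ε) (by linarith) (by linarith) (by linarith))
    simp only [(hfd _).deriv] at this
    have hfa : f (t + ε) = 0 := by simp [hf]
    have hfb : f (t + 2 * ε) = 1 := by rw [hf]; field_simp; ring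
    have hGc := (hsub (t + ε) (t + 2 * ε) (by linarith) (by linarith) (by linarith)).continuousOn
    rw [hfa, hfb, intervalIntegral.integral_add, intervalIntegral.integral_const_mul] at this
    · rw [intervalIntegral.integral_congr (g := fun s => f s * deriv G s)]
      · linarith
      · intro s hs
        rw [uIcc_of_le (by linarith)] at hs
        simp only
        rw [phi_mid hε (by linarith [hs.1]) (by linarith [hs.2])]
    · exact (hGc.const_smul (1 / ε)).intervalIntegrable
    · exact (hsub _ _ (by linarith) (by linarith) (by linarith)).intervalIntegrable_deriv.continuousOn_mul hfAC.continuousOn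
  rw [e1, e2, e3]; ring

structure Coef (δ : ℝ) (b : ℝ → Mx d) : Prop where
  meas : ∀ i j, Measurable fun t => b t i j
  inS : ∀ t, inS d δ (b t)

lemma inS_qf {δ : ℝ} {a : Mx d} (h : inS d δ a) (ξ : Spc d) : δ * ‖ξ‖ ^ 2 ≤ qf a ξ ∧ qf a ξ ≤ δ⁻¹ * ‖ξ‖ ^ 2 := by
  have := h.2 ξ
  rw [EuclideanSpace.norm_sq_eq]
  simpa [qf] using this

lemma inS_entry {δ : ℝ} (hδ : 0 < δ) {a : Mx d} (h : inS d δ a) (i j : Fin d) : |a i j| ≤ δ⁻¹ := by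
  have key : ∀ x y : ℝ, ∀ k l : Fin d, qf a (EuclideanSpace.single k x + EuclideanSpace.single l y) = a k k * x ^ 2 + a l l * y ^ 2 + (a k l + a l k) * (x * y) := by
    intro x y k l
    simp [qf, add_mul, mul_add, Finset.sum_add_distrib, Pi.single_apply, Finset.sum_ite_eq]
    ring
  have hs : a j i = a i j := h.1.apply i j
  have hd : ∀ k, a k k ≤ δ⁻¹ := by
    intro k
    have h1 := (inS_qf h (EuclideanSpace.single k 1 + EuclideanSpace.single k 0)).2
    rw [key] at h1
    have h0 : EuclideanSpace.single k (1:ℝ) + EuclideanSpace.single k 0 = EuclideanSpace.single k 1 := by simp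
    rw [h0] at h1
    simpa using h1
  have h1 := (inS_qf h (EuclideanSpace.single i 1 + EuclideanSpace.single j 1)).1
  have h2 := (inS_qf h (EuclideanSpace.single i 1 + EuclideanSpace.single j (-1))).1
  rw [key] at h1 h2
  have h3 := (mul_nonneg hδ.le (sq_nonneg ‖EuclideanSpace.single i (1:ℝ) + EuclideanSpace.single j 1‖)).trans h1
  have h4 := (mul_nonneg hδ.le (sq_nonneg ‖EuclideanSpace.single i (1:ℝ) + EuclideanSpace.single j (-1)‖)).trans h2
  rw [hs] at h3 h4
  have := hd i; have := hd j
  rw [abs_le]; constructor <;> linarith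

def Bi (b : ℝ → Mx d) (s : ℝ) : Mx d := Matrix.of fun i j => ∫ r in (0:ℝ)..s, b r i j

lemma Coef.ii {δ : ℝ} (hδ : 0 < δ) {b : ℝ → Mx d} (hb : Coef δ b) (i j : Fin d) :
    LocallyIntegrable (fun t => b t i j) := by
  refine (locallyIntegrable_const δ⁻¹).mono (hb.meas i j).aestronglyMeasurable (eof fun t => ?_)
  rw [Real.norm_eq_abs, Real.norm_of_nonneg (by positivity)]; exact inS_entry hδ (hb.inS t) i j

lemma Coef.ivi {δ : ℝ} (hδ : 0 < δ) {b : ℝ → Mx d} (hb : Coef δ b) (i j : Fin d) (a c : ℝ) :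
    IntervalIntegrable (fun t => b t i j) volume a c := by
  rw [intervalIntegrable_iff]
  exact ((hb.ii hδ i j).integrableOn_isCompact isCompact_uIcc).mono_set uIoc_subset_uIcc

lemma Bi_sub {δ : ℝ} (hδ : 0 < δ) {b : ℝ → Mx d} (hb : Coef δ b) (t s : ℝ) (i j : Fin d) :
    (Bi b s - Bi b t) i j = ∫ r in t..s, b r i j := by
  have h := fun a c => hb.ivi hδ i j a c
  simp only [Bi, Matrix.sub_apply, Matrix.of_apply]
  rw [intervalIntegral.integral_interval_sub_left (h _ _) (h _ _)]

lemma Bi_qf {δ : ℝ} (hδ : 0 < δ) {b : ℝ → Mx d} (hb : Coef δ b) (t s : ℝ) (ξ : Spc d) :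
    qf (Bi b s - Bi b t) ξ = ∫ r in t..s, qf (b r) ξ := by
  have h := fun i j a c => hb.ivi hδ i j a c
  simp only [qf, Bi_sub hδ hb]
  have h2 : ∀ i j, IntervalIntegrable (fun r => b r i j * ξ i * ξ j) volume t s := fun i j => ((h i j t s).mul_const _).mul_const _
  rw [intervalIntegral.integral_finsetSum]
  · refine Finset.sum_congr rfl fun i _ => ?_
    rw [intervalIntegral.integral_finsetSum (fun j _ => h2 i j)]
    refine Finset.sum_congr rfl fun j _ => ?_
    rw [intervalIntegral.integral_mul_const, intervalIntegral.integral_mul_const]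
  · intro i _
    have := IntervalIntegrable.sum (μ := volume) (a := t) (b := s) Finset.univ (f := fun j r => b r i j * ξ i * ξ j) (fun j _ => h2 i j)
    have e : (fun r => ∑ j, b r i j * ξ i * ξ j) = ∑ j, fun r => b r i j * ξ i * ξ j := by ext r; simp
    rw [e]; exact this

lemma Bi_adm {δ : ℝ} (hδ : 0 < δ) {b : ℝ → Mx d} (hb : Coef δ b) : Adm δ (Bi b) := by
  have h := fun i j a c => hb.ivi hδ i j a c
  have hq : ∀ ξ t s, IntervalIntegrable (fun r => qf (b r) ξ) volume t s := by
    intro ξ t s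
    have h2 : LocallyIntegrable (fun r => qf (b r) ξ) := by
      refine (locallyIntegrable_const (δ⁻¹ * ‖ξ‖ ^ 2)).mono ?_ (eof fun r => ?_)
      · apply Measurable.aestronglyMeasurable
        unfold qf
        have := hb.meas
        fun_prop
      · have := inS_qf (hb.inS r) ξ
        have h3 : 0 ≤ δ * ‖ξ‖ ^ 2 := by positivity
        rw [Real.norm_of_nonneg (by linarith), Real.norm_of_nonneg (by positivity)]
        exact this.2
    rw [intervalIntegrable_iff]
    exact (h2.integrableOn_isCompact isCompact_uIcc).mono_set uIoc_subset_uIcc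
  refine ⟨fun i j => ?_, fun s t => ?_, fun t s hts ξ => ?_, fun t s hts ξ => ?_⟩
  · exact intervalIntegral.continuous_primitive (h i j) 0
  · ext i j
    rw [Matrix.transpose_apply, Bi_sub hδ hb, Bi_sub hδ hb]
    congr 1; ext r; exact (hb.inS r).1.apply i j
  · rw [Bi_qf hδ hb]
    have := intervalIntegral.integral_mono_on hts (intervalIntegrable_const (c := δ * ‖ξ‖ ^ 2)) (hq ξ t s) (fun r _ => (inS_qf (hb.inS r) ξ).1)
    rw [intervalIntegral.integral_const, smul_eq_mul] at this
    linarith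
  · rw [Bi_qf hδ hb]
    have := intervalIntegral.integral_mono_on hts (hq ξ t s) (intervalIntegrable_const (c := δ⁻¹ * ‖ξ‖ ^ 2)) (fun r _ => (inS_qf (hb.inS r) ξ).2)
    rw [intervalIntegral.integral_const, smul_eq_mul] at this
    linarith

lemma Bi_deriv {δ : ℝ} (hδ : 0 < δ) {b : ℝ → Mx d} (hb : Coef δ b) (t : ℝ) :
    ∀ᵐ s, ∀ ξ, HasDerivAt (fun s => qf (Bi b s - Bi b t) ξ) (qf (b s) ξ) s := by
  have h : ∀ i j, ∀ᵐ s, HasDerivAt (fun s => (Bi b s - Bi b t) i j) (b s i j) s := by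
    intro i j
    filter_upwards [LocallyIntegrable.ae_hasDerivAt_integral (hb.ii hδ i j)] with s hs
    exact (hs 0).sub_const _
  have h' : ∀ᵐ s, ∀ i j, HasDerivAt (fun s => (Bi b s - Bi b t) i j) (b s i j) s := by
    rw [ae_all_iff]; intro i; rw [ae_all_iff]; exact h i
  filter_upwards [h'] with s hs ξ
  unfold qf
  exact HasDerivAt.fun_sum fun i _ => HasDerivAt.fun_sum fun j _ => ((hs i j).mul_const _).mul_const _

lemma Nice.sec {F : Pt d → ℝ} (hF : Nice F) : ∃ w : Spc d → ℝ, Integrable w ∧ (∀ y, 0 ≤ w y) ∧ ∀ s y, |F (s, y)| ≤ w y := by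
  obtain ⟨b, hb⟩ := hF.bdd
  obtain ⟨R, hR, hs⟩ := hF.supp
  have hb0 : 0 ≤ b := (abs_nonneg _).trans (hb 0)
  refine ⟨(ball (0 : Spc d) R).indicator fun _ => b, ?_, fun y => indicator_nonneg (fun _ _ => hb0) _, fun s y => ?_⟩
  · rw [integrable_indicator_iff measurableSet_ball]
    exact integrableOn_const measure_ball_lt_top.ne
  · by_cases hy : y ∈ ball (0 : Spc d) R
    · rw [indicator_of_mem hy]; exact hb _
    · rw [indicator_of_notMem hy, hs, abs_zero]
      rw [mem_pc]; rintro ⟨-, h2⟩; apply hy; simpa using h2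

lemma WW_bd {F : Pt d → ℝ} (hF : Nice F) : ∃ C, 0 ≤ C ∧ ∀ s ξ x, |WW (fun y => F (s, y)) ξ x| ≤ C := by
  obtain ⟨w, hw, hw0, hb⟩ := hF.sec
  refine ⟨∫ y, w y, integral_nonneg hw0, fun s ξ x => ?_⟩
  rw [← Real.norm_eq_abs, WW]
  refine norm_integral_le_of_norm_le hw (eof fun y => ?_)
  rw [norm_mul]
  exact (mul_le_of_le_one_right (norm_nonneg _) (Real.abs_cos_le_one _)).trans (hb s y)

lemma WW_int {F : Pt d → ℝ} (hF : Nice F) (s : ℝ) (ξ x : Spc d) : Integrable (fun y => F (s, y) * cos (2 * π * inner ℝ ξ (x - y))) := by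
  obtain ⟨w, hw, hw0, hb⟩ := hF.sec
  have hm := hF.meas
  refine hw.mono' (Measurable.aestronglyMeasurable ?_) (eof fun y => ?_)
  · refine Measurable.mul (by fun_prop) ?_
    apply Continuous.measurable; fun_prop
  · rw [norm_mul]
    exact (mul_le_of_le_one_right (norm_nonneg _) (Real.abs_cos_le_one _)).trans (hb s y)

lemma WW_meas {F : Pt d → ℝ} (hF : Nice F) (x : Spc d) : Measurable fun q : Spc d × ℝ => WW (fun y => F (q.2, y)) q.1 x := by
  have hm := hF.meas
  have : StronglyMeasurable (Function.uncurry fun (q : Spc d × ℝ) (y : Spc d) => F (q.2, y) * cos (2 * π * inner ℝ q.1 (x - y))) := by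
    apply Measurable.stronglyMeasurable
    refine Measurable.mul (f := fun a : (Spc d × ℝ) × Spc d => F (a.1.2, a.2)) (g := fun a => cos (2 * π * inner ℝ a.1.1 (x - a.2))) ?_ ?_
    · have : Measurable fun a : (Spc d × ℝ) × Spc d => (a.1.2, a.2) := by fun_prop
      exact hm.comp this
    · apply Continuous.measurable; fun_prop
  exact this.integral_prod_right.measurable

lemma WW_deriv {u : Pt d → ℝ} (hu : CinfC u) (s : ℝ) (ξ x : Spc d) :
    HasDerivAt (fun s => WW (fun y => u (s, y)) ξ x) (WW (fun y => Dt u (s, y)) ξ x) s := by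
  obtain ⟨w, hw, hw0, hb⟩ := hu.dt.nice.sec
  refine (hasDerivAt_integral_of_dominated_loc_of_deriv_le (F := fun s y => u (s, y) * cos (2 * π * inner ℝ ξ (x - y)))
    (F' := fun s y => Dt u (s, y) * cos (2 * π * inner ℝ ξ (x - y))) (s := univ) (bound := w) Filter.univ_mem ?_ (WW_int hu.nice s ξ x) ?_ ?_ hw ?_).2
  · exact eof fun s => (WW_int hu.nice s ξ x).aestronglyMeasurable
  · exact (WW_int hu.dt.nice s ξ x).aestronglyMeasurable
  · refine eof fun y s _ => ?_
    rw [norm_mul]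
    exact (mul_le_of_le_one_right (norm_nonneg _) (Real.abs_cos_le_one _)).trans (hb s y)
  · refine eof fun y s _ => ?_
    have := hu.hasDt s y
    rw [hu.Dt_eq]
    exact this.mul_const _

lemma TT_freq {δ ε : ℝ} (hδ : 0 < δ) (i j : Fin d) {ψ : ℝ → ℝ} (hψ : Cut ε ψ) {B : ℝ → Mx d} (hB : Adm δ B)
    {F : Pt d → ℝ} (hF : Nice F) (t : ℝ) (x : Spc d) :
    TT (Ker i j ψ B) F (t, x) = ∫ ξ, ∫ s, mu i j ψ B t s ξ * WW (fun y => F (s, y)) ξ x := by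
  have hε := hψ.pos
  have hFm := hF.meas
  have hmc := mu_cont i j hψ hB
  have hI : Integrable (fun q : Spc d × Pt d => mu i j ψ B t q.2.1 q.1 * (F q.2 * cos (2 * π * inner ℝ q.1 (x - q.2.2)))) (volume.prod volume) := by
    refine Integrable.mono' ((gint (d := d) (c := δ * ε) (by positivity)).mul_prod (ν := volume) hF.integrable.abs) ?_ ?_
    · refine Measurable.aestronglyMeasurable ?_
      refine Measurable.mul ?_ (Measurable.mul (by fun_prop) ?_)
      · exact (hmc.comp (by fun_prop : Continuous fun q : Spc d × Pt d => (t, q.2.1, q.1))).measurable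
      · apply Continuous.measurable; fun_prop
    · refine eof fun q => ?_
      rw [norm_mul, norm_mul]
      refine mul_le_mul (mu_bd2 hδ i j hψ hB t q.2.1 q.1) ?_ (by positivity) (by positivity)
      exact mul_le_of_le_one_right (norm_nonneg _) (Real.abs_cos_le_one _)
  have e1 : TT (Ker i j ψ B) F (t, x) = ∫ w, ∫ ξ, mu i j ψ B t w.1 ξ * (F w * cos (2 * π * inner ℝ ξ (x - w.2))) := by
    rw [TT]
    refine integral_congr_ae (eof fun w => ?_)
    simp only [Ker, kk]
    rw [mul_assoc, ← integral_mul_const, ← integral_const_mul]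
    refine integral_congr_ae (eof fun ξ => ?_)
    simp only [mu]; ring
  rw [e1, ← integral_integral_swap hI]
  refine integral_congr_ae ?_
  filter_upwards [hI.prod_right_ae] with ξ hξ
  rw [Measure.volume_eq_prod, integral_prod _ hξ]
  refine integral_congr_ae (eof fun s => ?_)
  simp only
  rw [integral_const_mul, WW]

def fb (u : Pt d → ℝ) (b : ℝ → Mx d) (lam : ℝ) (z : Pt d) : ℝ :=
  Dt u z + (∑ k, ∑ l, b z.1 k l * Dxx k l u z) - lam * u z

lemma Nice.add {F G : Pt d → ℝ} (hF : Nice F) (hG : Nice G) : Nice (fun z => F z + G z) := by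
  obtain ⟨b, hb⟩ := hF.bdd
  obtain ⟨b', hb'⟩ := hG.bdd
  obtain ⟨R, hR, hs⟩ := hF.supp
  obtain ⟨R', hR', hs'⟩ := hG.supp
  refine ⟨hF.meas.add hG.meas, ⟨b + b', fun z => (abs_add_le _ _).trans (add_le_add (hb z) (hb' z))⟩, max R R', by positivity, fun z hz => ?_⟩
  rw [hs z (fun h => hz (pc_mono hR (le_max_left _ _) h)), hs' z (fun h => hz (pc_mono hR' (le_max_right _ _) h)), add_zero]

lemma Nice.bmul {F g : Pt d → ℝ} (hF : Nice F) (hg : Measurable g) (hgb : ∃ C, ∀ z, |g z| ≤ C) : Nice (fun z => g z * F z) := by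
  obtain ⟨b, hb⟩ := hF.bdd
  obtain ⟨C, hC⟩ := hgb
  obtain ⟨R, hR, hs⟩ := hF.supp
  refine ⟨hg.mul hF.meas, ⟨C * b, fun z => ?_⟩, R, hR, fun z hz => by rw [hs z hz, mul_zero]⟩
  rw [abs_mul]; exact mul_le_mul (hC z) (hb z) (abs_nonneg _) ((abs_nonneg _).trans (hC z))

lemma Nice.zero : Nice (fun _ : Pt d => (0:ℝ)) := ⟨measurable_const, ⟨0, by simp⟩, 1, one_pos, fun _ _ => rfl⟩

lemma Nice.sum {ι : Type*} (S : Finset ι) {F : ι → Pt d → ℝ} (hF : ∀ k, Nice (F k)) : Nice (fun z => ∑ k ∈ S, F k z) := by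
  classical
  induction S using Finset.induction_on with
  | empty => simpa using Nice.zero
  | insert a S ha ih =>
    simp only [Finset.sum_insert ha]
    exact (hF a).add ih

lemma Lu_nice {u : Pt d → ℝ} (hu : CinfC u) {a : Pt d → Fin d → Fin d → ℝ} (ha : ∀ k l, Measurable fun z => a z k l)
    {M : ℝ} (hb : ∀ z k l, |a z k l| ≤ M) (lam : ℝ) : Nice (fun z => Dt u z + (∑ k, ∑ l, a z k l * Dxx k l u z) - lam * u z) := by
  have h1 := (hu.dt.nice.add (Nice.sum Finset.univ fun k => Nice.sum Finset.univ fun l => (hu.dxx k l).nice.bmul (ha k l) ⟨M, fun z => hb z k l⟩)).add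
    (hu.nice.bmul (g := fun _ => -lam) measurable_const ⟨_, fun _ => le_rfl⟩)
  convert h1 using 2
  ring

lemma fb_nice {δ : ℝ} (hδ : 0 < δ) {u : Pt d → ℝ} (hu : CinfC u) {b : ℝ → Mx d} (hb : Coef δ b) (lam : ℝ) : Nice (fb u b lam) :=
  Lu_nice hu (a := fun z k l => b z.1 k l) (fun k l => (hb.meas k l).comp measurable_fst) (fun z k l => inS_entry hδ (hb.inS z.1) k l) lam

lemma WW_fb {δ : ℝ} (hδ : 0 < δ) {u : Pt d → ℝ} (hu : CinfC u) {b : ℝ → Mx d} (hb : Coef δ b) (lam : ℝ) (s : ℝ) (ξ x : Spc d) :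
    WW (fun y => fb u b lam (s, y)) ξ x = WW (fun y => Dt u (s, y)) ξ x - (lam + 4 * π ^ 2 * qf (b s) ξ) * WW (fun y => u (s, y)) ξ x := by
  have h1 := WW_int hu.dt.nice s ξ x
  have h2 := fun k l => (WW_int (hu.dxx k l).nice s ξ x).const_mul (b s k l)
  have h2' : ∀ k, Integrable (fun y => ∑ l, b s k l * (Dxx k l u (s, y) * cos (2 * π * inner ℝ ξ (x - y)))) := fun k => integrable_finsetSum _ fun l _ => h2 k l
  have h3 := (WW_int hu.nice s ξ x).const_mul lam
  have e : WW (fun y => fb u b lam (s, y)) ξ x = ∫ y, (Dt u (s, y) * cos (2 * π * inner ℝ ξ (x - y)) +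
      ∑ k, ∑ l, b s k l * (Dxx k l u (s, y) * cos (2 * π * inner ℝ ξ (x - y)))) - lam * (u (s, y) * cos (2 * π * inner ℝ ξ (x - y))) := by
    unfold WW fb
    congr 1; ext y
    rw [sub_mul, add_mul, Finset.sum_mul]
    simp only [Finset.sum_mul, mul_assoc]
  have hA : Integrable (fun y => Dt u (s, y) * cos (2 * π * inner ℝ ξ (x - y)) +
      ∑ k, ∑ l, b s k l * (Dxx k l u (s, y) * cos (2 * π * inner ℝ ξ (x - y)))) := h1.add (integrable_finsetSum _ fun k _ => h2' k)
  rw [e, integral_sub hA h3, integral_add h1 (integrable_finsetSum _ fun k _ => h2' k),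
    integral_finsetSum _ (fun k _ => h2' k), integral_const_mul]
  simp only [integral_finsetSum _ (fun l _ => h2 _ l), integral_const_mul, ibp2 hu]
  change WW (fun y => Dt u (s, y)) ξ x + ∑ k, ∑ l, b s k l * (-(4 * π ^ 2 * ξ k * ξ l) * WW (fun y => u (s, y)) ξ x) - lam * WW (fun y => u (s, y)) ξ x = _
  have e2 : ∑ k, ∑ l, b s k l * (-(4 * π ^ 2 * ξ k * ξ l) * WW (fun y => u (s, y)) ξ x) = -(4 * π ^ 2 * qf (b s) ξ) * WW (fun y => u (s, y)) ξ x := by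
    rw [qf, Finset.mul_sum, ← Finset.sum_neg_distrib, Finset.sum_mul]
    refine Finset.sum_congr rfl fun k _ => ?_
    rw [Finset.mul_sum, ← Finset.sum_neg_distrib, Finset.sum_mul]
    refine Finset.sum_congr rfl fun l _ => ?_
    ring
  rw [e2]; ring

lemma exp_lip {a b : ℝ} (ha : 0 ≤ a) (hab : a ≤ b) : |exp (-b) - exp (-a)| ≤ b - a := by
  have h1 : exp (-b) ≤ exp (-a) := Real.exp_le_exp.2 (by linarith)
  have h2 : exp (-b) = exp (-a) * exp (-(b - a)) := by rw [← Real.exp_add]; ring_nf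
  have h3 := Real.add_one_le_exp (-(b - a))
  have h4 : exp (-a) ≤ 1 := Real.exp_le_one_iff.2 (by linarith)
  have h5 := Real.exp_pos (-a)
  rw [abs_sub_comm, abs_of_nonneg (by linarith), h2]
  nlinarith

lemma duh_xi {δ ε lam : ℝ} (hδ : 0 < δ) (hε : 0 < ε) (hl : 0 ≤ lam) (i j : Fin d) {u : Pt d → ℝ} (hu : CinfC u)
    {b : ℝ → Mx d} (hb : Coef δ b) (t : ℝ) (x ξ : Spc d) :
    ∫ s, mu i j (psi ε lam) (Bi b) t s ξ * WW (fun y => fb u b lam (s, y)) ξ x =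
      -(1 / ε) * ∫ s in (t + ε)..(t + 2 * ε), mu i j (fun τ => exp (-(lam * τ))) (Bi b) t s ξ * WW (fun y => u (s, y)) ξ x := by
  have hB := Bi_adm hδ hb
  obtain ⟨R1, hR1, hs1⟩ := hu.nice.supp
  obtain ⟨R2, hR2, hs2⟩ := (fb_nice hδ hu hb lam).supp
  set T := max (t + 2 * ε) (max (R1 ^ 2) (R2 ^ 2)) with hT
  have hT1 : t + 2 * ε ≤ T := le_max_left _ _
  have hT2 : R1 ^ 2 ≤ T := (le_max_left _ _).trans (le_max_right _ _)
  have hT3 : R2 ^ 2 ≤ T := (le_max_right _ _).trans (le_max_right _ _)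
  have hz1 : ∀ s, T ≤ s → ∀ y, u (s, y) = 0 := by
    intro s hs y; apply hs1; rw [mem_pc]; rintro ⟨h, -⟩
    simp only [Prod.fst_zero, sub_zero] at h
    have := le_abs_self s; linarith
  have hz2 : ∀ s, T ≤ s → ∀ y, fb u b lam (s, y) = 0 := by
    intro s hs y; apply hs2; rw [mem_pc]; rintro ⟨h, -⟩
    simp only [Prod.fst_zero, sub_zero] at h
    have := le_abs_self s; linarith
  set q : ℝ → ℝ := fun s => lam * (s - t) + 4 * π ^ 2 * qf (Bi b s - Bi b t) ξ with hq
  set U : ℝ → ℝ := fun s => WW (fun y => u (s, y)) ξ x with hU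
  set G : ℝ → ℝ := fun s => exp (-(q s)) * U s with hG
  set G' : ℝ → ℝ := fun s => exp (-(q s)) * WW (fun y => fb u b lam (s, y)) ξ x with hG'
  have hUd : ∀ s, HasDerivAt U (WW (fun y => Dt u (s, y)) ξ x) s := fun s => WW_deriv hu s ξ x
  obtain ⟨C, hC0, hC⟩ := WW_bd hu.nice
  obtain ⟨C', hC0', hC'⟩ := WW_bd hu.dt.nice
  have hUl : ∀ s s', |U s - U s'| ≤ C' * |s - s'| := by
    intro s s'
    have := Convex.norm_image_sub_le_of_norm_hasDerivWithin_le (s := univ) (f := U) (C := C') (fun x _ => (hUd x).hasDerivWithinAt) (fun s _ => hC' s ξ x) convex_univ (mem_univ s') (mem_univ s)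
    simpa using this
  set K1 := lam + 4 * π ^ 2 * (δ⁻¹ * ‖ξ‖ ^ 2) with hK1
  have hK10 : 0 ≤ K1 := by positivity
  have hqd : ∀ s' s, s' ≤ s → 0 ≤ q s - q s' ∧ q s - q s' ≤ K1 * (s - s') := by
    intro s' s h
    have e : q s - q s' = lam * (s - s') + 4 * π ^ 2 * qf (Bi b s - Bi b s') ξ := by
      simp only [hq, qf_sub]; ring
    have h1 := hB.low s' s h ξ
    have h2 := hB.up s' s h ξ
    have h3 : 0 ≤ δ * (s - s') * ‖ξ‖ ^ 2 := mul_nonneg (mul_nonneg hδ.le (by linarith)) (sq_nonneg _)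
    have h4 : 0 ≤ lam * (s - s') := mul_nonneg hl (by linarith)
    have h5 : 0 ≤ 4 * π ^ 2 := by positivity
    rw [e]; constructor
    · have := mul_nonneg h5 (h3.trans h1); linarith
    · have := mul_le_mul_of_nonneg_left h2 h5
      rw [hK1]; nlinarith
  have hqt : q t = 0 := by simp [hq, qf]
  have hq0 : ∀ s, t ≤ s → 0 ≤ q s := fun s hs => by have := (hqd t s hs).1; rwa [hqt, sub_zero] at this
  have hGl : ∀ s' s, t ≤ s' → s' ≤ s → |G s - G s'| ≤ (K1 * C + C') * (s - s') := by
    intro s' s h1 h2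
    have e : G s - G s' = (exp (-(q s)) - exp (-(q s'))) * U s + exp (-(q s')) * (U s - U s') := by simp only [hG]; ring
    have a1 := exp_lip (hq0 s' h1) (by have := (hqd s' s h2).1; linarith : q s' ≤ q s)
    have a2 := hUl s s'
    have a3 : exp (-(q s')) ≤ 1 := Real.exp_le_one_iff.2 (by have := hq0 s' h1; linarith)
    rw [e]
    refine (abs_add_le _ _).trans ?_
    rw [abs_mul, abs_mul, abs_of_pos (Real.exp_pos (-q s'))]
    have b1 : |exp (-(q s)) - exp (-(q s'))| * |U s| ≤ (K1 * (s - s')) * C :=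
      mul_le_mul (a1.trans (hqd s' s h2).2) (hC s ξ x) (abs_nonneg _) (mul_nonneg hK10 (by linarith))
    have b2 : exp (-(q s')) * |U s - U s'| ≤ 1 * (C' * |s - s'|) := mul_le_mul a3 a2 (abs_nonneg _) zero_le_one
    rw [abs_of_nonneg (by linarith : 0 ≤ s - s')] at b2
    nlinarith
  have hLip : LipschitzOnWith (Real.toNNReal (K1 * C + C')) G (Icc t T) := by
    apply LipschitzOnWith.of_dist_le_mul
    intro s hs s' hs'
    rw [Real.coe_toNNReal _ (by positivity), Real.dist_eq, Real.dist_eq]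
    rcases le_total s' s with h | h
    · rw [abs_of_nonneg (by linarith : 0 ≤ s - s')]; exact hGl s' s hs'.1 h
    · rw [abs_sub_comm, abs_sub_comm s, abs_of_nonneg (by linarith : 0 ≤ s' - s)]; exact hGl s s' hs.1 h
  have hGd : ∀ᵐ s, s ∈ Ioc t T → HasDerivAt G (G' s) s := by
    filter_upwards [Bi_deriv hδ hb t] with s hs _
    have h1 : HasDerivAt q (lam + 4 * π ^ 2 * qf (b s) ξ) s := by
      have := (((hasDerivAt_id s).sub_const t).const_mul lam).add ((hs ξ).const_mul (4 * π ^ 2))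
      rw [mul_one] at this
      exact this
    refine ((h1.fun_neg.exp).fun_mul (hUd s)).congr_deriv ?_
    symm
    change exp (-(q s)) * WW (fun y => fb u b lam (s, y)) ξ x = _
    rw [WW_fb hδ hu hb]
    change _ = exp (-(q s)) * -(lam + 4 * π ^ 2 * qf (b s) ξ) * WW (fun y => u (s, y)) ξ x + _
    ring
  have hGT : G T = 0 := by
    simp only [hG, hU, WW, hz1 T le_rfl]; simp
  have key := cutFTC hε hT1 hLip hGd hGT
  have e1 : ∫ s, mu i j (psi ε lam) (Bi b) t s ξ * WW (fun y => fb u b lam (s, y)) ξ x = (-(4 * π ^ 2 * ξ i * ξ j)) * ∫ s in t..T, phi ε (s - t) * G' s := by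
    rw [intervalIntegral.integral_of_le (by linarith), ← integral_const_mul, ← setIntegral_eq_integral_of_forall_compl_eq_zero (s := Ioc t T)]
    · refine integral_congr_ae (eof fun s => ?_)
      simp only [mu, psi, hG', hq, neg_add, Real.exp_add]; ring
    · intro s hs
      rw [mem_Ioc, not_and_or, not_lt, not_le] at hs
      rcases hs with h | h
      · simp [mu, psi, phi_zero hε (by linarith : s - t ≤ ε)]
      · simp only [WW, hz2 s h.le]; simp
  rw [e1, key, ← mul_assoc, mul_comm (-(4 * π ^ 2 * ξ i * ξ j)), mul_assoc, ← intervalIntegral.integral_const_mul]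
  congr 1
  refine intervalIntegral.integral_congr fun s _ => ?_
  simp only [mu, hG, hq, neg_add, Real.exp_add]; ring

def JJ (i j : Fin d) (u : Pt d → ℝ) (b : ℝ → Mx d) (lam t : ℝ) (x : Spc d) (s : ℝ) : ℝ :=
  ∫ ξ, mu i j (fun τ => exp (-(lam * τ))) (Bi b) t s ξ * WW (fun y => u (s, y)) ξ x

lemma duh {δ ε lam : ℝ} (hδ : 0 < δ) (hε : 0 < ε) (hl : 0 ≤ lam) (i j : Fin d) {u : Pt d → ℝ} (hu : CinfC u)
    {b : ℝ → Mx d} (hb : Coef δ b) (t : ℝ) (x : Spc d) :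
    IntervalIntegrable (JJ i j u b lam t x) volume (t + ε) (t + 2 * ε) ∧
    TT (Ker i j (psi ε lam) (Bi b)) (fb u b lam) (t, x) = -(1 / ε) * ∫ s in (t + ε)..(t + 2 * ε), JJ i j u b lam t x s := by
  have hB := Bi_adm hδ hb
  have hle : t + ε ≤ t + 2 * ε := by linarith
  obtain ⟨C, hC0, hC⟩ := WW_bd hu.nice
  have hI : Integrable (fun q : Spc d × ℝ => mu i j (fun τ => exp (-(lam * τ))) (Bi b) t q.2 q.1 * WW (fun y => u (q.2, y)) q.1 x)
      (volume.prod (volume.restrict (Ioc (t + ε) (t + 2 * ε)))) := by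
    have hm1 : Continuous (fun q : Spc d × ℝ => mu i j (fun τ => exp (-(lam * τ))) (Bi b) t q.2 q.1) := by
      unfold mu qf
      have h2 := hB.cont
      simp only [Matrix.sub_apply]
      fun_prop
    have hc : Integrable (fun _ : ℝ => C) (volume.restrict (Ioc (t + ε) (t + 2 * ε))) := integrableOn_const (by simp)
    refine Integrable.mono' ((gint (d := d) (c := δ * ε) (by positivity)).mul_prod hc) (hm1.measurable.mul (WW_meas hu.nice x)).aestronglyMeasurable ?_
    have hae : ∀ᵐ q : Spc d × ℝ ∂(volume.prod (volume.restrict (Ioc (t + ε) (t + 2 * ε)))), q.2 ∈ Ioc (t + ε) (t + 2 * ε) := by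
      have := (Measure.quasiMeasurePreserving_snd (μ := (volume : Measure (Spc d))) (ν := volume.restrict (Ioc (t + ε) (t + 2 * ε)))).ae (ae_restrict_mem measurableSet_Ioc)
      exact this
    filter_upwards [hae] with q hq
    rw [norm_mul]
    refine mul_le_mul ?_ (hC _ _ _) (norm_nonneg _) (by positivity)
    have h0 : ∀ ξ, δ * ε * ‖ξ‖ ^ 2 ≤ qf (Bi b q.2 - Bi b t) ξ := by
      intro ξ
      refine le_trans ?_ (hB.low t q.2 (by linarith [hq.1]) ξ)
      have : ε ≤ q.2 - t := by linarith [hq.1]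
      gcongr
    have h1 := kk_bd i j h0 q.1 0
    simp only [inner_zero_right, mul_zero, Real.cos_zero, mul_one] at h1
    rw [mu, norm_mul]
    refine (mul_le_of_le_one_left (norm_nonneg _) ?_).trans h1
    rw [Real.norm_of_nonneg (Real.exp_pos _).le, Real.exp_le_one_iff]
    have := mul_nonneg hl (by linarith [hq.1] : 0 ≤ q.2 - t); linarith
  constructor
  · rw [intervalIntegrable_iff_integrableOn_Ioc_of_le hle]
    exact hI.integral_prod_right
  · rw [TT_freq hδ i j (psi_cut hε hl) hB (fb_nice hδ hu hb lam)]
    simp only [duh_xi hδ hε hl i j hu hb]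
    rw [integral_const_mul, intervalIntegral.integral_of_le hle]
    congr 1
    simp only [intervalIntegral.integral_of_le hle]
    exact integral_integral_swap hI

lemma JJ_eq {δ lam : ℝ} (hδ : 0 < δ) (i j : Fin d) {u : Pt d → ℝ} (hu : CinfC u)
    {b : ℝ → Mx d} (hb : Coef δ b) (t : ℝ) (x : Spc d) (s : ℝ) (hs : t ≤ s) :
    ∃ L : Spc d →L[ℝ] Spc d, (∀ η, ‖L η‖ ≤ 2 * sqrt ((s - t) / δ) * ‖η‖) ∧
      JJ i j u b lam t x s = exp (-(lam * (s - t))) * ∫ η, Dxx i j u (s, x - L η) ∂(gam d) := by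
  have hB := Bi_adm hδ hb
  have hst : 0 ≤ s - t := by linarith
  obtain ⟨L, hL, hL2⟩ := gauss_L (Bi b s - Bi b t) (hB.symm s t) (fun ξ => le_trans (by positivity) (hB.low t s hs ξ)) (sqrt ((s - t) / δ)) (Real.sqrt_nonneg _) (fun ξ => by
    rw [Real.sq_sqrt (by positivity)]
    have := hB.up t s hs ξ
    rwa [div_eq_inv_mul])
  refine ⟨L, hL, ?_⟩
  rw [← gavg ((hu.dxx i j).sec s).1 ((hu.dxx i j).sec s).2 hL2 x, JJ, ← integral_const_mul]
  refine integral_congr_ae (eof fun ξ => ?_)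
  simp only [mu, WW, ibp2 hu]; ring

lemma duh_lim {δ lam : ℝ} (hδ : 0 < δ) (hl : 0 ≤ lam) (i j : Fin d) {u : Pt d → ℝ} (hu : CinfC u)
    {κ : ℝ} (hκ : 0 < κ) : ∃ ε0, 0 < ε0 ∧ ∀ ε, 0 < ε → ε ≤ ε0 → ∀ b : ℝ → Mx d, Coef δ b →
      ∀ z, |TT (Ker i j (psi ε lam) (Bi b)) (fb u b lam) z + Dxx i j u z| ≤ κ := by
  obtain ⟨Lp, hLp0, hLp⟩ := (hu.dxx i j).lip
  obtain ⟨M, hM⟩ := (hu.dxx i j).nice.bdd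
  have hM0 : 0 ≤ M := (abs_nonneg _).trans (hM 0)
  have hEi : Integrable (fun η : Spc d => ‖η‖) (gam d) := by
    refine (gam_mom (d := d) 0 le_rfl 0).mono' (by fun_prop) (eof fun η => ?_)
    rw [norm_norm]; simp
  set E := ∫ η, ‖η‖ ∂(gam d) with hE
  have hE0 : 0 ≤ E := integral_nonneg fun _ => norm_nonneg _
  have hlim : Filter.Tendsto (fun ε : ℝ => Lp * (2 * ε + 2 * sqrt (2 * ε / δ) * E) + lam * (2 * ε) * M) (nhdsWithin 0 (Ioi 0)) (nhds 0) := by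
    have : Continuous (fun ε : ℝ => Lp * (2 * ε + 2 * sqrt (2 * ε / δ) * E) + lam * (2 * ε) * M) := by fun_prop
    have h := this.tendsto 0
    simp only [mul_zero, zero_div, Real.sqrt_zero, zero_mul, add_zero] at h
    exact h.mono_left nhdsWithin_le_nhds
  have hev := hlim.eventually (gt_mem_nhds hκ)
  rw [eventually_nhdsWithin_iff, Metric.eventually_nhds_iff] at hev
  obtain ⟨e0, he0, hev⟩ := hev
  refine ⟨e0 / 2, by positivity, fun ε hε hεe b hb z => ?_⟩
  have hsm := hev (y := ε) (by rw [Real.dist_eq, sub_zero, abs_of_pos hε]; linarith) hε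
  obtain ⟨t, x⟩ := z
  obtain ⟨hJi, hT⟩ := duh hδ hε hl i j hu hb t x
  set v := Dxx i j u (t, x) with hv
  have hJ : ∀ s ∈ uIoc (t + ε) (t + 2 * ε), ‖JJ i j u b lam t x s - v‖ ≤ κ := by
    intro s hs
    rw [uIoc_of_le (by linarith)] at hs
    have hts : t ≤ s := by linarith [hs.1]
    obtain ⟨L, hL, hJe⟩ := JJ_eq (lam := lam) hδ i j hu hb t x s hts
    have hci : Integrable (fun η => Dxx i j u (s, x - L η)) (gam d) := by
      refine Integrable.mono' (integrable_const M) ?_ (eof fun η => hM _)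
      have h1 := (hu.dxx i j).1.continuous
      have h2 : Continuous fun η => Dxx i j u (s, x - L η) := h1.comp (by fun_prop)
      exact h2.aestronglyMeasurable
    have e1 : JJ i j u b lam t x s - v = exp (-(lam * (s - t))) * (∫ η, (Dxx i j u (s, x - L η) - v) ∂(gam d)) + (exp (-(lam * (s - t))) - exp (-0)) * v := by
      rw [integral_sub hci (integrable_const _), hJe]
      simp; ring
    have h1 : ‖∫ η, (Dxx i j u (s, x - L η) - v) ∂(gam d)‖ ≤ Lp * (2 * ε + 2 * sqrt (2 * ε / δ) * E) := by
      have hg : Integrable (fun η : Spc d => Lp * (2 * ε + 2 * sqrt (2 * ε / δ) * ‖η‖)) (gam d) := ((integrable_const _).add (hEi.const_mul _)).const_mul _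
      refine (norm_integral_le_of_norm_le hg (eof fun η => ?_)).trans (le_of_eq ?_)
      · refine (hLp s t _ _).trans (mul_le_mul_of_nonneg_left ?_ hLp0)
        rw [abs_of_nonneg (by linarith)]
        have h3 : x - L η - x = -(L η) := by abel
        rw [h3, norm_neg]
        refine add_le_add (by linarith [hs.2]) ((hL η).trans ?_)
        have : sqrt ((s - t) / δ) ≤ sqrt (2 * ε / δ) := Real.sqrt_le_sqrt (by gcongr; linarith [hs.2])
        gcongr
      · rw [integral_const_mul, integral_add (integrable_const _) (hEi.const_mul _)]; simp [hE]; exact Or.inl (integral_const_mul _ _)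
    have h2 : |exp (-(lam * (s - t))) - exp (-0)| ≤ lam * (2 * ε) := by
      refine (exp_lip le_rfl (mul_nonneg hl (by linarith))).trans ?_
      rw [sub_zero]; exact mul_le_mul_of_nonneg_left (by linarith [hs.2]) hl
    rw [e1]
    refine (norm_add_le _ _).trans ?_
    rw [norm_mul, norm_mul]
    have h4 : ‖exp (-(lam * (s - t)))‖ ≤ 1 := by
      rw [Real.norm_of_nonneg (Real.exp_pos _).le, Real.exp_le_one_iff]
      have := mul_nonneg hl (by linarith : 0 ≤ s - t); linarith
    have h5 := mul_le_mul h4 h1 (norm_nonneg _) zero_le_one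
    have h6 : ‖exp (-(lam * (s - t))) - exp (-0)‖ * ‖v‖ ≤ lam * (2 * ε) * M := mul_le_mul h2 (hM _) (norm_nonneg _) (by positivity)
    linarith
  have e2 : TT (Ker i j (psi ε lam) (Bi b)) (fb u b lam) (t, x) + v = -(1 / ε) * ∫ s in (t + ε)..(t + 2 * ε), (JJ i j u b lam t x s - v) := by
    rw [hT, intervalIntegral.integral_sub hJi (by simp)]
    simp only [intervalIntegral.integral_const, smul_eq_mul]
    field_simp; ring
  rw [e2, abs_mul]
  have h7 := intervalIntegral.norm_integral_le_of_norm_le_const hJ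
  rw [Real.norm_eq_abs] at h7
  have h8 : |t + 2 * ε - (t + ε)| = ε := by rw [show t + 2 * ε - (t + ε) = ε by ring, abs_of_pos hε]
  rw [h8] at h7
  rw [abs_neg, abs_of_pos (by positivity)]
  calc 1 / ε * _ ≤ 1 / ε * (κ * ε) := by gcongr
    _ = κ := by field_simp

lemma core_osc (d : ℕ) {δ p0 : ℝ} (hδ : 0 < δ) (hδ1 : δ ≤ 1) (hp0 : 1 < p0) (hp2 : p0 < 2) :
    ∃ N : ℝ, 0 < N ∧ ∀ b : ℝ → Mx d, Coef δ b → ∀ u : Pt d → ℝ, CinfC u → ∀ lam : ℝ, 0 ≤ lam → ∀ i j : Fin d,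
      ∀ (z0 : Pt d) (r s θ : ℝ), 0 < r → 0 < s → 0 < θ → N * θ ≤ 1 →
      (∀ k : ℕ, 4 ≤ k → Gd p0 (fun z => |fb u b lam z|) (θ * (3/2) ^ k * s) z0 (2 ^ k * r)) →
      Gd 1 (fun z => |Dxx i j u z|) s z0 (4 * r) →
      volume {w ∈ pc z0 (4 * r) | 7 * s < |Dxx i j u w|} ≤ ofReal (N * θ ^ p0) * volume (pc z0 r) := by
  obtain ⟨N0, hN0, hreg⟩ := Ker_reg d hδ hδ1
  obtain ⟨Np, hNp, hdown⟩ := CZ_down d (N2 := δ⁻¹ * δ⁻¹) hp0 hp2 hN0.le (by positivity)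
  obtain ⟨N, hN, hosc⟩ := osc d hp0.le hN0.le hNp.le
  refine ⟨N, hN, fun b hb u hu lam hl i j z0 r s θ hr hs hθ hNθ hF hD => ?_⟩
  obtain ⟨ε, hε, hlim⟩ := duh_lim hδ hl i j hu hs
  have hlim := hlim ε hε le_rfl b hb
  have hψ := psi_cut hε hl
  have hB := Bi_adm hδ hb
  have hK := Ker_KN hδ i j hψ hB
  set T := TT (Ker i j (psi ε lam) (Bi b)) (fb u b lam) with hT
  have hLp := hdown _ hK (Ker_regT (δ := δ) i j hψ (hreg _ hB.refl ε _ hψ i j)) (L2B hδ i j hψ hB)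
  have h := hosc _ hK (hreg _ hB ε _ hψ i j) hLp _ (fb_nice hδ hu hb lam) z0 r (2 * s) θ hr (by positivity) hθ hNθ ?_ ?_
  · refine (measure_mono ?_).trans h
    rintro w ⟨hw, hw2⟩
    refine ⟨hw, ?_⟩
    have h1 := hlim w
    have h2 : |Dxx i j u w| ≤ |T w + Dxx i j u w| + |T w| := by
      have := abs_sub (T w + Dxx i j u w) (T w); rwa [add_sub_cancel_left] at this
    linarith
  · intro k hk
    refine (hF k hk).mono (by linarith) ?_
    have : 0 ≤ θ * (3/2) ^ k * s := by positivity
    linarith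
  · unfold Gd LI at hD ⊢
    simp only [ENNReal.rpow_one] at hD ⊢
    calc ∫⁻ w in pc z0 (4 * r), ofReal |T w| ≤ ∫⁻ w in pc z0 (4 * r), (ofReal |Dxx i j u w| + ofReal s) := by
          refine lintegral_mono fun w => ?_
          rw [← ofReal_add (abs_nonneg _) hs.le]
          refine ofReal_le_ofReal ?_
          have h1 := hlim w
          have h2 : |T w| ≤ |T w + Dxx i j u w| + |Dxx i j u w| := by
            have := abs_sub (T w + Dxx i j u w) (Dxx i j u w); rwa [add_sub_cancel_right] at this
          linarith
      _ = (∫⁻ w in pc z0 (4 * r), ofReal |Dxx i j u w|) + ofReal s * volume (pc z0 (4 * r)) := by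
          rw [lintegral_add_right _ measurable_const]; simp
      _ ≤ ofReal s * volume (pc z0 (4 * r)) + ofReal s * volume (pc z0 (4 * r)) := by gcongr
      _ = ofReal (2 * s) * volume (pc z0 (4 * r)) := by
          rw [two_mul, ofReal_add hs.le hs.le, add_mul]

lemma LI_hold {p0 q m M A α s : ℝ} (hp0 : 1 < p0) (hq : p0 < q) (hm : m = p0 * Real.conjExponent (q / p0)) (hM : 0 < M) (hA : 0 ≤ A) (hα : 0 < α)
    (hA2 : M ^ (m - 1) * A ≤ α ^ m) {g H : Pt d → ℝ} (hg : Measurable g) (hH : Measurable H) (hg0 : ∀ z, 0 ≤ g z) (hgM : ∀ z, g z ≤ M) (hs : 0 < s)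
    {D : Set (Pt d)} (hgD : ∫⁻ z in D, ofReal (g z) ≤ ofReal A * volume D)
    (hHD : LI q H D ≤ ofReal s ^ q * volume D) :
    LI p0 (fun z => g z * H z) D ≤ ofReal (α * s) ^ p0 * volume D := by
  have h0 : 0 < p0 := by linarith
  have hP : 1 < q / p0 := by rw [lt_div_iff₀ h0]; linarith
  have hPQ := Real.HolderConjugate.conjExponent hP
  set P := q / p0 with hPd
  set Q := Real.conjExponent P with hQ
  have hQ1 : 1 < Q := hPQ.symm.lt
  have hm1 : 1 < m := by rw [hm]; nlinarith
  have hqP : p0 * P = q := by rw [hPd]; field_simp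
  have h1 : ∫⁻ z in D, (ofReal (g z) ^ p0) ^ Q ≤ ofReal (α ^ m) * volume D := by
    calc ∫⁻ z in D, (ofReal (g z) ^ p0) ^ Q ≤ ∫⁻ z in D, ofReal (M ^ (m - 1)) * ofReal (g z) := by
          refine lintegral_mono fun z => ?_
          dsimp only
          rw [← ENNReal.rpow_mul, ← hm, ofReal_rpow_of_nonneg (hg0 z) (by linarith), ← ofReal_mul (by positivity)]
          refine ofReal_le_ofReal ?_
          have e : g z ^ m = g z ^ (m - 1) * g z := by
            rw [← Real.rpow_add_one' (hg0 z) (by linarith)]; ring_nf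
          rw [e]
          exact mul_le_mul_of_nonneg_right (Real.rpow_le_rpow (hg0 z) (hgM z) (by linarith)) (hg0 z)
      _ = ofReal (M ^ (m - 1)) * ∫⁻ z in D, ofReal (g z) := lintegral_const_mul _ (by fun_prop)
      _ ≤ ofReal (M ^ (m - 1)) * (ofReal A * volume D) := by gcongr
      _ = ofReal (M ^ (m - 1) * A) * volume D := by rw [← mul_assoc, ofReal_mul (by positivity)]
      _ ≤ _ := by gcongr
  have h2 : ∫⁻ z in D, (ofReal (H z) ^ p0) ^ P ≤ ofReal s ^ q * volume D := by
    refine le_trans (le_of_eq ?_) hHD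
    unfold LI
    refine lintegral_congr fun z => ?_
    rw [← ENNReal.rpow_mul, hqP]
  have h3 : LI p0 (fun z => g z * H z) D = ∫⁻ z in D, ((fun z => ofReal (g z) ^ p0) * (fun z => ofReal (H z) ^ p0)) z := by
    unfold LI
    refine lintegral_congr fun z => ?_
    rw [ofReal_mul (hg0 z), mul_rpow_of_nonneg _ _ h0.le]; rfl
  rw [h3]
  have hPp := hPQ.pos
  have hQp := hPQ.symm.pos
  refine (ENNReal.lintegral_mul_le_Lp_mul_Lq (volume.restrict D) hPQ.symm (by fun_prop) (by fun_prop)).trans ?_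
  calc _ ≤ (ofReal (α ^ m) * volume D) ^ (1 / Q) * (ofReal s ^ q * volume D) ^ (1 / P) := by gcongr
    _ = _ := by
      rw [mul_rpow_of_nonneg _ _ (by positivity), mul_rpow_of_nonneg _ _ (by positivity),
        ← ofReal_rpow_of_pos hα, ← ENNReal.rpow_mul, ← ENNReal.rpow_mul, ofReal_mul hα.le, mul_rpow_of_nonneg _ _ h0.le]
      have e1 : m * (1 / Q) = p0 := by rw [hm]; field_simp
      have e2 : q * (1 / P) = p0 := by rw [← hqP]; field_simp
      rw [e1, e2, mul_mul_mul_comm, ← ENNReal.rpow_add_of_nonneg _ _ (by positivity) (by positivity)]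
      have e3 : 1 / Q + 1 / P = 1 := by simpa using hPQ.symm.inv_add_inv_eq_one
      rw [e3, ENNReal.rpow_one]

lemma Gd_add {p0 c r : ℝ} (hp0 : 1 ≤ p0) {F G H : Pt d → ℝ} {z : Pt d} (hG : Measurable G) (hF0 : ∀ z, 0 ≤ F z) (hG0 : ∀ z, 0 ≤ G z)
    (h1 : Gd p0 F c z r) (h2 : Gd p0 G c z r) (hH : ∀ w, H w ≤ F w + G w) : Gd p0 H (2 * c) z r := by
  unfold Gd LI at *
  calc ∫⁻ w in pc z r, ofReal (H w) ^ p0 ≤ ∫⁻ w in pc z r, 2 ^ (p0 - 1) * (ofReal (F w) ^ p0 + ofReal (G w) ^ p0) := by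
        refine lintegral_mono fun w => ?_
        refine le_trans ?_ (ENNReal.rpow_add_le_mul_rpow_add_rpow _ _ hp0)
        rw [← ofReal_add (hF0 w) (hG0 w)]
        have := hH w
        gcongr
    _ = 2 ^ (p0 - 1) * ((∫⁻ w in pc z r, ofReal (F w) ^ p0) + ∫⁻ w in pc z r, ofReal (G w) ^ p0) := by
        rw [lintegral_const_mul' _ _ (by simp), lintegral_add_right _ (by fun_prop)]
    _ ≤ 2 ^ (p0 - 1) * (ofReal c ^ p0 * volume (pc z r) + ofReal c ^ p0 * volume (pc z r)) := by gcongr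
    _ = _ := by
        rw [← two_mul, ofReal_mul zero_le_two, mul_rpow_of_nonneg _ _ (by linarith), ofReal_ofNat, ← mul_assoc, ← mul_assoc]
        congr 2
        have : (2:ℝ≥0∞) ^ (p0 - 1) * 2 = 2 ^ (p0 - 1) * 2 ^ (1:ℝ) := by rw [ENNReal.rpow_one]
        rw [this, ← ENNReal.rpow_add _ _ (by simp) (by simp)]; ring_nf

lemma mnorm_cs (A B : Fin d → Fin d → ℝ) : |∑ i, ∑ j, A i j * B i j| ≤ mnorm A * mnorm B := by
  rw [mnorm, mnorm, ← Real.sqrt_mul (by positivity), ← Real.sqrt_sq_eq_abs]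
  refine Real.sqrt_le_sqrt ?_
  have := Finset.sum_mul_sq_le_sq_mul_sq (Finset.univ : Finset (Fin d × Fin d)) (fun x => A x.1 x.2) (fun x => B x.1 x.2)
  simpa only [Fintype.sum_prod_type] using this

lemma mnorm_nonneg (A : Fin d → Fin d → ℝ) : 0 ≤ mnorm A := Real.sqrt_nonneg _

lemma le_mnorm (A : Fin d → Fin d → ℝ) (i j : Fin d) : |A i j| ≤ mnorm A := by
  rw [mnorm, ← Real.sqrt_sq_eq_abs]
  refine Real.sqrt_le_sqrt ?_
  refine le_trans (Finset.single_le_sum (f := fun j => A i j ^ 2) (fun _ _ => sq_nonneg _) (Finset.mem_univ j)) ?_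
  exact Finset.single_le_sum (f := fun i => ∑ j, A i j ^ 2) (fun _ _ => Finset.sum_nonneg fun _ _ => sq_nonneg _) (Finset.mem_univ i)

lemma mnorm_le (A : Fin d → Fin d → ℝ) {c : ℝ} (hc : 0 ≤ c) (h : ∀ i j, |A i j| ≤ c) : mnorm A ≤ d * c := by
  rw [mnorm]
  refine Real.sqrt_le_iff.2 ⟨by positivity, ?_⟩
  calc ∑ i, ∑ j, A i j ^ 2 ≤ ∑ i : Fin d, ∑ j : Fin d, c ^ 2 := Finset.sum_le_sum fun i _ => Finset.sum_le_sum fun j _ => by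
        rw [← sq_abs]; exact pow_le_pow_left₀ (abs_nonneg _) (h i j) 2
    _ = _ := by simp; ring

lemma mnorm_meas {A : Pt d → Fin d → Fin d → ℝ} (h : ∀ i j, Measurable fun z => A z i j) : Measurable fun z => mnorm (A z) := by
  unfold mnorm; fun_prop

lemma mat_meas {a : Pt d → Mx d} (ha : Measurable a) (i j : Fin d) : Measurable fun z => a z i j :=
  (measurable_pi_apply j).comp ((measurable_pi_apply i).comp (show Measurable (fun z => (a z : Fin d → Fin d → ℝ)) from ha))

lemma aTilde_coef {δ : ℝ} (hδ : 0 < δ) {a : Pt d → Mx d} (ha : Measurable a) (hS : ∀ z, inS d δ (a z)) {R : ℝ} (hR : 0 < R) (x0 : Spc d) :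
    Coef δ (fun t => Matrix.of fun i j => aTilde a R x0 t i j) := by
  have hm := mat_meas ha
  have hv0 : volume (ball x0 R) ≠ 0 := (measure_ball_pos volume x0 hR).ne'
  have hvt : volume (ball x0 R) ≠ ⊤ := measure_ball_lt_top.ne
  have hc : 0 < (volume (ball x0 R)).toReal := ENNReal.toReal_pos hv0 hvt
  have hI : ∀ t i j, IntegrableOn (fun y => a (t, y) i j) (ball x0 R) := by
    intro t i j
    have h1 := (hm i j).comp (by fun_prop : Measurable fun y : Spc d => (t, y))
    refine Integrable.mono' (g := fun _ => δ⁻¹) (integrableOn_const hvt) h1.aestronglyMeasurable (eof fun y => inS_entry hδ (hS _) i j)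
  have hav : ∀ t i j, aTilde a R x0 t i j = (volume (ball x0 R)).toReal⁻¹ * ∫ y in ball x0 R, a (t, y) i j := by
    intro t i j; rw [aTilde, setAverage_eq, smul_eq_mul]; rfl
  refine ⟨fun i j => ?_, fun t => ⟨?_, fun ξ => ?_⟩⟩
  · simp only [Matrix.of_apply, hav]
    refine Measurable.const_mul ?_ _
    have h1 : StronglyMeasurable (Function.uncurry fun (t : ℝ) (y : Spc d) => a (t, y) i j) := (hm i j).stronglyMeasurable
    exact (h1.integral_prod_right (ν := volume.restrict (ball x0 R))).measurable
  · ext i j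
    simp only [Matrix.transpose_apply, Matrix.of_apply, hav]
    congr 2; ext y
    exact (hS (t, y)).1.apply i j
  · have e : ∑ i, ∑ j, (Matrix.of fun i j => aTilde a R x0 t i j) i j * ξ i * ξ j = (volume (ball x0 R)).toReal⁻¹ * ∫ y in ball x0 R, ∑ i, ∑ j, a (t, y) i j * ξ i * ξ j := by
      rw [integral_finsetSum _ fun i _ => integrable_finsetSum _ fun j _ => ((hI t i j).mul_const _).mul_const _, Finset.mul_sum]
      refine Finset.sum_congr rfl fun i _ => ?_
      rw [integral_finsetSum _ fun j _ => ((hI t i j).mul_const _).mul_const _, Finset.mul_sum]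
      refine Finset.sum_congr rfl fun j _ => ?_
      rw [integral_mul_const, integral_mul_const, Matrix.of_apply, hav]; ring
    have hI2 : IntegrableOn (fun y => ∑ i, ∑ j, a (t, y) i j * ξ i * ξ j) (ball x0 R) :=
      integrable_finsetSum _ fun i _ => integrable_finsetSum _ fun j _ => ((hI t i j).mul_const _).mul_const _
    have h1 := setIntegral_mono (s := ball x0 R) (integrableOn_const hvt) hI2 (fun y => ((hS (t, y)).2 ξ).1)
    have h2 := setIntegral_mono (s := ball x0 R) hI2 (integrableOn_const hvt) (fun y => ((hS (t, y)).2 ξ).2)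
    rw [setIntegral_const, smul_eq_mul] at h1 h2
    rw [e]
    constructor
    · rw [inv_mul_eq_div, le_div_iff₀ hc, mul_comm]; exact h1
    · rw [inv_mul_eq_div, div_le_iff₀ hc]; exact h2.trans_eq (mul_comm _ _)

lemma cyl_sub_pc {ρ t : ℝ} {x : Spc d} : cyl d ρ t x ⊆ pc (t, x) ρ := by
  rintro w ⟨h1, h2⟩
  exact ⟨⟨by have := h1.1; have := sq_nonneg ρ; linarith, h1.2⟩, h2⟩

lemma pc_sub_cyl {ρ t : ℝ} {x : Spc d} (hρ : 0 < ρ) : pc (t, x) ρ ⊆ cyl d (2 * ρ) (t - ρ ^ 2) x := by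
  rintro w ⟨h1, h2⟩
  refine ⟨⟨h1.1, ?_⟩, ball_subset_ball (by linarith) h2⟩
  have := h1.2; have := sq_nonneg ρ; nlinarith

lemma lu_GG (d : ℕ) {δ p0 q η : ℝ} (hd : 1 ≤ d) (hδ : 0 < δ) (hδ1 : δ ≤ 1) (hp0 : 1 < p0) (hp2 : p0 < 2) (hq : p0 < q) (hη : 0 < η) :
    ∃ aHat γ : ℝ, 0 < aHat ∧ 0 < γ ∧ ∀ a : Pt d → Mx d, Measurable a → (∀ z, inS d δ (a z)) → aSharp a ≤ ofReal aHat →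
      ∀ lam : ℝ, 0 ≤ lam → ∀ u : Pt d → ℝ, CinfC u → GG q (7 * d) η γ (fun z => mnorm fun i j => Dxx i j u z)
        (fun z => |Dt u z + (∑ i, ∑ j, a z i j * Dxx i j u z) - lam * u z|) := by
  obtain ⟨N, hN, hcore⟩ := core_osc d hδ hδ1 hp0 hp2
  have hd0 : (0:ℝ) < d := by exact_mod_cast hd
  have h0 : 0 < p0 := by linarith
  set θ := min (1 / N) ((η / (d * d * N)) ^ (1 / p0)) with hθd
  have hθ : 0 < θ := by positivity
  have hθ1 : N * θ ≤ 1 := by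
    have := min_le_left (1 / N) ((η / (d * d * N)) ^ (1 / p0))
    calc N * θ ≤ N * (1 / N) := by gcongr
      _ = 1 := by field_simp
  have hθ2 : d * d * (N * θ ^ p0) ≤ η := by
    have h1 : θ ^ p0 ≤ η / (d * d * N) := by
      calc θ ^ p0 ≤ ((η / (d * d * N)) ^ (1 / p0)) ^ p0 := by gcongr; exact min_le_right _ _
        _ = _ := by rw [← Real.rpow_mul (by positivity), one_div_mul_cancel h0.ne', Real.rpow_one]
    rw [le_div_iff₀ (by positivity)] at h1; linarith
  set M := d * (δ⁻¹ + δ⁻¹) with hM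
  have hM0 : 0 < M := by positivity
  obtain ⟨k0, hk0⟩ : ∃ k0 : ℕ, M ≤ θ / 2 * (3 / 2) ^ k0 := by
    obtain ⟨k, hk⟩ := pow_unbounded_of_one_lt (M / (θ / 2)) (by norm_num : (1:ℝ) < 3 / 2)
    refine ⟨k, ?_⟩
    rw [div_lt_iff₀ (by positivity)] at hk; linarith
  set m := p0 * Real.conjExponent (q / p0) with hm
  set V : ℝ := (2 ^ (k0 + 1)) ^ (d + 2) with hV
  have hV0 : 0 < V := by positivity
  set A := (θ / 2) ^ m / M ^ (m - 1) with hA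
  have hA0 : 0 < A := by positivity
  refine ⟨A / V, θ / 2, by positivity, by positivity, fun a ha hS hsh lam hl u hu z0 r s hr hs hG => ?_⟩
  set R := 2 ^ (k0 + 1) * r with hR
  have hR0 : 0 < R := by positivity
  set b : ℝ → Mx d := fun t => Matrix.of fun i j => aTilde a R z0.2 t i j with hb
  have hbC : Coef δ b := aTilde_coef hδ ha hS hR0 z0.2
  set H : Pt d → ℝ := fun z => mnorm fun i j => Dxx i j u z with hH
  set f : Pt d → ℝ := fun z => |Dt u z + (∑ i, ∑ j, a z i j * Dxx i j u z) - lam * u z| with hf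
  set g : Pt d → ℝ := fun z => mnorm fun i j => a z i j - b z.1 i j with hg
  have hDm : ∀ i j, Measurable (Dxx i j u) := fun i j => (hu.dxx i j).1.continuous.measurable
  have hHm : Measurable H := mnorm_meas hDm
  have ham := mat_meas ha
  have hbm : ∀ i j, Measurable fun z : Pt d => b z.1 i j := fun i j => (hbC.meas i j).comp measurable_fst
  have hgm : Measurable g := mnorm_meas fun i j => (ham i j).sub (hbm i j)
  have hgM : ∀ z, g z ≤ M := fun z => mnorm_le _ (by positivity) fun i j => (abs_sub _ _).trans (add_le_add (inS_entry hδ (hS z) i j) (inS_entry hδ (hbC.inS z.1) i j))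
  have hg0 : ∀ z, 0 ≤ g z := fun z => mnorm_nonneg _
  have hH0 : ∀ z, 0 ≤ H z := fun z => mnorm_nonneg _
  have hfb : ∀ z, |fb u b lam z| ≤ f z + g z * H z := by
    intro z
    have e : fb u b lam z = (Dt u z + (∑ i, ∑ j, a z i j * Dxx i j u z) - lam * u z) - ∑ i, ∑ j, (a z i j - b z.1 i j) * Dxx i j u z := by
      simp only [fb, sub_mul, Finset.sum_sub_distrib]; ring
    rw [e]
    exact (abs_sub _ _).trans (add_le_add le_rfl (mnorm_cs _ _))
  have hfm : Measurable f := by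
    have := (Lu_nice hu (a := fun z => a z) ham (fun z k l => inS_entry hδ (hS z) k l) lam).meas
    exact this.abs
  have hFk : ∀ k : ℕ, 4 ≤ k → Gd p0 (fun z => |fb u b lam z|) (θ * (3/2) ^ k * s) z0 (2 ^ k * r) := by
    intro k hk
    obtain ⟨hGH, hGf⟩ := hG k (by omega)
    have e : θ * (3/2) ^ k * s = 2 * (θ / 2 * (3/2) ^ k * s) := by ring
    have hpk : (1:ℝ) ≤ (3/2) ^ k := one_le_pow₀ (by norm_num)
    have hle : θ / 2 * s ≤ θ / 2 * (3/2) ^ k * s := by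
      have : 0 < θ / 2 * s := by positivity
      nlinarith
    rw [e]
    refine Gd_add (F := f) (G := fun z => g z * H z) hp0.le (by fun_prop) (fun z => abs_nonneg _) (fun z => mul_nonneg (hg0 z) (hH0 z)) ?_ ?_ hfb
    · exact Gd.mono h0.le (holder_avg h0 hq.le hfm _ hGf) hle
    · rcases le_or_gt k0 k with hkk | hkk
      · have h1 : Gd p0 H s z0 (2 ^ k * r) := holder_avg h0 hq.le hHm _ hGH
        have h2 : Gd p0 (fun z => g z * H z) (M * s) z0 (2 ^ k * r) := by
          unfold Gd at h1 ⊢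
          calc LI p0 (fun z => g z * H z) (pc z0 (2 ^ k * r)) ≤ LI p0 (fun z => M * H z) (pc z0 (2 ^ k * r)) :=
                LI_mono h0.le _ fun w => mul_le_mul_of_nonneg_right (hgM w) (hH0 w)
            _ = ofReal M ^ p0 * LI p0 H (pc z0 (2 ^ k * r)) := by
                unfold LI
                rw [← lintegral_const_mul _ (by fun_prop)]
                refine lintegral_congr fun w => ?_
                rw [ofReal_mul hM0.le, mul_rpow_of_nonneg _ _ h0.le]
            _ ≤ ofReal M ^ p0 * (ofReal s ^ p0 * volume (pc z0 (2 ^ k * r))) := by gcongr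
            _ = _ := by rw [ofReal_mul hM0.le, mul_rpow_of_nonneg _ _ h0.le, mul_assoc]
        refine h2.mono h0.le ?_
        have : ((3:ℝ)/2) ^ k0 ≤ (3/2) ^ k := pow_le_pow_right₀ (by norm_num) hkk
        have h3 : M ≤ θ / 2 * (3/2) ^ k := hk0.trans (by gcongr)
        gcongr
      · refine Gd.mono (s := θ / 2 * s) h0.le ?_ hle
        refine LI_hold hp0 hq hm hM0 hA0.le (by positivity) ?_ hgm hHm hg0 hgM hs ?_ hGH
        · rw [hA]; apply le_of_eq; field_simp
        · have hrk : 0 < 2 ^ k * r := by positivity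
          have hr0 : 0 < 2 ^ k0 * r := by positivity
          have s1 : pc z0 (2 ^ k * r) ⊆ cyl d R (z0.1 - (2 ^ k0 * r) ^ 2) z0.2 := by
            refine (pc_mono hrk (?_ : 2 ^ k * r ≤ 2 ^ k0 * r)).trans ?_
            · gcongr; norm_num
            · have := pc_sub_cyl (d := d) (t := z0.1) (x := z0.2) hr0
              rw [hR, pow_succ, mul_comm _ (2:ℝ), mul_assoc]; exact this
          set C := cyl d R (z0.1 - (2 ^ k0 * r) ^ 2) z0.2 with hC
          have hCv0 : volume C ≠ 0 := by
            have := measure_mono (μ := volume) s1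
            intro h; rw [h] at this; exact vol_pc_pos z0 hrk (le_antisymm this bot_le)
          have hCv : volume C ≤ ofReal V * volume (pc z0 (2 ^ k * r)) := by
            refine (measure_mono cyl_sub_pc).trans ?_
            rw [vol_pc _ hR0, vol_pc _ hrk, ← ofReal_mul hV0.le]
            refine ofReal_le_ofReal ?_
            have hvv := vv_pos d
            have : r ≤ 2 ^ k * r := le_mul_of_one_le_left hr.le (one_le_pow₀ (by norm_num))
            calc vv d * R ^ (d + 2) = V * (vv d * r ^ (d + 2)) := by rw [hR, hV, mul_pow]; ring
              _ ≤ _ := by gcongr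
          have hCt : volume C ≠ ⊤ := (hCv.trans_lt (ENNReal.mul_lt_top ofReal_lt_top (vol_pc_ne_top z0 _).lt_top)).ne
          have h1 : aSharpCyl a R (z0.1 - (2 ^ k0 * r) ^ 2) z0.2 ≤ ofReal (A / V) := by
            refine le_trans ?_ hsh
            unfold aSharp
            exact le_iSup₂_of_le R hR0 (le_iSup₂_of_le _ _ le_rfl)
          rw [aSharpCyl] at h1
          have h2 : ∫⁻ z in C, ofReal (g z) ≤ ofReal (A / V) * volume C := by
            have := mul_le_mul_right h1 (volume C)
            rw [← mul_assoc, ENNReal.mul_inv_cancel hCv0 hCt, one_mul] at this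
            exact this.trans_eq (mul_comm _ _)
          calc ∫⁻ z in pc z0 (2 ^ k * r), ofReal (g z) ≤ ∫⁻ z in C, ofReal (g z) := lintegral_mono_set s1
            _ ≤ ofReal (A / V) * (ofReal V * volume (pc z0 (2 ^ k * r))) := h2.trans (by gcongr)
            _ = _ := by rw [← mul_assoc, ← ofReal_mul (by positivity), div_mul_cancel₀ _ hV0.ne']
  have hG1 : ∀ i j, Gd 1 (fun z => |Dxx i j u z|) s z0 (4 * r) := by
    intro i j
    have h1 := (hG 2 (by norm_num)).1
    have h2 : Gd 1 H s z0 (2 ^ 2 * r) := holder_avg one_pos (by linarith) hHm _ h1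
    norm_num at h2
    exact (LI_mono zero_le_one _ fun w => le_mnorm (fun i j => Dxx i j u w) i j).trans h2
  have hsub : {w ∈ pc z0 (4 * r) | 7 * d * s < H w} ⊆ ⋃ i : Fin d, ⋃ j : Fin d, {w ∈ pc z0 (4 * r) | 7 * s < |Dxx i j u w|} := by
    rintro w ⟨hw, hw2⟩
    by_contra hcon
    simp only [mem_iUnion, not_exists] at hcon
    have : H w ≤ d * (7 * s) := mnorm_le _ (by positivity) fun i j => by
      by_contra h; exact hcon i j ⟨hw, not_le.1 h⟩
    linarith
  calc volume {w ∈ pc z0 (4 * r) | 7 * d * s < H w} ≤ volume (⋃ i : Fin d, ⋃ j : Fin d, {w ∈ pc z0 (4 * r) | 7 * s < |Dxx i j u w|}) := measure_mono hsub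
    _ ≤ ∑ i : Fin d, ∑ j : Fin d, volume {w ∈ pc z0 (4 * r) | 7 * s < |Dxx i j u w|} :=
        (measure_iUnion_fintype_le _ _).trans (Finset.sum_le_sum fun i _ => measure_iUnion_fintype_le _ _)
    _ ≤ ∑ i : Fin d, ∑ j : Fin d, ofReal (N * θ ^ p0) * volume (pc z0 r) :=
        Finset.sum_le_sum fun i _ => Finset.sum_le_sum fun j _ => hcore b hbC u hu lam hl i j z0 r s θ hr hs hθ hθ1 hFk (hG1 i j)
    _ = ofReal (d * d * (N * θ ^ p0)) * volume (pc z0 r) := by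
        rw [ofReal_mul (by positivity : (0:ℝ) ≤ d * d), ofReal_mul hd0.le, ofReal_natCast]
        simp only [Finset.sum_const, Finset.card_univ, Fintype.card_fin, nsmul_eq_mul, mul_assoc]
    _ ≤ _ := by gcongr

lemma vol_cyl_ge {ρ : ℝ} (hρ : 0 < ρ) (t : ℝ) (x : Spc d) : ofReal (vv d * (ρ / 2) ^ (d + 2)) ≤ volume (cyl d ρ t x) := by
  rw [← vol_pc (t + ρ ^ 2 / 2, x) (by positivity : 0 < ρ / 2)]
  refine measure_mono ?_
  rintro w ⟨h1, h2⟩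
  have hs : 0 < ρ ^ 2 := by positivity
  refine ⟨⟨?_, ?_⟩, ball_subset_ball (by linarith) h2⟩
  · have := h1.1; dsimp only at this; nlinarith
  · have := h1.2; dsimp only at this; nlinarith

lemma vol_cyl_le {ρ : ℝ} (hρ : 0 < ρ) (t : ℝ) (x : Spc d) : volume (cyl d ρ t x) ≤ ofReal (vv d * ρ ^ (d + 2)) := by
  rw [← vol_pc (t, x) hρ]; exact measure_mono cyl_sub_pc

lemma vol_cyl_ne0 {ρ : ℝ} (hρ : 0 < ρ) (t : ℝ) (x : Spc d) : volume (cyl d ρ t x) ≠ 0 := by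
  have hv := vv_pos d
  intro h
  have := vol_cyl_ge hρ t x
  rw [h, nonpos_iff_eq_zero, ofReal_eq_zero] at this
  have h2 : 0 < vv d * (ρ / 2) ^ (d + 2) := by positivity
  linarith

lemma vol_cyl_net {ρ : ℝ} (hρ : 0 < ρ) (t : ℝ) (x : Spc d) : volume (cyl d ρ t x) ≠ ⊤ :=
  ((vol_cyl_le hρ t x).trans_lt ofReal_lt_top).ne

lemma rpow_split {ρ β p : ℝ} (hρ : 0 < ρ) : ρ ^ ((d:ℝ) + 2 - β * p) * (ρ ^ β) ^ p = ρ ^ (d + 2) := by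
  rw [← Real.rpow_mul hρ.le, ← Real.rpow_add hρ, ← Real.rpow_natCast]; push_cast; ring_nf

lemma mor_le {p β X : ℝ} (hp : 0 < p) (hX : 0 ≤ X) {g : Pt d → ℝ} (h : MB p (d + 2 - β * p) (fun z => |g z|) X) :
    morreyP p β g ≤ ofReal ((2 ^ (d + 2) / vv d * X) ^ (1 / p)) := by
  have hv := vv_pos d
  unfold morreyP
  refine iSup₂_le fun ρ hρ => iSup₂_le fun t x => ?_
  have h1 : ∫⁻ z in cyl d ρ t x, ofReal |g z| ^ p ≤ ofReal (X * ρ ^ ((d:ℝ) + 2 - β * p)) :=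
    (lintegral_mono_set cyl_sub_pc).trans (h (t, x) ρ hρ)
  have hpos : 0 < vv d * (ρ / 2) ^ (d + 2) := by positivity
  have h2 : (volume (cyl d ρ t x))⁻¹ * ∫⁻ z in cyl d ρ t x, ofReal |g z| ^ p ≤ ofReal ((2 ^ (d + 2) / vv d * X) / (ρ ^ β) ^ p) := by
    calc _ ≤ (ofReal (vv d * (ρ / 2) ^ (d + 2)))⁻¹ * ofReal (X * ρ ^ ((d:ℝ) + 2 - β * p)) :=
          mul_le_mul' (ENNReal.inv_le_inv.2 (vol_cyl_ge hρ t x)) h1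
      _ = _ := by
          rw [← ofReal_inv_of_pos hpos, ← ofReal_mul (by positivity)]
          congr 1
          have := rpow_split (d := d) (β := β) (p := p) hρ
          rw [div_pow, ← this]
          have : 0 < (ρ ^ β) ^ p := by positivity
          have : 0 < ρ ^ ((d:ℝ) + 2 - β * p) := by positivity
          field_simp
  have hρβ : 0 < ρ ^ β := by positivity
  calc _ ≤ ofReal (ρ ^ β) * (ofReal ((2 ^ (d + 2) / vv d * X) / (ρ ^ β) ^ p)) ^ (1 / p) := by gcongr
    _ = _ := by
      rw [ofReal_rpow_of_nonneg (by positivity) (by positivity), ← ofReal_mul hρβ.le, Real.div_rpow (by positivity) (by positivity),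
        ← Real.rpow_mul hρβ.le, mul_one_div_cancel hp.ne', Real.rpow_one]
      congr 1; field_simp

lemma MB_of_mor {p β Y : ℝ} (hp : 0 < p) (hY : 0 ≤ Y) {g : Pt d → ℝ} (h : morreyP p β g ≤ ofReal Y) :
    MB p (d + 2 - β * p) (fun z => |g z|) (vv d * 2 ^ ((d:ℝ) + 2 - β * p) * Y ^ p) := by
  intro z r hr
  have hv := vv_pos d
  set R := 2 * r with hR
  have hR0 : 0 < R := by positivity
  set C := cyl d R (z.1 - r ^ 2) z.2 with hC
  set I := ∫⁻ z in C, ofReal |g z| ^ p with hI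
  have hs : LI p (fun z => |g z|) (pc z r) ≤ I := lintegral_mono_set (pc_sub_cyl (t := z.1) (x := z.2) hr)
  have h1 : ofReal (R ^ β) * ((volume C)⁻¹ * I) ^ (1 / p) ≤ ofReal Y :=
    le_trans (le_iSup₂_of_le (f := fun ρ (_ : 0 < ρ) => ⨆ (t : ℝ) (x : Spc d), ofReal (ρ ^ β) *
      ((volume (cyl d ρ t x))⁻¹ * ∫⁻ z in cyl d ρ t x, ofReal |g z| ^ p) ^ (1 / p)) R hR0 (le_iSup₂_of_le (z.1 - r ^ 2) z.2 le_rfl)) h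
  have hRβ : 0 < R ^ β := by positivity
  have h2 : ((volume C)⁻¹ * I) ^ (1 / p) ≤ ofReal (Y / R ^ β) := by
    rw [ofReal_div_of_pos hRβ, ENNReal.le_div_iff_mul_le (Or.inl (by simpa using hRβ)) (Or.inl ofReal_ne_top), mul_comm]
    exact h1
  have h3 : (volume C)⁻¹ * I ≤ ofReal ((Y / R ^ β) ^ p) := by
    rw [one_div, ENNReal.rpow_inv_le_iff hp, ofReal_rpow_of_nonneg (by positivity) hp.le] at h2
    exact h2
  have h4 : I ≤ volume C * ofReal ((Y / R ^ β) ^ p) := by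
    have := mul_le_mul_right h3 (volume C)
    rwa [← mul_assoc, ENNReal.mul_inv_cancel (vol_cyl_ne0 hR0 _ _) (vol_cyl_net hR0 _ _), one_mul] at this
  refine hs.trans (h4.trans ?_)
  refine (mul_le_mul_left (vol_cyl_le hR0 _ _) _).trans ?_
  rw [← ofReal_mul (by positivity)]
  refine ofReal_le_ofReal (le_of_eq ?_)
  rw [Real.div_rpow hY hRβ.le, ← rpow_split (d := d) (β := β) (p := p) hR0]
  have : 0 < (R ^ β) ^ p := by positivity
  field_simp
  rw [hR, Real.mul_rpow zero_le_two hr.le]; ring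

lemma MB_fin {p e : ℝ} (hp : 0 < p) (he : 0 ≤ e) (he2 : e ≤ d + 2) {F : Pt d → ℝ} (hF : Nice F) : ∃ X, 0 ≤ X ∧ MB p e (fun z => |F z|) X := by
  have hv := vv_pos d
  obtain ⟨B, hB⟩ := hF.bdd
  have hB0 : 0 ≤ B := (abs_nonneg _).trans (hB 0)
  have hfin := hF.LI_lt_top hp
  set I := LI p (fun z => |F z|) univ with hI
  refine ⟨B ^ p * vv d + I.toReal, by positivity, fun z r hr => ?_⟩
  rcases le_total r 1 with h | h
  · have h1 : LI p (fun z => |F z|) (pc z r) ≤ ofReal (B ^ p) * volume (pc z r) := by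
      unfold LI
      rw [← setLIntegral_const]
      refine lintegral_mono fun w => ?_
      dsimp only
      rw [ofReal_rpow_of_nonneg (abs_nonneg _) hp.le]
      exact ofReal_le_ofReal (Real.rpow_le_rpow (abs_nonneg _) (hB w) hp.le)
    refine h1.trans ?_
    rw [vol_pc z hr, ← ofReal_mul (by positivity)]
    refine ofReal_le_ofReal ?_
    have h2 : r ^ (d + 2) ≤ r ^ e := by
      rw [← Real.rpow_natCast]; push_cast
      exact Real.rpow_le_rpow_of_exponent_ge hr h he2
    calc B ^ p * (vv d * r ^ (d + 2)) ≤ B ^ p * (vv d * r ^ e) := by gcongr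
      _ = B ^ p * vv d * r ^ e := by ring
      _ ≤ _ := by gcongr; linarith [toReal_nonneg (a := I)]
  · refine (lintegral_mono_set (subset_univ _)).trans ?_
    change I ≤ _
    rw [← ofReal_toReal hfin.ne]
    refine ofReal_le_ofReal ?_
    have h2 : 1 ≤ r ^ e := Real.one_le_rpow h he
    have h3 : 0 ≤ B ^ p * vv d := by positivity
    rw [ENNReal.toReal_ofReal toReal_nonneg]
    nlinarith [toReal_nonneg (a := I)]

lemma MB_neg {p e X : ℝ} (he : e < 0) {g : Pt d → ℝ} (h : MB p e g X) (z : Pt d) (r : ℝ) (hr : 0 < r) : LI p g (pc z r) = 0 := by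
  refine le_antisymm ?_ bot_le
  have h1 : Filter.Tendsto (fun R : ℝ => ofReal (X * R ^ e)) Filter.atTop (nhds 0) := by
    have h2 := (tendsto_rpow_neg_atTop (y := -e) (by linarith)).const_mul X
    rw [neg_neg, mul_zero] at h2
    have := ENNReal.tendsto_ofReal h2
    rwa [ofReal_zero] at this
  refine ge_of_tendsto h1 ?_
  filter_upwards [Filter.eventually_ge_atTop r] with R hR
  exact (lintegral_mono_set (pc_mono hr hR)).trans (h z R (hr.trans_le hR))

lemma main1 (d : ℕ) (hd : 1 ≤ d) {δ p β : ℝ} (hδ : 0 < δ) (hδ1 : δ ≤ 1) (hp : 1 < p) (hβ : 0 < β) :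
    ∃ aHat N : ℝ, 0 < aHat ∧ 0 < N ∧ ∀ a : Pt d → Mx d, Measurable a → (∀ z, inS d δ (a z)) → aSharp a ≤ ofReal aHat →
      ∀ lam : ℝ, 0 ≤ lam → ∀ u : Pt d → ℝ, CinfC u → morreyP p β (fun z => mnorm fun i j => Dxx i j u z) ≤
        ofReal N * morreyP p β (fun z => Dt u z + (∑ i, ∑ j, a z i j * Dxx i j u z) - lam * u z) := by
  have hv := vv_pos d
  have hp0 : 0 < p := by linarith
  have hd0 : (1:ℝ) ≤ d := by exact_mod_cast hd
  set e : ℝ := d + 2 - β * p with he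
  have hβp : 0 < β * p := by positivity
  set e' := max e 0 with he'
  obtain ⟨p0, hp01, hp02⟩ : ∃ p0, 1 < p0 ∧ p0 < min 2 p := exists_between (lt_min (by norm_num) hp)
  obtain ⟨q, hq1, hq2⟩ : ∃ q, p0 < q ∧ q < p := exists_between (hp02.trans_le (min_le_right _ _))
  have he'2 : e' < d + 2 := max_lt (by rw [he]; linarith) (by linarith)
  obtain ⟨η, hη, hAM⟩ := AM d (q := q) (p := p) (e := e') (K := 7 * d) (by linarith) hq2 he'2 (by linarith)
  obtain ⟨aHat, γ, haH, hγ, hGG⟩ := lu_GG d hd hδ hδ1 hp01 (hp02.trans_le (min_le_left _ _)) hq1 hη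
  obtain ⟨C, hC, hAM⟩ := hAM γ hγ
  set c := vv d * 2 ^ e with hc
  have hc0 : 0 < c := by positivity
  refine ⟨aHat, (2 ^ (d + 2) / vv d * (C * c)) ^ (1 / p), haH, by positivity, fun a ha hS hsh lam hl u hu => ?_⟩
  set f : Pt d → ℝ := fun z => Dt u z + (∑ i, ∑ j, a z i j * Dxx i j u z) - lam * u z with hf
  set H : Pt d → ℝ := fun z => mnorm fun i j => Dxx i j u z with hH
  by_cases hft : morreyP p β f = ⊤
  · rw [hft, ENNReal.mul_top]; · exact le_top
    rw [Ne, ofReal_eq_zero, not_le]; positivity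
  have hfin : Nice f := Lu_nice hu (a := fun z => a z) (mat_meas ha) (fun z k l => inS_entry hδ (hS z) k l) lam
  set Y := (morreyP p β f).toReal with hY
  have hY0 : 0 ≤ Y := toReal_nonneg
  have hYe : morreyP p β f = ofReal Y := (ofReal_toReal hft).symm
  have hMf := MB_of_mor hp0 hY0 hYe.le
  rw [← he, ← hc] at hMf
  have hHc : Continuous H := by
    have := fun i j => (hu.dxx i j).1.continuous
    simp only [hH, mnorm]; fun_prop
  have hHn : Nice H := by
    have hs : Nice (fun z => ∑ i, ∑ j, |Dxx i j u z|) := Nice.sum _ fun i => Nice.sum _ fun j => by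
      have h := (hu.dxx i j).nice
      obtain ⟨B, hB⟩ := h.bdd
      obtain ⟨R, hR, hs⟩ := h.supp
      exact ⟨h.meas.abs, ⟨B, fun z => by rw [abs_abs]; exact hB z⟩, R, hR, fun z hz => by rw [hs z hz, abs_zero]⟩
    obtain ⟨B, hB⟩ := hs.bdd
    obtain ⟨R, hR, hs'⟩ := hs.supp
    have hle : ∀ z i j, |Dxx i j u z| ≤ ∑ i, ∑ j, |Dxx i j u z| := fun z i j =>
      (Finset.single_le_sum (f := fun j => |Dxx i j u z|) (fun _ _ => abs_nonneg _) (Finset.mem_univ j)).trans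
      (Finset.single_le_sum (f := fun i => ∑ j, |Dxx i j u z|) (fun _ _ => Finset.sum_nonneg fun _ _ => abs_nonneg _) (Finset.mem_univ i))
    have hHle : ∀ z, H z ≤ d * ∑ i, ∑ j, |Dxx i j u z| := fun z => mnorm_le _ (by positivity) (hle z)
    refine ⟨hHc.measurable, ⟨d * B, fun z => ?_⟩, R, hR, fun z hz => ?_⟩
    · rw [abs_of_nonneg (mnorm_nonneg _)]
      refine (hHle z).trans ?_
      gcongr; exact (le_abs_self _).trans (hB z)
    · refine le_antisymm ((hHle z).trans_eq ?_) (mnorm_nonneg _)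
      rw [hs' z hz, mul_zero]
  obtain ⟨X, hX, hMH⟩ := MB_fin (e := e') hp0 (le_max_right _ _) he'2.le hHn
  have habs : (fun z => |H z|) = H := funext fun z => abs_of_nonneg (mnorm_nonneg _)
  rw [habs] at hMH
  have hGGu := hGG a ha hS hsh lam hl u hu
  have hgoal : MB p e H (C * (c * Y ^ p)) := by
    rcases le_or_gt 0 e with h0 | h0
    · have ee : e' = e := max_eq_left h0
      rw [ee] at hAM hMH
      exact hAM H (fun z => |f z|) hHc (fun z => mnorm_nonneg _) hfin.meas.abs (fun z => abs_nonneg _) hGGu X _ hX (by positivity) hMH hMf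
    · have := hAM H (fun z => |f z|) hHc (fun z => mnorm_nonneg _) hfin.meas.abs (fun z => abs_nonneg _) hGGu X 0 hX le_rfl hMH
        (fun z r hr => by rw [MB_neg h0 hMf z r hr]; exact bot_le)
      intro z r hr
      refine (this z r hr).trans ?_
      rw [mul_zero, zero_mul, ofReal_zero]; exact bot_le
  have := mor_le (β := β) (g := H) (X := C * (c * Y ^ p)) hp0 (by positivity) (by rw [habs]; exact hgoal)
  refine this.trans (le_of_eq ?_)
  rw [hYe, ← ofReal_mul (by positivity)]
  congr 1
  rw [show 2 ^ (d + 2) / vv d * (C * (c * Y ^ p)) = 2 ^ (d + 2) / vv d * (C * c) * Y ^ p by ring, Real.mul_rpow (by positivity) (by positivity),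
    ← Real.rpow_mul hY0, mul_one_div_cancel hp0.ne', Real.rpow_one]

lemma mor_mono {p β : ℝ} (hp : 1 < p) {g h : Pt d → ℝ} (H : ∀ z, |g z| ≤ |h z|) : morreyP p β g ≤ morreyP p β h := by
  have hp0 : 0 < p := by linarith
  unfold morreyP
  refine iSup₂_mono fun ρ hρ => iSup₂_mono fun t x => ?_
  have : ∫⁻ z in cyl d ρ t x, ofReal |g z| ^ p ≤ ∫⁻ z in cyl d ρ t x, ofReal |h z| ^ p :=
    lintegral_mono fun z => ENNReal.rpow_le_rpow (ofReal_le_ofReal (H z)) hp0.le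
  gcongr

lemma mor_add {p β : ℝ} (hp : 1 < p) {g h : Pt d → ℝ} (hg : Measurable g) (hh : Measurable h) :
    morreyP p β (fun z => g z + h z) ≤ morreyP p β g + morreyP p β h := by
  have hp0 : 0 < p := by linarith
  have hi : (0:ℝ) ≤ 1 / p := by positivity
  refine iSup₂_le fun ρ hρ => iSup₂_le fun t x => ?_
  have key : (∫⁻ z in cyl d ρ t x, ofReal |g z + h z| ^ p) ^ (1 / p) ≤
      (∫⁻ z in cyl d ρ t x, ofReal |g z| ^ p) ^ (1 / p) + (∫⁻ z in cyl d ρ t x, ofReal |h z| ^ p) ^ (1 / p) := by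
    refine le_trans ?_ (ENNReal.lintegral_Lp_add_le (μ := volume.restrict (cyl d ρ t x)) (f := fun z => ofReal |g z|) (g := fun z => ofReal |h z|)
      hg.abs.ennreal_ofReal.aemeasurable hh.abs.ennreal_ofReal.aemeasurable hp.le)
    refine ENNReal.rpow_le_rpow (lintegral_mono fun z => ENNReal.rpow_le_rpow ?_ hp0.le) hi
    simp only [Pi.add_apply]
    rw [← ofReal_add (abs_nonneg _) (abs_nonneg _)]
    exact ofReal_le_ofReal (abs_add_le _ _)
  have h1 : ∀ f : Pt d → ℝ, ofReal (ρ ^ β) * ((volume (cyl d ρ t x))⁻¹ * ∫⁻ z in cyl d ρ t x, ofReal |f z| ^ p) ^ (1 / p) ≤ morreyP p β f := fun f =>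
    le_iSup₂_of_le (f := fun ρ (_ : 0 < ρ) => ⨆ (t : ℝ) (x : Spc d), ofReal (ρ ^ β) *
      ((volume (cyl d ρ t x))⁻¹ * ∫⁻ z in cyl d ρ t x, ofReal |f z| ^ p) ^ (1 / p)) ρ hρ (le_iSup₂_of_le t x le_rfl)
  refine le_trans ?_ (add_le_add (h1 g) (h1 h))
  simp only [mul_rpow_of_nonneg _ _ hi]
  rw [← mul_add, ← mul_add]
  gcongr

lemma mor_smul_le {p β : ℝ} (hp : 1 < p) (c : ℝ) (g : Pt d → ℝ) :
    morreyP p β (fun z => c * g z) ≤ ofReal |c| * morreyP p β g := by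
  have hp0 : 0 < p := by linarith
  have hi : (0:ℝ) ≤ 1 / p := by positivity
  unfold morreyP
  simp only [ENNReal.mul_iSup]
  refine iSup₂_mono fun ρ hρ => iSup₂_mono fun t x => le_of_eq ?_
  have : ∀ z, ofReal |c * g z| ^ p = ofReal |c| ^ p * ofReal |g z| ^ p := fun z => by
    rw [abs_mul, ofReal_mul (abs_nonneg _), mul_rpow_of_nonneg _ _ hp0.le]
  simp only [this]
  rw [lintegral_const_mul' _ _ (ENNReal.rpow_ne_top_of_nonneg hp0.le ofReal_ne_top)]
  rw [mul_left_comm, mul_rpow_of_nonneg _ _ hi, ← ENNReal.rpow_mul, mul_one_div_cancel hp0.ne', ENNReal.rpow_one, mul_left_comm]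

lemma mor_smul {p β : ℝ} (hp : 1 < p) {c : ℝ} (hc : 0 ≤ c) (g : Pt d → ℝ) :
    morreyP p β (fun z => c * g z) = ofReal c * morreyP p β g := by
  refine le_antisymm ?_ ?_
  · have := mor_smul_le (β := β) hp c g; rwa [abs_of_nonneg hc] at this
  · rcases hc.eq_or_lt with rfl | h
    · simp
    · have := mor_smul_le (β := β) hp c⁻¹ (fun z => c * g z)
      simp only [inv_mul_cancel_left₀ h.ne'] at this
      rw [abs_of_pos (inv_pos.2 h), ofReal_inv_of_pos h] at this
      calc _ ≤ ofReal c * ((ofReal c)⁻¹ * _) := by gcongr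
        _ = _ := by rw [← mul_assoc, ENNReal.mul_inv_cancel (by simpa using h) ofReal_ne_top, one_mul]

lemma mor_shift {p β : ℝ} (v : Pt d) (g : Pt d → ℝ) : morreyP p β (fun z => g (z + v)) ≤ morreyP p β g := by
  refine iSup₂_le fun ρ hρ => iSup₂_le fun t x => ?_
  refine le_iSup₂_of_le (f := fun ρ (_ : 0 < ρ) => ⨆ (t : ℝ) (x : Spc d), ofReal (ρ ^ β) *
      ((volume (cyl d ρ t x))⁻¹ * ∫⁻ z in cyl d ρ t x, ofReal |g z| ^ p) ^ (1 / p)) ρ hρ (le_iSup₂_of_le (t + v.1) (x + v.2) (le_of_eq ?_))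
  have hpre : (fun z : Pt d => z + v) ⁻¹' cyl d ρ (t + v.1) (x + v.2) = cyl d ρ t x := by
    ext z
    simp only [cyl, mem_preimage, mem_prod, mem_Ioo, mem_ball, Prod.fst_add, Prod.snd_add, dist_add_right]
    constructor
    · rintro ⟨⟨h1, h2⟩, h3⟩; exact ⟨⟨by linarith, by linarith⟩, h3⟩
    · rintro ⟨⟨h1, h2⟩, h3⟩; exact ⟨⟨by linarith, by linarith⟩, h3⟩
  have : (volume : Measure (Pt d)).IsAddHaarMeasure := inferInstanceAs (Measure.prod volume volume).IsAddHaarMeasure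
  have hmp := measurePreserving_add_right (volume : Measure (Pt d)) v
  have hms : MeasurableSet (cyl d ρ (t + v.1) (x + v.2)) := measurableSet_Ioo.prod measurableSet_ball
  have h1 : volume (cyl d ρ t x) = volume (cyl d ρ (t + v.1) (x + v.2)) := by
    rw [← hpre]; exact hmp.measure_preimage hms.nullMeasurableSet
  have h2 : ∫⁻ z in cyl d ρ t x, ofReal |g (z + v)| ^ p = ∫⁻ z in cyl d ρ (t + v.1) (x + v.2), ofReal |g z| ^ p := by
    rw [← hpre]
    exact hmp.setLIntegral_comp_preimage_emb (measurableEmbedding_addRight v) (fun z => ofReal |g z| ^ p) _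
  rw [h1, h2]

lemma mor_sum {p β : ℝ} (hp : 1 < p) {ι : Type*} (S : Finset ι) {g : ι → Pt d → ℝ} (hg : ∀ i, Measurable (g i)) :
    morreyP p β (fun z => ∑ i ∈ S, g i z) ≤ ∑ i ∈ S, morreyP p β (g i) := by
  classical
  induction S using Finset.induction_on with
  | empty =>
    have := mor_smul (β := β) hp (le_refl 0) (fun _ : Pt d => (0:ℝ))
    simp only [zero_mul, ofReal_zero] at this
    simp [this]
  | insert i S hi ih =>
    simp only [Finset.sum_insert hi]
    exact (mor_add hp (hg i) (Finset.measurable_fun_sum S fun i _ => hg i)).trans (add_le_add le_rfl ih)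

lemma mor_zero {p β β' : ℝ} (hp : 1 < p) {g : Pt d → ℝ} (h : morreyP p β g = 0) : morreyP p β' g = 0 := by
  have hi : (0:ℝ) < 1 / p := by positivity
  unfold morreyP at h ⊢
  simp only [ENNReal.iSup_eq_zero, mul_eq_zero, ENNReal.rpow_eq_zero_iff_of_pos hi] at h ⊢
  intro ρ hρ t x
  rcases h ρ hρ t x with h | h
  · rw [ofReal_eq_zero] at h
    have : 0 < ρ ^ β := by positivity
    linarith
  · exact Or.inr h

lemma mor_neg {p β β' : ℝ} (hp : 1 < p) (he : (d:ℝ) + 2 - β * p < 0) {g : Pt d → ℝ} (h : morreyP p β g ≠ ⊤) : morreyP p β' g = 0 := by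
  have hp0 : 0 < p := by linarith
  have hM := MB_of_mor hp0 toReal_nonneg (ofReal_toReal h).ge
  have hi : (0:ℝ) < 1 / p := by positivity
  unfold morreyP
  simp only [ENNReal.iSup_eq_zero, mul_eq_zero, ENNReal.rpow_eq_zero_iff_of_pos hi]
  intro ρ hρ t x
  refine Or.inr (Or.inr (le_antisymm ?_ bot_le))
  exact (lintegral_mono_set cyl_sub_pc).trans (MB_neg he hM (t, x) ρ hρ).le

lemma mor_fin {p β : ℝ} (hp : 1 < p) (hβ : 0 < β) (he : 0 ≤ (d:ℝ) + 2 - β * p) {g : Pt d → ℝ} (hg : Nice g) : morreyP p β g ≠ ⊤ := by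
  have hp0 : 0 < p := by linarith
  obtain ⟨X, hX, h⟩ := MB_fin hp0 he (by nlinarith [mul_pos hβ hp0]) hg
  exact ((mor_le hp0 hX h).trans_lt ofReal_lt_top).ne

lemma mor_small {p β R : ℝ} (hp : 1 < p) (hβ : 0 < β) (he : 0 ≤ (d:ℝ) + 2 - β * p) (hR : 0 < R) :
    ∃ C, 0 < C ∧ ∀ κ, 0 ≤ κ → ∀ E : Pt d → ℝ, (∀ z, |E z| ≤ κ) → (∀ z, z ∉ pc (0 : Pt d) R → E z = 0) → morreyP p β E ≤ ofReal (C * κ) := by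
  have hms : MeasurableSet (pc (0 : Pt d) R) := measurableSet_Ioo.prod measurableSet_ball
  set χ : Pt d → ℝ := (pc (0 : Pt d) R).indicator (fun _ => 1) with hχ
  have hn : Nice χ := ⟨measurable_const.indicator hms, ⟨1, fun z => by
    by_cases h : z ∈ pc (0 : Pt d) R <;> simp [hχ, h]⟩, R, hR, fun z hz => by simp [hχ, hz]⟩
  have hf := mor_fin hp hβ he hn
  refine ⟨(morreyP p β χ).toReal + 1, by positivity, fun κ hκ E h1 h2 => ?_⟩
  have : morreyP p β E ≤ morreyP p β (fun z => κ * χ z) := mor_mono hp fun z => by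
    by_cases h : z ∈ pc (0 : Pt d) R
    · simpa [hχ, h, abs_of_nonneg hκ] using h1 z
    · rw [h2 z h, abs_zero]; exact abs_nonneg _
  refine this.trans ?_
  rw [mor_smul hp hκ, mul_comm, ofReal_mul (by positivity)]
  gcongr
  rw [ENNReal.le_ofReal_iff_toReal_le hf (by positivity)]; linarith

lemma mvt0 {φ φ' : ℝ → ℝ} {C h : ℝ} (hd : ∀ s, HasDerivAt φ (φ' s) s) (hb : ∀ s, |s| ≤ |h| → |φ' s| ≤ C) : |φ h - φ 0| ≤ C * |h| := by
  have := (convex_Icc (-|h|) |h|).norm_image_sub_le_of_norm_hasDerivWithin_le (f := φ) (f' := φ') (C := C) (x := 0) (y := h)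
    (fun s _ => (hd s).hasDerivWithinAt) (fun s hs => hb s (abs_le.2 hs)) ⟨by simp, by simp⟩ ⟨neg_abs_le h, le_abs_self h⟩
  simpa using this

lemma CinfC.line {u : Pt d → ℝ} (hu : CinfC u) (z v : Pt d) (s : ℝ) : HasDerivAt (fun s : ℝ => u (z + s • v)) (fderiv ℝ u (z + s • v) v) s := by
  have h1 : HasDerivAt (fun s : ℝ => z + s • v) ((1:ℝ) • v) s := ((hasDerivAt_id s).smul_const v).const_add z
  rw [one_smul] at h1
  exact (hu.diff (z + s • v)).hasFDerivAt.comp_hasDerivAt s h1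

lemma taylor1 {u : Pt d → ℝ} (hu : CinfC u) (v : Pt d) : ∃ C, 0 ≤ C ∧ ∀ z h, |u (z + h • v) - u z - h * fderiv ℝ u z v| ≤ C * h ^ 2 := by
  obtain ⟨B, hB⟩ := ((hu.dir v).dir v).nice.bdd
  have hB0 : 0 ≤ B := (abs_nonneg _).trans (hB 0)
  refine ⟨B, hB0, fun z h => ?_⟩
  have h1 : ∀ s, |fderiv ℝ u (z + s • v) v - fderiv ℝ u z v| ≤ B * |s| := fun s => by
    have := mvt0 (h := s) ((hu.dir v).line z v) (fun s _ => hB _)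
    simpa using this
  have h2 := mvt0 (h := h) (C := B * |h|) (fun s => ((hu.line z v s).sub ((hasDerivAt_id s).mul_const (fderiv ℝ u z v)))) (fun s hs => by
    rw [one_mul]; exact (h1 s).trans (by gcongr))
  simp only [Pi.sub_apply, id, zero_smul, add_zero, zero_mul, sub_zero] at h2
  rw [sub_right_comm, mul_assoc, abs_mul_abs_self, ← pow_two] at h2
  exact h2

lemma taylor2 {u : Pt d → ℝ} (hu : CinfC u) (v : Pt d) :
    ∃ C, 0 ≤ C ∧ ∀ z h, |u (z + h • v) + u (z + (-h) • v) - 2 * u z - h ^ 2 * fderiv ℝ (fun z => fderiv ℝ u z v) z v| ≤ C * |h| ^ 3 := by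
  obtain ⟨C, hC, hT⟩ := taylor1 (hu.dir v) v
  refine ⟨2 * C, by positivity, fun z h => ?_⟩
  set w := fderiv ℝ (fun z => fderiv ℝ u z v) z v with hw
  have hm : ∀ s, HasDerivAt (fun s : ℝ => u (z + (-s) • v)) (fderiv ℝ u (z + (-s) • v) v * (-1)) s := fun s =>
    HasDerivAt.comp (h₂ := fun s : ℝ => u (z + s • v)) s (hu.line z v (-s)) (hasDerivAt_neg s)
  have hq : ∀ s : ℝ, HasDerivAt (fun s : ℝ => s ^ 2 * w) (2 * s * w) s := fun s => by
    have := (hasDerivAt_pow 2 s).mul_const w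
    simpa using this
  have h2 := mvt0 (h := h) (C := 2 * C * h ^ 2) (fun s => (((hu.line z v s).add (hm s)).sub (hq s))) (fun s hs => by
    have e1 := abs_le.1 (hT z s)
    have e2 := abs_le.1 (hT z (-s))
    have e3 : s ^ 2 ≤ h ^ 2 := sq_le_sq.2 hs
    have e4 : C * s ^ 2 ≤ C * h ^ 2 := by gcongr
    rw [neg_sq] at e2
    rw [abs_le]
    constructor <;> linarith [e1.1, e1.2, e2.1, e2.2])
  simp only [Pi.sub_apply, Pi.add_apply, neg_zero, zero_smul, add_zero] at h2
  calc _ = |u (z + h • v) + u (z + -h • v) - h ^ 2 * w - (u z + u z - 0 ^ 2 * w)| := by congr 1; ring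
    _ ≤ _ := h2
    _ = _ := by rw [← sq_abs h]; ring

def Gen (p β : ℝ) (w g : Pt d → ℝ) : Prop := ∀ κ : ℝ, 0 < κ → ∃ s : ℝ, 0 ≤ s ∧ ∃ S : Pt d → ℝ, Measurable S ∧
  morreyP p β S ≤ ofReal s * morreyP p β w ∧ Measurable (fun z => S z - s * w z - g z) ∧ morreyP p β (fun z => S z - s * w z - g z) ≤ ofReal κ

lemma Gen.add {p β : ℝ} (hp : 1 < p) {w g g' : Pt d → ℝ} (h : Gen p β w g) (h' : Gen p β w g') : Gen p β w (fun z => g z + g' z) := by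
  intro κ hκ
  obtain ⟨s, hs, S, hS, h1, h2, h3⟩ := h (κ / 2) (by positivity)
  obtain ⟨s', hs', S', hS', h1', h2', h3'⟩ := h' (κ / 2) (by positivity)
  have e : (fun z => (S z + S' z) - (s + s') * w z - (g z + g' z)) = fun z => (S z - s * w z - g z) + (S' z - s' * w z - g' z) := by
    funext z; ring
  refine ⟨s + s', by positivity, fun z => S z + S' z, hS.add hS', ?_, ?_, ?_⟩
  · refine (mor_add hp hS hS').trans ?_
    rw [ofReal_add hs hs', add_mul]
    exact add_le_add h1 h1'
  · rw [e]; exact h2.add h2'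
  · rw [e]
    refine (mor_add hp h2 h2').trans ((add_le_add h3 h3').trans_eq ?_)
    rw [← ofReal_add (by positivity) (by positivity), add_halves]

lemma Gen.res {p β lam : ℝ} (hp : 1 < p) (hl : 0 ≤ lam) {w g : Pt d → ℝ} (hw : Measurable w) (hg : Measurable g) (hf : morreyP p β w ≠ ⊤) (h : Gen p β w g) :
    ofReal lam * morreyP p β w ≤ morreyP p β (fun z => g z - lam * w z) := by
  refine ENNReal.le_of_forall_pos_le_add fun κ hκ _ => ?_
  obtain ⟨s, hs, S, hS, h1, h2, h3⟩ := h κ hκ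
  have e : (fun z => (lam + s) * w z) = fun z => (S z + (-1) * (g z - lam * w z)) + (-1) * (S z - s * w z - g z) := by funext z; ring
  have hgm : Measurable (fun z => g z - lam * w z) := hg.sub (hw.const_mul _)
  have h4 : morreyP p β (fun z => (lam + s) * w z) ≤ ofReal s * morreyP p β w + morreyP p β (fun z => g z - lam * w z) + ofReal κ := by
    rw [e]
    refine (mor_add hp (hS.add (hgm.const_mul _)) (h2.const_mul _)).trans (add_le_add ((mor_add hp hS (hgm.const_mul _)).trans (add_le_add h1 ?_)) ?_)
    · exact (mor_smul_le hp _ _).trans (by simp)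
    · exact (mor_smul_le hp _ _).trans (by simpa using h3)
  rw [mor_smul hp (by positivity), ofReal_add hl hs, add_mul, add_comm, add_assoc] at h4
  have := (ENNReal.add_le_add_iff_left (ENNReal.mul_ne_top ofReal_ne_top hf)).1 h4
  simpa using this

lemma supp_shift {u : Pt d → ℝ} (hu : CinfC u) : ∃ R, 0 < R ∧ ∀ z v : Pt d, ‖v‖ ≤ 1 → z ∉ pc (0 : Pt d) R → u (z + v) = 0 := by
  obtain ⟨R, hR, hs⟩ := hu.nice.supp
  refine ⟨R + 1, by positivity, fun z v hv hz => ?_⟩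
  refine hs _ fun hm => hz ?_
  have hv1 : |v.1| ≤ 1 := (norm_fst_le v).trans hv
  have hv2 : ‖v.2‖ ≤ 1 := (norm_snd_le v).trans hv
  obtain ⟨⟨h1, h2⟩, h3⟩ := hm
  simp only [Prod.fst_add, Prod.snd_add, Prod.fst_zero, Prod.snd_zero, mem_ball, dist_zero_right] at h1 h2 h3
  refine ⟨⟨?_, ?_⟩, ?_⟩
  · simp only [Prod.fst_zero]; nlinarith [abs_le.1 hv1]
  · simp only [Prod.fst_zero]; nlinarith [abs_le.1 hv1]
  · simp only [Prod.snd_zero, mem_ball, dist_zero_right]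
    have := norm_sub_norm_le z.2 (-v.2)
    rw [sub_neg_eq_add, norm_neg] at this
    linarith

lemma pc_mono' {R R' : ℝ} (hR : 0 < R) (h : R ≤ R') {z : Pt d} (hz : z ∉ pc (0 : Pt d) R') : z ∉ pc (0 : Pt d) R := fun h' => hz (pc_mono hR h h')

lemma gen1 {p β : ℝ} (hp : 1 < p) (hβ : 0 < β) (he : 0 ≤ (d:ℝ) + 2 - β * p) {u : Pt d → ℝ} (hu : CinfC u) {v : Pt d} (hv : ‖v‖ ≤ 1) :
    Gen p β u (fun z => fderiv ℝ u z v) := by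
  obtain ⟨R, hR, hs⟩ := supp_shift hu
  obtain ⟨R', hR', hs'⟩ := supp_shift (hu.dir v)
  obtain ⟨C, hC, hT⟩ := taylor1 hu v
  obtain ⟨K, hK, hKs⟩ := mor_small (d := d) (p := p) (β := β) (R := max R R') hp hβ he (lt_max_of_lt_left hR)
  intro κ hκ
  set h := min 1 (κ / (K * (C + 1))) with hh
  have h0 : 0 < h := by positivity
  have h1 : h ≤ 1 := min_le_left _ _
  have h2 : K * (C * h) ≤ κ := by
    have : h ≤ κ / (K * (C + 1)) := min_le_right _ _
    rw [le_div_iff₀ (by positivity)] at this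
    nlinarith [mul_pos hK h0]
  have hm := hu.nice.meas
  have hS : Measurable (fun z => h⁻¹ * u (z + h • v)) := (hm.comp (measurable_id.add_const _)).const_mul _
  refine ⟨h⁻¹, by positivity, fun z => h⁻¹ * u (z + h • v), hS, ?_, (hS.sub (hm.const_mul _)).sub (hu.dir v).nice.meas, ?_⟩
  · rw [mor_smul hp (by positivity)]; gcongr; exact mor_shift _ _
  · refine (hKs (C * h) (by positivity) _ (fun z => ?_) (fun z hz => ?_)).trans (ofReal_le_ofReal h2)
    · have : h⁻¹ * u (z + h • v) - h⁻¹ * u z - fderiv ℝ u z v = h⁻¹ * (u (z + h • v) - u z - h * fderiv ℝ u z v) := by field_simp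
      rw [this, abs_mul, abs_of_pos (by positivity : 0 < h⁻¹), inv_mul_le_iff₀ h0]
      exact (hT z h).trans_eq (by ring)
    · have a1 := hs z (h • v) (by rw [norm_smul, Real.norm_of_nonneg h0.le]; nlinarith [norm_nonneg v]) (pc_mono' hR (le_max_left _ _) hz)
      have a2 := hs z 0 (by simp) (pc_mono' hR (le_max_left _ _) hz)
      have a3 := hs' z 0 (by simp) (pc_mono' hR' (le_max_right _ _) hz)
      rw [add_zero] at a2 a3
      dsimp only; rw [a1, a2, a3]; simp

lemma gen2 {p β : ℝ} (hp : 1 < p) (hβ : 0 < β) (he : 0 ≤ (d:ℝ) + 2 - β * p) {u : Pt d → ℝ} (hu : CinfC u) {v : Pt d} (hv : ‖v‖ ≤ 1) :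
    Gen p β u (fun z => fderiv ℝ (fun z => fderiv ℝ u z v) z v) := by
  obtain ⟨R, hR, hs⟩ := supp_shift hu
  obtain ⟨R', hR', hs'⟩ := supp_shift ((hu.dir v).dir v)
  obtain ⟨C, hC, hT⟩ := taylor2 hu v
  obtain ⟨K, hK, hKs⟩ := mor_small (d := d) (p := p) (β := β) (R := max R R') hp hβ he (lt_max_of_lt_left hR)
  intro κ hκ
  set h := min 1 (κ / (K * (C + 1))) with hh
  have h0 : 0 < h := by positivity
  have h1 : h ≤ 1 := min_le_left _ _
  have h2 : K * (C * h) ≤ κ := by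
    have : h ≤ κ / (K * (C + 1)) := min_le_right _ _
    rw [le_div_iff₀ (by positivity)] at this
    nlinarith [mul_pos hK h0]
  have hm := hu.nice.meas
  have hq : 0 < (h ^ 2)⁻¹ := by positivity
  have hS1 : Measurable (fun z => u (z + h • v)) := hm.comp (measurable_id.add_const _)
  have hS2 : Measurable (fun z => u (z + (-h) • v)) := hm.comp (measurable_id.add_const _)
  have hS : Measurable (fun z => (h ^ 2)⁻¹ * (u (z + h • v) + u (z + (-h) • v))) := (hS1.add hS2).const_mul _
  refine ⟨(h ^ 2)⁻¹ * 2, by positivity, _, hS, ?_, (hS.sub (hm.const_mul _)).sub ((hu.dir v).dir v).nice.meas, ?_⟩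
  · rw [mor_smul hp hq.le, ofReal_mul hq.le, mul_assoc]; gcongr
    refine (mor_add hp hS1 hS2).trans ((add_le_add (mor_shift _ _) (mor_shift _ _)).trans_eq ?_)
    rw [ofReal_ofNat, two_mul]
  · refine (hKs (C * h) (by positivity) _ (fun z => ?_) (fun z hz => ?_)).trans (ofReal_le_ofReal h2)
    · set w := fderiv ℝ (fun z => fderiv ℝ u z v) z v with hw
      have : (h ^ 2)⁻¹ * (u (z + h • v) + u (z + (-h) • v)) - (h ^ 2)⁻¹ * 2 * u z - w = (h ^ 2)⁻¹ * (u (z + h • v) + u (z + (-h) • v) - 2 * u z - h ^ 2 * w) := by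
        field_simp
      rw [this, abs_mul, abs_of_pos hq, inv_mul_le_iff₀ (by positivity)]
      exact (hT z h).trans_eq (by rw [abs_of_pos h0]; ring)
    · have hn : ‖h • v‖ ≤ 1 := by rw [norm_smul, Real.norm_of_nonneg h0.le]; nlinarith [norm_nonneg v]
      have a1 := hs z (h • v) hn (pc_mono' hR (le_max_left _ _) hz)
      have a4 := hs z ((-h) • v) (by rw [neg_smul, norm_neg]; exact hn) (pc_mono' hR (le_max_left _ _) hz)
      have a2 := hs z 0 (by simp) (pc_mono' hR (le_max_left _ _) hz)
      have a3 := hs' z 0 (by simp) (pc_mono' hR' (le_max_right _ _) hz)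
      rw [add_zero] at a2 a3
      dsimp only; rw [a1, a2, a3, a4]; simp

lemma nv (i : Fin d) : ‖((0, EuclideanSpace.single i 1) : Pt d)‖ ≤ 1 := by
  simp [Prod.norm_def]

lemma Dxx_fd {u : Pt d → ℝ} (hu : CinfC u) (i j : Fin d) :
    Dxx i j u = fun z => fderiv ℝ (fun z => fderiv ℝ u z (0, EuclideanSpace.single j 1)) z (0, EuclideanSpace.single i 1) := by
  unfold Dxx
  rw [(hu.dx j).Dx_eq, hu.Dx_eq]

lemma lam_u {p β lam : ℝ} (hp : 1 < p) (hβ : 0 < β) (he : 0 ≤ (d:ℝ) + 2 - β * p) (hl : 0 ≤ lam) {u : Pt d → ℝ} (hu : CinfC u) :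
    ofReal lam * morreyP p β u ≤ morreyP p β (fun z => (Dt u z + ∑ i, Dxx i i u z) - lam * u z) := by
  have hm := hu.nice.meas
  have hs : ∀ S : Finset (Fin d), Gen p β u (fun z => Dt u z + ∑ i ∈ S, Dxx i i u z) := fun S => by
    classical
    induction S using Finset.induction_on with
    | empty =>
      simp only [Finset.sum_empty, add_zero, hu.Dt_eq]
      exact gen1 hp hβ he hu (by simp [Prod.norm_def])
    | insert i S hi ih =>
      have h2 : Gen p β u (Dxx i i u) := by rw [Dxx_fd hu]; exact gen2 hp hβ he hu (nv i)
      have := ih.add hp h2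
      refine cast ?_ this
      congr 1; funext z; rw [Finset.sum_insert hi]; ring
  exact (hs Finset.univ).res hp hl hm (hu.dt.nice.meas.add (Finset.measurable_fun_sum _ fun i _ => (hu.dxx i i).nice.meas)) (mor_fin hp hβ he hu.nice)

lemma lam_Du {p β μ : ℝ} (hp : 1 < p) (hβ : 0 < β) (he : 0 ≤ (d:ℝ) + 2 - β * p) (hl : 0 ≤ μ) {u : Pt d → ℝ} (hu : CinfC u) (i : Fin d) :
    ofReal μ * morreyP p β (Dx i u) ≤ morreyP p β (Dxx i i u) + 2 * (ofReal (μ ^ 2) * morreyP p β u) := by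
  have hm := hu.nice.meas
  have hi := hu.dx i
  have hw : CinfC (fun z => Dx i u z + μ * u z) := ⟨hi.1.add (contDiff_const.mul hu.1), hi.2.add (HasCompactSupport.mul_left hu.2)⟩
  have hg : (fun z => fderiv ℝ (fun z => Dx i u z + μ * u z) z (0, EuclideanSpace.single i 1)) = fun z => Dxx i i u z + μ * Dx i u z := by
    funext z
    rw [fderiv_fun_add (hi.diff z) ((hu.diff z).const_mul μ), fderiv_const_mul (hu.diff z)]
    unfold Dxx
    rw [hi.Dx_eq, hu.Dx_eq]
    simp
  have h1 := gen1 hp hβ he hw (nv i)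
  rw [hg] at h1
  have h2 := h1.res hp hl hw.nice.meas (show Measurable fun z => Dxx i i u z + μ * Dx i u z from (hu.dxx i i).nice.meas.add (hi.nice.meas.const_mul _)) (mor_fin hp hβ he hw.nice)
  have e : (fun z => Dxx i i u z + μ * Dx i u z - μ * (Dx i u z + μ * u z)) = fun z => Dxx i i u z + (-μ ^ 2) * u z := by funext z; ring
  rw [e] at h2
  have h3 : morreyP p β (fun z => Dxx i i u z + (-μ ^ 2) * u z) ≤ morreyP p β (Dxx i i u) + ofReal (μ ^ 2) * morreyP p β u := by
    refine (mor_add hp (hu.dxx i i).nice.meas (hm.const_mul _)).trans (add_le_add le_rfl ((mor_smul_le hp _ _).trans_eq ?_))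
    rw [abs_neg, abs_of_nonneg (sq_nonneg μ)]
  have h4 : morreyP p β (Dx i u) ≤ morreyP p β (fun z => Dx i u z + μ * u z) + ofReal μ * morreyP p β u := by
    have e2 : Dx i u = fun z => (Dx i u z + μ * u z) + (-μ) * u z := by funext z; ring
    conv_lhs => rw [e2]
    refine (mor_add hp hw.nice.meas (hm.const_mul _)).trans (add_le_add le_rfl ((mor_smul_le hp _ _).trans_eq ?_))
    rw [abs_neg, abs_of_nonneg hl]
  calc _ ≤ ofReal μ * (morreyP p β (fun z => Dx i u z + μ * u z) + ofReal μ * morreyP p β u) := by gcongr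
    _ = ofReal μ * morreyP p β (fun z => Dx i u z + μ * u z) + ofReal (μ ^ 2) * morreyP p β u := by
      rw [mul_add, ← mul_assoc (ofReal μ) (ofReal μ), ← ofReal_mul hl, pow_two]
    _ ≤ (morreyP p β (Dxx i i u) + ofReal (μ ^ 2) * morreyP p β u) + ofReal (μ ^ 2) * morreyP p β u := by gcongr; exact h2.trans h3
    _ = _ := by rw [two_mul, add_assoc]

lemma vnorm_le (v : Fin d → ℝ) : vnorm v ≤ ∑ i, |v i| := by
  unfold vnorm
  rw [Real.sqrt_le_left (Finset.sum_nonneg fun _ _ => abs_nonneg _)]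
  calc ∑ i, v i ^ 2 = ∑ i, |v i| ^ 2 := by simp
    _ ≤ _ := Finset.sum_sq_le_sq_sum_of_nonneg fun _ _ => abs_nonneg _

lemma main2 (d : ℕ) (hd : 1 ≤ d) {δ p β : ℝ} (hδ : 0 < δ) (hδ1 : δ ≤ 1) (hp : 1 < p) (hβ : 0 < β) (he : 0 ≤ (d:ℝ) + 2 - β * p) :
    ∃ aHat N : ℝ, 0 < aHat ∧ 0 < N ∧
      ∀ a : Pt d → Mx d, Measurable a → (∀ z, inS d δ (a z)) →
        aSharp a ≤ ofReal aHat →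
      ∀ lam : ℝ, 0 ≤ lam → ∀ u : Pt d → ℝ, CinfC u →
        ofReal lam * morreyP p β u +
          ofReal (sqrt lam) *
            morreyP p β (fun z => vnorm fun i => Dx i u z) +
          morreyP p β (Dt u) + morreyP p β (fun z => mnorm fun i j => Dxx i j u z) ≤
          ofReal N *
            morreyP p β
              (fun z => Dt u z + (∑ i, ∑ j, a z i j * Dxx i j u z) - lam * u z) := by
  obtain ⟨aHat, N, haH, hN, hM⟩ := main1 d hd hδ hδ1 hp hβ
  set M : ℝ := d * (δ⁻¹ + 1) with hMd
  have hM0 : 0 ≤ M := by positivity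
  refine ⟨aHat, (1 + M * N) + (d * (N + 2 * (1 + M * N))) + (1 + M * N + (1 + M * N)) + N, haH, by positivity, fun a ha hS hsh lam hl u hu => ?_⟩
  have hH := hM a ha hS hsh lam hl u hu
  set f : Pt d → ℝ := fun z => Dt u z + (∑ i, ∑ j, a z i j * Dxx i j u z) - lam * u z with hf
  set H : Pt d → ℝ := fun z => mnorm fun i j => Dxx i j u z with hHd
  have hfn : Nice f := Lu_nice hu (a := fun z => a z) (mat_meas ha) (fun z k l => inS_entry hδ (hS z) k l) lam
  have hDm : ∀ i j, Measurable (Dxx i j u) := fun i j => (hu.dxx i j).nice.meas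
  have hHm : Measurable H := mnorm_meas (A := fun z i j => Dxx i j u z) hDm
  set F := morreyP p β f with hF
  have hmon : ∀ (A : Pt d → Fin d → Fin d → ℝ), (∀ z i j, |A z i j| ≤ δ⁻¹ + 1) →
      morreyP p β (fun z => ∑ i, ∑ j, A z i j * Dxx i j u z) ≤ ofReal (M * N) * F := fun A hA => by
    calc _ ≤ morreyP p β (fun z => M * H z) := mor_mono hp fun z => by
          refine (mnorm_cs _ _).trans (le_trans ?_ (le_abs_self _))
          exact mul_le_mul_of_nonneg_right (mnorm_le _ (by positivity) (hA z)) (mnorm_nonneg _)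
      _ = ofReal M * morreyP p β H := mor_smul hp hM0 _
      _ ≤ ofReal M * (ofReal N * F) := by gcongr
      _ = _ := by rw [← mul_assoc, ← ofReal_mul hM0]
  have hae : ∀ z i j, |a z i j| ≤ δ⁻¹ := fun z i j => inS_entry hδ (hS z) i j
  have hAm : ∀ A : Pt d → Fin d → Fin d → ℝ, (∀ i j, Measurable fun z => A z i j) → Measurable (fun z => ∑ i, ∑ j, A z i j * Dxx i j u z) := fun A hA =>
    Finset.measurable_fun_sum _ fun i _ => Finset.measurable_fun_sum _ fun j _ => (hA i j).mul (hDm i j)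
  have T1 : ofReal lam * morreyP p β u ≤ ofReal (1 + M * N) * F := by
    refine (lam_u hp hβ he hl hu).trans ?_
    set A : Pt d → Fin d → Fin d → ℝ := fun z i j => (if i = j then 1 else 0) - a z i j with hA
    have e : (fun z => (Dt u z + ∑ i, Dxx i i u z) - lam * u z) = fun z => f z + ∑ i, ∑ j, A z i j * Dxx i j u z := by
      funext z
      simp only [hA, hf, sub_mul, Finset.sum_sub_distrib, ite_mul, one_mul, zero_mul, Finset.sum_ite_eq, Finset.mem_univ, if_true]
      ring
    rw [e]
    refine (mor_add hp hfn.meas (hAm A fun i j => measurable_const.sub (mat_meas ha i j))).trans ?_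
    rw [ofReal_add zero_le_one (by positivity), add_mul, ofReal_one, one_mul]
    refine add_le_add le_rfl (hmon A fun z i j => ?_)
    refine (abs_sub _ _).trans ?_
    rw [add_comm]
    refine add_le_add (hae z i j) ?_
    split_ifs <;> simp
  have T2 : ofReal (sqrt lam) * morreyP p β (fun z => vnorm fun i => Dx i u z) ≤ ofReal (d * (N + 2 * (1 + M * N))) * F := by
    have h1 : morreyP p β (fun z => vnorm fun i => Dx i u z) ≤ ∑ i, morreyP p β (Dx i u) := by
      calc _ ≤ morreyP p β (fun z => ∑ i, |Dx i u z|) := mor_mono hp fun z => by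
            rw [abs_of_nonneg (show 0 ≤ vnorm _ from Real.sqrt_nonneg _)]; exact (vnorm_le _).trans (le_abs_self _)
        _ ≤ ∑ i, morreyP p β (fun z => |Dx i u z|) := mor_sum hp _ fun i => (hu.dx i).nice.meas.abs
        _ ≤ _ := Finset.sum_le_sum fun i _ => mor_mono hp fun z => by rw [abs_abs]
    have h2 : ∀ i, ofReal (sqrt lam) * morreyP p β (Dx i u) ≤ ofReal (N + 2 * (1 + M * N)) * F := fun i => by
      refine (lam_Du hp hβ he (Real.sqrt_nonneg _) hu i).trans ?_
      rw [Real.sq_sqrt hl, ofReal_add hN.le (by positivity), add_mul, ofReal_mul zero_le_two, ofReal_ofNat, mul_assoc]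
      refine add_le_add (le_trans (mor_mono hp fun z => ?_) hH) (by gcongr)
      exact (le_mnorm (fun i j => Dxx i j u z) i i).trans (le_abs_self _)
    calc _ ≤ ofReal (sqrt lam) * ∑ i, morreyP p β (Dx i u) := by gcongr
      _ = ∑ i, ofReal (sqrt lam) * morreyP p β (Dx i u) := Finset.mul_sum _ _ _
      _ ≤ ∑ _i : Fin d, ofReal (N + 2 * (1 + M * N)) * F := Finset.sum_le_sum fun i _ => h2 i
      _ = _ := by
        rw [Finset.sum_const, Finset.card_univ, Fintype.card_fin, nsmul_eq_mul, ofReal_mul (by positivity), ofReal_natCast, ← mul_assoc]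
  have T3 : morreyP p β (Dt u) ≤ ofReal (1 + M * N + (1 + M * N)) * F := by
    have e : Dt u = fun z => (f z + ∑ i, ∑ j, (-a z i j) * Dxx i j u z) + lam * u z := by
      funext z
      simp only [hf, neg_mul, Finset.sum_neg_distrib]; ring
    have hm2 := hAm (fun z i j => -a z i j) fun i j => (mat_meas ha i j).neg
    rw [e]
    refine (mor_add hp (hfn.meas.add hm2) (hu.nice.meas.const_mul _)).trans ?_
    rw [ofReal_add (by positivity) (by positivity), add_mul]
    refine add_le_add ((mor_add hp hfn.meas hm2).trans ?_) ?_
    · rw [ofReal_add zero_le_one (by positivity), add_mul, ofReal_one, one_mul]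
      refine add_le_add le_rfl (hmon (fun z i j => -a z i j) fun z i j => ?_)
      rw [abs_neg]; linarith [hae z i j]
    · rw [mor_smul hp hl]; exact T1
  rw [ofReal_add (by positivity) hN.le, ofReal_add (by positivity) (by positivity), ofReal_add (by positivity) (by positivity), add_mul, add_mul, add_mul]
  exact add_le_add (add_le_add (add_le_add T1 T2) T3) hH

end

theorem stmt16 (d : ℕ) (hd : 1 ≤ d) (δ : ℝ) (hδ0 : 0 < δ) (hδ1 : δ ≤ 1)
    (p β : ℝ) (hp : 1 < p) (hβ : 0 < β) :
    ∃ aHat N : ℝ, 0 < aHat ∧ 0 < N ∧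
      ∀ a : Pt d → Matrix (Fin d) (Fin d) ℝ, Measurable a → (∀ z, inS d δ (a z)) →
        aSharp a ≤ ENNReal.ofReal aHat →
      ∀ lam : ℝ, 0 ≤ lam → ∀ u : Pt d → ℝ, CinfC u →
        ENNReal.ofReal lam * morreyP p β u +
          ENNReal.ofReal (Real.sqrt lam) *
            morreyP p β (fun z => vnorm fun i => Dx i u z) +
          morreyP p β (Dt u) + morreyP p β (fun z => mnorm fun i j => Dxx i j u z) ≤
          ENNReal.ofReal N *
            morreyP p β
              (fun z => Dt u z + (∑ i, ∑ j, a z i j * Dxx i j u z) - lam * u z) := by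
  have hp0 : 0 < p := by linarith
  rcases le_or_gt 0 ((d:ℝ) + 2 - β * p) with he | he
  · exact main2 d hd hδ0 hδ1 hp hβ he
  · have hd2 : (0:ℝ) < d + 2 := by positivity
    obtain ⟨aHat, N, h1, h2, h3⟩ := main2 d hd hδ0 hδ1 hp (β := (d + 2) / p) (by positivity) (by rw [div_mul_cancel₀ _ hp0.ne']; simp)
    refine ⟨aHat, N, h1, h2, fun a ha hS hsh lam hl u hu => ?_⟩
    by_cases hf : morreyP p β (fun z => Dt u z + (∑ i, ∑ j, a z i j * Dxx i j u z) - lam * u z) = ⊤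
    · rw [hf, ENNReal.mul_top (by rw [Ne, ENNReal.ofReal_eq_zero, not_le]; exact h2)]; exact le_top
    have h4 := h3 a ha hS hsh lam hl u hu
    rw [mor_neg hp he hf, mul_zero, nonpos_iff_eq_zero] at h4
    simp only [add_eq_zero, mul_eq_zero] at h4
    obtain ⟨⟨⟨k1, k2⟩, k3⟩, k4⟩ := h4
    have e1 : ENNReal.ofReal lam * morreyP p β u = 0 := mul_eq_zero.2 (k1.imp id (mor_zero hp))
    have e2 : ENNReal.ofReal (Real.sqrt lam) * morreyP p β (fun z => vnorm fun i => Dx i u z) = 0 := mul_eq_zero.2 (k2.imp id (mor_zero hp))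
    rw [e1, e2, mor_zero hp k3, mor_zero hp k4]
    simp
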